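/- arXiv:1310.2339 — 4 statements merged into one kernel-verified Lean document; each statement's English description precedes it below -/
import Mathlib

section
/- Suppose a < 0, a + b < 0 and 2b + a > 0. Then, almost surely, limsup_{t→∞} |X(t) − U(t)| / t^{−1−b/a} is finite (i.e. lies in [0,∞)). -/
open MeasureTheory ProbabilityTheory Filter Real Set

noncomputable section

/-- `B` is a standard one-dimensional Brownian motion adapted to the filtration `F`
under the probability measure `P`: all paths are continuous and start at `0`, the
increment `B t - B s` is Gaussian with mean `0` and variance `t - s`, and increments
after time `s` are independent of `F s`. -/
def IsStdBrownian {Ω : Type*} {mΩ : MeasurableSpace Ω} (P : Measure Ω)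
    (F : MeasureTheory.Filtration ℝ mΩ) (B : ℝ → Ω → ℝ) : Prop :=
  MeasureTheory.Adapted F B ∧
  (∀ ω, B 0 ω = 0) ∧
  (∀ ω, Continuous fun t => B t ω) ∧
  (∀ s t : ℝ, 0 ≤ s → s ≤ t →
    P.map (fun ω => B t ω - B s ω) = gaussianReal 0 (Real.toNNReal (t - s))) ∧
  (∀ s t : ℝ, 0 ≤ s → s ≤ t →
    Indep (MeasurableSpace.comap (fun ω => B t ω - B s ω) Real.measurableSpace) (F s) P)

/-- `X` is the (continuous, adapted) solution of the affine stochastic functional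
differential equation `dX(t) = (a X(t) + b/(1+t) ∫_{-1}^t X(s) ds) dt + σ dB(t)` for
`t ≥ 0`, with initial history `ψ` on `[-1, 0]`; i.e. almost surely, for all `t ≥ 0`,
`X t = ψ 0 + ∫_0^t (a X(s) + b/(1+s) (∫_{-1}^0 ψ(u) du + ∫_0^s X(u) du)) ds + σ B t`. -/
def IsSolutionSFDE {Ω : Type*} {mΩ : MeasurableSpace Ω} (P : Measure Ω)
    (F : MeasureTheory.Filtration ℝ mΩ) (a b σ : ℝ) (ψ : ℝ → ℝ)
    (B X : ℝ → Ω → ℝ) : Prop :=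
  (∀ t : ℝ, 0 ≤ t → StronglyMeasurable[F t] (X t)) ∧
  (∀ ω, ContinuousOn (fun t => X t ω) (Set.Ici (0 : ℝ))) ∧
  (∀ᵐ ω ∂P, ∀ t : ℝ, 0 ≤ t →
    X t ω = ψ 0
      + (∫ s in (0:ℝ)..t,
          (a * X s ω + b / (1 + s) * ((∫ u in (-1:ℝ)..(0:ℝ), ψ u) + ∫ u in (0:ℝ)..s, X u ω)))
      + σ * B t ω)

/-- `U` is the Ornstein–Uhlenbeck process driven by `σ B` with `U 0 = 0`: the
(continuous, adapted) process with, almost surely, `U t = a ∫_0^t U(s) ds + σ B t`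
for all `t ≥ 0`. -/
def IsOUProcess {Ω : Type*} {mΩ : MeasurableSpace Ω} (P : Measure Ω)
    (F : MeasureTheory.Filtration ℝ mΩ) (a σ : ℝ) (B U : ℝ → Ω → ℝ) : Prop :=
  (∀ t : ℝ, 0 ≤ t → StronglyMeasurable[F t] (U t)) ∧
  (∀ ω, ContinuousOn (fun t => U t ω) (Set.Ici (0 : ℝ))) ∧
  (∀ᵐ ω ∂P, ∀ t : ℝ, 0 ≤ t →
    U t ω = a * (∫ s in (0:ℝ)..t, U s ω) + σ * B t ω)

/-- One-sided comparison: a solution of `f' = -α f + q` with `α ≥ A > 0` and `q ≤ K` stays below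
`|f 0| + K / A`. -/
lemma le_of_hasDerivAt_dissipative {f α q : ℝ → ℝ} {A K T : ℝ} (hA : 0 < A) (hK : 0 ≤ K)
    (hT : 0 ≤ T) (hf : ∀ t, 0 ≤ t → HasDerivAt f (-α t * f t + q t) t)
    (hα : ∀ t, 0 ≤ t → A ≤ α t) (hq : ∀ t ∈ Icc 0 T, q t ≤ K) :
    f T ≤ |f 0| + K / A := by
  refine le_of_forall_pos_le_add fun ε hε => ?_
  have hK' : 0 ≤ K / A := by positivity
  refine image_le_of_deriv_right_lt_deriv_boundary (a := 0) (b := T)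
    (f' := fun t => -α t * f t + q t) (B := fun _ => |f 0| + K / A + ε) (B' := fun _ => 0)
    (fun t ht => (hf t ht.1).continuousAt.continuousWithinAt)
    (fun t ht => (hf t ht.1).hasDerivWithinAt) ?_ (fun t => hasDerivAt_const _ _) ?_
    (right_mem_Icc.2 hT)
  · linarith [le_abs_self (f 0)]
  · intro t ht hft
    have h1 := hq t ⟨ht.1, ht.2.le⟩
    have h2 := hα t ht.1
    have h3 : A * f t = A * |f 0| + K + A * ε := by rw [hft]; field_simp
    have h4 : 0 ≤ f t := by rw [hft]; positivity
    nlinarith [mul_le_mul_of_nonneg_right h2 h4, mul_pos hA hε, mul_nonneg hA.le (abs_nonneg (f 0))]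

/-- A solution of `f' = -α f + q` with `α ≥ A > 0` and `|q| ≤ K` satisfies
`|f| ≤ |f 0| + K / A`. -/
lemma abs_le_of_hasDerivAt_dissipative {f α q : ℝ → ℝ} {A K T : ℝ} (hA : 0 < A) (hT : 0 ≤ T)
    (hf : ∀ t, 0 ≤ t → HasDerivAt f (-α t * f t + q t) t)
    (hα : ∀ t, 0 ≤ t → A ≤ α t) (hq : ∀ t ∈ Icc 0 T, |q t| ≤ K) :
    |f T| ≤ |f 0| + K / A := by
  have hK : 0 ≤ K := (abs_nonneg _).trans (hq 0 ⟨le_rfl, hT⟩)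
  refine abs_le'.2 ⟨le_of_hasDerivAt_dissipative hA hK hT hf hα
    fun t ht => (le_abs_self _).trans (hq t ht), ?_⟩
  have h := le_of_hasDerivAt_dissipative (f := fun t => -f t) (q := fun t => -q t) hA hK hT
    (fun t ht => ((hf t ht).neg).congr_deriv (by ring)) hα
    fun t ht => (neg_le_abs _).trans (hq t ht)
  simpa using h

/-- Gronwall's inequality with the integrable rate `C (1 + t) ^ (-1 - δ)`. -/
lemma le_mul_exp_of_hasDerivAt_le {M M' : ℝ → ℝ} {C δ : ℝ} (hδ : 0 < δ) (hC : 0 ≤ C)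
    (hM0 : 0 ≤ M 0) (hM : ∀ t, 0 ≤ t → HasDerivAt M (M' t) t)
    (hM' : ∀ t, 0 ≤ t → M' t ≤ (1 + t) ^ (-1 - δ) * (C * (1 + M t))) {t : ℝ} (ht : 0 ≤ t) :
    1 + M t ≤ (1 + M 0) * exp (C / δ) := by
  set G : ℝ → ℝ := fun t => C / δ * (1 + t) ^ (-δ) with hG
  have hGd : ∀ t, 0 ≤ t → HasDerivAt G (-(C * (1 + t) ^ (-1 - δ))) t := by
    intro t ht
    have h1 : HasDerivAt (fun t : ℝ => 1 + t) 1 t := (hasDerivAt_id t).const_add 1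
    have h2 := (h1.rpow_const (p := -δ) (Or.inl (by positivity))).const_mul (C / δ)
    refine h2.congr_deriv ?_
    rw [show -δ - 1 = -1 - δ by ring]
    field_simp
  have hanti : AntitoneOn (fun t => (1 + M t) * exp (G t)) (Ici 0) := by
    have hd : ∀ t, 0 ≤ t → HasDerivAt (fun t => (1 + M t) * exp (G t))
        (M' t * exp (G t) + (1 + M t) * (exp (G t) * -(C * (1 + t) ^ (-1 - δ)))) t :=
      fun t ht => ((hM t ht).const_add 1).mul (hGd t ht).exp
    refine antitoneOn_of_deriv_nonpos (convex_Ici 0)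
      (fun t ht => (hd t ht).continuousAt.continuousWithinAt)
      (fun t ht => (hd t (interior_subset ht)).differentiableAt.differentiableWithinAt) ?_
    intro t ht
    have ht : 0 ≤ t := interior_subset ht
    rw [(hd t ht).deriv]
    have := mul_le_mul_of_nonneg_right (hM' t ht) (exp_pos (G t)).le
    linarith
  have h := hanti (self_mem_Ici : (0:ℝ) ∈ Ici 0) ht ht
  simp only [hG, add_zero, one_rpow, mul_one] at h
  have h1 : 0 ≤ C / δ * (1 + t) ^ (-δ) := by positivity
  by_cases hneg : 0 ≤ 1 + M t
  · exact (le_mul_of_one_le_right hneg (one_le_exp h1)).trans h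
  · have : 0 ≤ (1 + M 0) * exp (C / δ) := by positivity
    linarith

/-- Boundedness for a weakly coupled pair: `m` is driven at the integrable rate
`(1 + t) ^ (-1 - δ)` by `d`, while `d` is exponentially stable and driven by `m`. -/
lemma exists_bound_of_weakly_coupled {m d m' α q : ℝ → ℝ} {A κ R δ : ℝ} (hA : 0 < A)
    (hκ : 0 ≤ κ) (hR : 0 ≤ R) (hδ : 0 < δ)
    (hm : ∀ t, 0 ≤ t → HasDerivAt m (m' t) t)
    (hm' : ∀ t, 0 ≤ t → |m' t| ≤ (1 + t) ^ (-1 - δ) * (κ * |d t| + R))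
    (hd : ∀ t, 0 ≤ t → HasDerivAt d (-α t * d t + q t) t)
    (hα : ∀ t, 0 ≤ t → A ≤ α t) (hq : ∀ t, 0 ≤ t → |q t| ≤ κ * |m t| + R) :
    ∃ K, ∀ t, 0 ≤ t → |d t| ≤ K := by
  set p : ℝ → ℝ := fun s => (1 + max s 0) ^ (-1 - δ) * (κ * |d (max s 0)| + R) with hp
  have hpc : Continuous p := by
    have hdc : Continuous fun s : ℝ => d (max s 0) := by
      refine continuous_iff_continuousAt.2 fun s => ?_
      exact ContinuousAt.comp (f := fun s : ℝ => max s 0) (hd _ (le_max_right s 0)).continuousAt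
        (by fun_prop)
    refine Continuous.mul (Continuous.rpow_const (by fun_prop) fun s => Or.inl ?_)
      ((hdc.abs.const_mul κ).add_const R)
    have := le_max_right s 0
    positivity
  have hp0 : ∀ s, 0 ≤ p s := fun s => by
    have := le_max_right s 0
    positivity
  have hpt : ∀ t, 0 ≤ t → p t = (1 + t) ^ (-1 - δ) * (κ * |d t| + R) := fun t ht => by
    simp only [hp, max_eq_left ht]
  set M : ℝ → ℝ := fun t => |m 0| + ∫ s in (0:ℝ)..t, p s with hM
  have hMd : ∀ t, HasDerivAt M (p t) t := fun t =>
    (hpc.integral_hasStrictDerivAt 0 t).hasDerivAt.const_add _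
  have hMmono : Monotone M := monotone_of_deriv_nonneg (fun t => (hMd t).differentiableAt)
    fun t => by rw [(hMd t).deriv]; exact hp0 t
  have hM0 : M 0 = |m 0| := by simp [hM]
  have hmM : ∀ t, 0 ≤ t → |m t| ≤ M t := fun t ht =>
    image_norm_le_of_norm_deriv_right_le_deriv_boundary (a := 0) (b := t) (f' := m')
      (B' := p) (fun t ht => (hm t ht.1).continuousAt.continuousWithinAt)
      (fun t ht => (hm t ht.1).hasDerivWithinAt) (by rw [hM0]; rfl) hMd
      (fun s hs => by rw [hpt s hs.1]; exact hm' s hs.1) (right_mem_Icc.2 ht)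
  have hdM : ∀ t, 0 ≤ t → |d t| ≤ |d 0| + (κ * M t + R) / A := fun t ht =>
    abs_le_of_hasDerivAt_dissipative hA ht hd hα fun s hs => (hq s hs.1).trans <| by
      have := (hmM s hs.1).trans (hMmono hs.2)
      gcongr
  have hMnn : ∀ t, 0 ≤ t → 0 ≤ M t := fun t ht => (abs_nonneg _).trans (hmM t ht)
  set C := κ * |d 0| + κ * κ / A + κ * R / A + R with hC
  have hC0 : 0 ≤ C := by positivity
  have hMb : ∀ t, 0 ≤ t → 1 + M t ≤ (1 + M 0) * exp (C / δ) := fun t ht =>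
    le_mul_exp_of_hasDerivAt_le hδ hC0 (hMnn 0 le_rfl) (fun t _ => hMd t) (fun t ht => by
      rw [hpt t ht]
      have h0 := hMnn t ht
      refine mul_le_mul_of_nonneg_left ?_ (by positivity)
      calc κ * |d t| + R ≤ κ * (|d 0| + (κ * M t + R) / A) + R := by
            gcongr; exact hdM t ht
        _ = κ * |d 0| + κ * κ / A * M t + κ * R / A + R := by ring
        _ ≤ C * (1 + M t) := by
            have : 0 ≤ (κ * |d 0| + κ * R / A + R) * M t + κ * κ / A := by positivity
            rw [hC]; linarith) ht
  refine ⟨|d 0| + (κ * ((1 + M 0) * exp (C / δ)) + R) / A, fun t ht => (hdM t ht).trans ?_⟩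
  have := hMb t ht
  gcongr
  linarith

/-- Growth of the solution of `D' = a D - a κ / (1 + t) * (c + Y + V)`, `Y' = D`, when the
forcing `V` grows strictly slower than `t ^ κ`. -/
lemma exists_bound_of_hasDerivAt_volterra {D Y V : ℝ → ℝ} {a κ c C γ : ℝ} (ha : a < 0)
    (hκ : 1 / 2 < κ) (hγ : γ < κ) (hγ' : κ ≤ γ + 1)
    (hY : ∀ t, 0 ≤ t → HasDerivAt Y (D t) t)
    (hD : ∀ t, 0 ≤ t → HasDerivAt D (a * D t + -a * κ / (1 + t) * (c + Y t + V t)) t)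
    (hV : ∀ t, 0 ≤ t → |V t| ≤ C * (1 + t) ^ γ) :
    ∃ K, ∀ t, 0 ≤ t → |D t| ≤ K * (1 + t) ^ (κ - 1) := by
  have hC : 0 ≤ C := by simpa using (abs_nonneg _).trans (hV 0 le_rfl)
  have hr : ∀ p t : ℝ, 0 ≤ t →
      HasDerivAt (fun t : ℝ => (1 + t) ^ p) (p * (1 + t) ^ (p - 1)) t := fun p t ht =>
    (((hasDerivAt_id t).const_add 1).rpow_const (p := p) (Or.inl (by simp; positivity))).congr_deriv
      (by simp)
  have haκ : 0 < -a * κ := mul_pos (neg_pos.2 ha) (by linarith)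
  have hVC : ∀ t, 0 ≤ t → |-a * κ * V t| ≤ -a * κ * C * (1 + t) ^ γ := fun t ht => by
    rw [abs_mul, abs_of_pos haκ, mul_assoc _ C]
    exact mul_le_mul_of_nonneg_left (hV t ht) haκ.le
  have hR : 0 ≤ -a * κ * C := mul_nonneg haκ.le hC
  obtain ⟨K, hK⟩ : ∃ K, ∀ t, 0 ≤ t → |D t * (1 + t) ^ (1 - κ)| ≤ K := by
    refine exists_bound_of_weakly_coupled
      (m := fun t => (D t - a * (c + Y t)) * (1 + t) ^ (-κ))
      (d := fun t => D t * (1 + t) ^ (1 - κ))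
      (m' := fun t => (-κ * D t + -a * κ * V t) * (1 + t) ^ (-κ - 1))
      (α := fun t => -a + (2 * κ - 1) / (1 + t))
      (q := fun t => κ * ((D t - a * (c + Y t)) * (1 + t) ^ (-κ)) + -a * κ * V t * (1 + t) ^ (-κ))
      (A := -a) (κ := κ) (R := -a * κ * C) (δ := κ - γ) (by linarith) (by linarith) hR (by linarith)
      ?_ ?_ ?_ ?_ ?_
    · intro t ht
      have h1 : 0 < 1 + t := by linarith
      refine (((hD t ht).sub (((hY t ht).const_add c).const_mul a)).mul (hr (-κ) t ht)).congr_deriv ?_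
      simp only [Pi.sub_apply]
      rw [rpow_sub_one h1.ne']
      field_simp
      ring
    · intro t ht
      have h1 : 0 < 1 + t := by linarith
      have e1 : (1 + t) ^ (-1 - (κ - γ)) = (1 + t) ^ (-κ - 1) * (1 + t) ^ γ := by
        rw [← rpow_add h1]; ring_nf
      have e2 : (1 + t) ^ (-κ - 1) ≤ (1 + t) ^ (-1 - (κ - γ)) * (1 + t) ^ (1 - κ) := by
        rw [← rpow_add h1]
        exact rpow_le_rpow_of_exponent_le (by linarith) (by linarith)
      have h2 := hVC t ht
      have h3 : 0 ≤ (1 + t) ^ (-κ - 1) := by positivity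
      have h4 : 0 ≤ (1 + t) ^ (1 - κ) := by positivity
      have hκ0 : 0 ≤ κ := by linarith
      calc |(-κ * D t + -a * κ * V t) * (1 + t) ^ (-κ - 1)|
          = |-κ * D t + -a * κ * V t| * (1 + t) ^ (-κ - 1) := by rw [abs_mul, abs_of_nonneg h3]
        _ ≤ (κ * |D t| + -a * κ * C * (1 + t) ^ γ) * (1 + t) ^ (-κ - 1) := by
            refine mul_le_mul_of_nonneg_right ((abs_add_le _ _).trans (add_le_add ?_ h2)) h3
            rw [abs_mul, abs_neg, abs_of_nonneg hκ0]
        _ = κ * |D t| * (1 + t) ^ (-κ - 1) + (1 + t) ^ (-1 - (κ - γ)) * (-a * κ * C) := by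
            rw [e1]; ring
        _ ≤ κ * |D t| * ((1 + t) ^ (-1 - (κ - γ)) * (1 + t) ^ (1 - κ))
              + (1 + t) ^ (-1 - (κ - γ)) * (-a * κ * C) := by gcongr
        _ = _ := by rw [abs_mul, abs_of_nonneg h4]; ring
    · intro t ht
      have h1 : 0 < 1 + t := by linarith
      refine ((hD t ht).mul (hr (1 - κ) t ht)).congr_deriv ?_
      rw [show 1 - κ - 1 = -κ by ring, show 1 - κ = -κ + 1 by ring, rpow_add_one h1.ne']
      field_simp
      ring
    · intro t ht
      have : 0 ≤ (2 * κ - 1) / (1 + t) := div_nonneg (by linarith) (by linarith)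
      linarith
    · intro t ht
      have h1 : 0 < 1 + t := by linarith
      have hκ0 : 0 ≤ κ := by linarith
      refine (abs_add_le _ _).trans (add_le_add (by rw [abs_mul, abs_of_nonneg hκ0]) ?_)
      have h3 : 0 ≤ (1 + t) ^ (-κ) := by positivity
      rw [abs_mul, abs_of_nonneg h3]
      refine (mul_le_mul_of_nonneg_right (hVC t ht) h3).trans ?_
      rw [mul_assoc _ ((1 + t) ^ γ), ← rpow_add h1]
      exact mul_le_of_le_one_right hR (rpow_le_one_of_one_le_of_nonpos (by linarith) (by linarith))
  refine ⟨K, fun t ht => ?_⟩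
  have h1 : 0 < 1 + t := by linarith
  have h := mul_le_mul_of_nonneg_right (hK t ht) (rpow_nonneg h1.le (κ - 1))
  rwa [abs_mul, abs_of_pos (rpow_pos_of_pos h1 _), mul_assoc, ← rpow_add h1,
    show 1 - κ + (κ - 1) = 0 by ring, rpow_zero, mul_one] at h

/-- Growth of the solution of `V' = a V + σ β` in terms of an even moment of the forcing `β`. -/
lemma exists_bound_of_hasDerivAt_linear {V β : ℝ → ℝ} {a σ C γ : ℝ} {n : ℕ} (hn : n ≠ 0)
    (ha : a < 0) (hσ : 0 < σ) (hβ : Continuous β) (hV0 : V 0 = 0)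
    (hV : ∀ t, 0 ≤ t → HasDerivAt V (a * V t + σ * β t) t)
    (hC : ∀ t, 0 ≤ t → ∫ s in (0:ℝ)..t, β s ^ (2 * n) ≤ C * (1 + t) ^ (2 * n * γ)) :
    ∃ C', ∀ t, 0 ≤ t → |V t| ≤ C' * (1 + t) ^ γ := by
  set L : ℝ := 2 * n * ((σ / -a) ^ (2 * n - 1) * σ) with hL
  have ha' : 0 < -a := neg_pos.2 ha
  have hL0 : 0 ≤ L := by positivity
  have hC0 : 0 ≤ C := by simpa using hC 0 le_rfl
  have young : ∀ x y : ℝ, 2 * n * x ^ (2 * n - 1) * (a * x + σ * y) ≤ L * y ^ (2 * n) := by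
    intro x y
    have hodd : 2 * n - 1 + 1 = 2 * n := by omega
    have hx : x ^ (2 * n - 1) * x = |x| ^ (2 * n - 1) * |x| := by
      rw [← pow_succ, ← pow_succ, hodd, pow_mul, pow_mul, sq_abs]
    have hxy : x ^ (2 * n - 1) * y ≤ |x| ^ (2 * n - 1) * |y| := by
      rw [← abs_pow, ← abs_mul]; exact le_abs_self _
    have hy : y ^ (2 * n) = |y| ^ (2 * n - 1) * |y| := by
      rw [← pow_succ, hodd, pow_mul, pow_mul, sq_abs]
    have hu : 0 ≤ |x| ^ (2 * n - 1) := by positivity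
    have hv : 0 ≤ |y| ^ (2 * n - 1) := by positivity
    suffices h : |x| ^ (2 * n - 1) * (σ * |y| - -a * |x|)
        ≤ (σ / -a) ^ (2 * n - 1) * σ * (|y| ^ (2 * n - 1) * |y|) by
      rw [hy, hL]
      have h2 : x ^ (2 * n - 1) * (a * x + σ * y)
          ≤ |x| ^ (2 * n - 1) * (σ * |y| - -a * |x|) := by
        have := mul_le_mul_of_nonneg_left hxy hσ.le
        linear_combination this + a * hx
      have := mul_le_mul_of_nonneg_left (h2.trans h) (by positivity : (0:ℝ) ≤ 2 * n)
      linarith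
    rcases le_total (σ * |y|) (-a * |x|) with h | h
    · have : |x| ^ (2 * n - 1) * (σ * |y| - -a * |x|) ≤ 0 :=
        mul_nonpos_of_nonneg_of_nonpos hu (by linarith)
      exact this.trans (by positivity)
    · have h' : |x| ≤ σ / -a * |y| := by
        rw [div_mul_eq_mul_div, le_div_iff₀ ha']; linarith
      have h1 : |x| ^ (2 * n - 1) ≤ (σ / -a) ^ (2 * n - 1) * |y| ^ (2 * n - 1) := by
        rw [← mul_pow]; gcongr
      calc |x| ^ (2 * n - 1) * (σ * |y| - -a * |x|) ≤ |x| ^ (2 * n - 1) * (σ * |y|) := by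
            have : 0 ≤ -a * |x| := by positivity
            gcongr; linarith
        _ ≤ (σ / -a) ^ (2 * n - 1) * |y| ^ (2 * n - 1) * (σ * |y|) := by gcongr
        _ = _ := by ring
  have hanti : AntitoneOn (fun t => V t ^ (2 * n) - L * ∫ s in (0:ℝ)..t, β s ^ (2 * n))
      (Ici 0) := by
    have hd : ∀ t, 0 ≤ t → HasDerivAt
        (fun t => V t ^ (2 * n) - L * ∫ s in (0:ℝ)..t, β s ^ (2 * n))
        (2 * n * V t ^ (2 * n - 1) * (a * V t + σ * β t) - L * β t ^ (2 * n)) t := fun t ht => by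
      have h1 : Continuous fun s => β s ^ (2 * n) := by fun_prop
      refine (((hV t ht).pow (2 * n)).sub
        (((h1.integral_hasStrictDerivAt 0 t).hasDerivAt).const_mul L)).congr_deriv ?_
      push_cast
      ring
    refine antitoneOn_of_deriv_nonpos (convex_Ici 0)
      (fun t ht => (hd t ht).continuousAt.continuousWithinAt)
      (fun t ht => (hd t (interior_subset ht)).differentiableAt.differentiableWithinAt) ?_
    intro t ht
    rw [(hd t (interior_subset ht)).deriv]
    linarith [young (V t) (β t)]
  refine ⟨(L * C) ^ ((2 * n : ℝ)⁻¹), fun t ht => ?_⟩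
  have h := hanti (self_mem_Ici : (0:ℝ) ∈ Ici 0) ht ht
  have h2n : 2 * n ≠ 0 := by omega
  simp only [hV0, zero_pow h2n, intervalIntegral.integral_same, mul_zero, sub_zero] at h
  have h1 : |V t| ^ (2 * n) ≤ ((L * C) ^ ((2 * n : ℝ)⁻¹) * (1 + t) ^ γ) ^ (2 * n) := by
    have e1 : ((L * C) ^ ((2 * n : ℝ)⁻¹)) ^ (2 * n) = L * C := by
      have := rpow_inv_natCast_pow (mul_nonneg hL0 hC0) h2n
      push_cast at this
      exact this
    have e2 : ((1 + t) ^ γ) ^ (2 * n) = (1 + t) ^ (2 * n * γ) := by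
      rw [← rpow_natCast, ← rpow_mul (by positivity)]
      push_cast
      ring_nf
    rw [mul_pow, e1, e2, pow_mul, sq_abs, ← pow_mul]
    have := mul_le_mul_of_nonneg_left (hC t ht) hL0
    linarith
  exact le_of_pow_le_pow_left₀ h2n (by positivity) h1

/-- The even moments of a centred Gaussian scale with the variance and are finite. -/
lemma exists_lintegral_pow_gaussianReal (n : ℕ) :
    ∃ C : ENNReal, C ≠ ⊤ ∧ ∀ s : ℝ, 0 ≤ s →
      ∫⁻ x, ENNReal.ofReal (x ^ (2 * n)) ∂gaussianReal 0 s.toNNReal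
        = ENNReal.ofReal (s ^ n) * C := by
  refine ⟨∫⁻ x, ENNReal.ofReal (x ^ (2 * n)) ∂gaussianReal 0 1, ?_, fun s hs => ?_⟩
  · have h := (memLp_id_gaussianReal (μ := 0) (v := 1) (2 * n : ℕ)).integrable_norm_pow'
    have h2 : Integrable (fun x : ℝ => x ^ (2 * n)) (gaussianReal 0 1) := by
      refine h.congr (ae_of_all _ fun x => ?_)
      simp [pow_mul]
    exact (lintegral_ofReal_ne_top_iff_integrable h2.1
      (ae_of_all _ fun x => by simp only [Pi.zero_apply, pow_mul]; positivity)).2 h2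
  · have h := gaussianReal_map_const_mul (μ := 0) (v := 1) √s
    have hv : NNReal.mk (√s ^ 2) (sq_nonneg _) * 1 = s.toNNReal := by
      ext; simp [sq_sqrt hs, hs]
    rw [mul_zero, hv] at h
    rw [← h, lintegral_map (by fun_prop) (by fun_prop), ← lintegral_const_mul _ (by fun_prop)]
    refine lintegral_congr fun x => ?_
    rw [← ENNReal.ofReal_mul (by positivity), mul_pow, pow_mul √s, sq_sqrt hs]

/-- The even moments of a Brownian path grow polynomially, almost surely. -/
lemma IsStdBrownian.ae_exists_integral_pow_le {Ω : Type*} {mΩ : MeasurableSpace Ω}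
    {P : Measure Ω} [IsProbabilityMeasure P] {F : MeasureTheory.Filtration ℝ mΩ}
    {B : ℝ → Ω → ℝ} (hB : IsStdBrownian P F B) {n : ℕ} {γ : ℝ} (hγ : 0 ≤ γ)
    (hn : 1 < n * (2 * γ - 1)) :
    ∀ᵐ ω ∂P, ∃ C, ∀ t, 0 ≤ t →
      ∫ s in (0:ℝ)..t, B s ω ^ (2 * n) ≤ C * (1 + t) ^ (2 * n * γ) := by
  obtain ⟨hadap, hB0, hcont, hlaw, -⟩ := hB
  have hmeas : ∀ t, Measurable (B t) := fun t => (hadap t).mono (F.le t) le_rfl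
  have hjoint : Measurable (Function.uncurry B) :=
    measurable_uncurry_of_continuous_of_measurable hcont hmeas
  obtain ⟨C, hC, hCs⟩ := exists_lintegral_pow_gaussianReal n
  set w : ℝ → ℝ := fun s => (s + 1) ^ (-(2 * n * γ)) with hw
  have hwm : Measurable w := by fun_prop
  have hmom : ∀ s, 0 ≤ s → ∫⁻ ω, ENNReal.ofReal (B s ω ^ (2 * n)) ∂P
      = ENNReal.ofReal (s ^ n) * C := by
    intro s hs
    have h := hlaw 0 s le_rfl hs
    simp only [hB0, sub_zero] at h
    rw [← hCs s hs, ← h, lintegral_map (by fun_prop) (hmeas s)]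
  have hfin : ∫⁻ ω, (∫⁻ s in Ioi (0:ℝ), ENNReal.ofReal (B s ω ^ (2 * n) * w s)) ∂P ≠ ⊤ := by
    have hm : Measurable (Function.uncurry fun (ω : Ω) (s : ℝ) =>
        ENNReal.ofReal (B s ω ^ (2 * n) * w s)) := by
      have h1 : Measurable fun p : Ω × ℝ => B p.2 p.1 := hjoint.comp measurable_swap
      exact ((h1.pow_const _).mul (hwm.comp measurable_snd)).ennreal_ofReal
    rw [lintegral_lintegral_swap hm.aemeasurable]
    have hint : IntegrableOn (fun s : ℝ => (s + 1) ^ (n - 2 * n * γ)) (Ioi 0) :=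
      integrableOn_add_rpow_Ioi_of_lt (by linarith) (by norm_num)
    have hle : ∫⁻ s in Ioi (0:ℝ), ∫⁻ ω, ENNReal.ofReal (B s ω ^ (2 * n) * w s) ∂P
        ≤ ∫⁻ s in Ioi (0:ℝ), ENNReal.ofReal ((s + 1) ^ (n - 2 * n * γ)) * C := by
      refine setLIntegral_mono (by fun_prop) fun s hs => ?_
      have hs : 0 < s := hs
      have hws : 0 ≤ w s := by positivity
      have hBs := hmeas s
      simp only [ENNReal.ofReal_mul' hws]
      rw [lintegral_mul_const _ (by fun_prop), hmom s hs.le, mul_right_comm,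
        ← ENNReal.ofReal_mul (by positivity)]
      gcongr
      rw [sub_eq_add_neg, rpow_add (by positivity), rpow_natCast]
      gcongr
      linarith
    refine ne_top_of_le_ne_top ?_ hle
    rw [lintegral_mul_const _ (by fun_prop)]
    refine ENNReal.mul_ne_top ?_ hC
    exact (lintegral_ofReal_ne_top_iff_integrable hint.1 ((ae_restrict_iff' measurableSet_Ioi).2
      (ae_of_all _ fun s hs => by have : 0 < s := hs; simp only [Pi.zero_apply]; positivity))).2 hint
  have hmω : Measurable fun ω => ∫⁻ s in Ioi (0:ℝ), ENNReal.ofReal (B s ω ^ (2 * n) * w s) := by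
    have h1 : Measurable fun p : Ω × ℝ => B p.2 p.1 := hjoint.comp measurable_swap
    exact Measurable.lintegral_prod_right'
      (f := fun p : Ω × ℝ => ENNReal.ofReal (B p.2 p.1 ^ (2 * n) * w p.2))
      ((h1.pow_const _).mul (hwm.comp measurable_snd)).ennreal_ofReal
  filter_upwards [ae_lt_top hmω hfin] with ω hω
  have hnn : ∀ s ∈ Ioi (0:ℝ), 0 ≤ B s ω ^ (2 * n) * w s := fun s hs => by
    have hs : 0 < s := hs
    rw [pow_mul]
    positivity
  have hBc : Continuous fun s => B s ω := hcont ω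
  have hBm : Measurable fun s => B s ω := hBc.measurable
  have hint : IntegrableOn (fun s => B s ω ^ (2 * n) * w s) (Ioi 0) :=
    (lintegral_ofReal_ne_top_iff_integrable (by fun_prop)
      ((ae_restrict_iff' measurableSet_Ioi).2 (ae_of_all _ hnn))).1 hω.ne
  refine ⟨∫ s in Ioi (0:ℝ), B s ω ^ (2 * n) * w s, fun t ht => ?_⟩
  rw [intervalIntegral.integral_of_le ht, ← integral_mul_const]
  calc ∫ s in Ioc 0 t, B s ω ^ (2 * n)
      ≤ ∫ s in Ioc 0 t, B s ω ^ (2 * n) * w s * (1 + t) ^ (2 * n * γ) := by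
        refine setIntegral_mono_on ?_ ((hint.mono_set Ioc_subset_Ioi_self).mul_const _)
          measurableSet_Ioc fun s hs => ?_
        · exact (by fun_prop : Continuous fun s => B s ω ^ (2 * n)).integrableOn_Ioc
        · have hs0 : 0 < s := hs.1
          have hB2 : 0 ≤ B s ω ^ (2 * n) := by rw [pow_mul]; positivity
          rw [mul_assoc]
          refine le_mul_of_one_le_right hB2 ?_
          rw [hw]
          calc (1:ℝ) = (s + 1) ^ (-(2 * n * γ)) * (s + 1) ^ (2 * n * γ) := by
                rw [← rpow_add (by positivity)]; simp
            _ ≤ _ := by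
                have : s + 1 ≤ 1 + t := by linarith [hs.2]
                exact mul_le_mul_of_nonneg_left
                  (rpow_le_rpow (by positivity) this (by positivity)) (by positivity)
    _ ≤ _ := setIntegral_mono_set (hint.mul_const _)
        ((ae_restrict_iff' measurableSet_Ioi).2 (ae_of_all _ fun s hs =>
          mul_nonneg (hnn s hs) (by positivity))) Ioc_subset_Ioi_self.eventuallyLE

theorem sfde_XU_rate_poly {Ω : Type*} {mΩ : MeasurableSpace Ω} (P : Measure Ω) [IsProbabilityMeasure P]
    (F : MeasureTheory.Filtration ℝ mΩ) (a b σ : ℝ) (ψ : ℝ → ℝ) (B X : ℝ → Ω → ℝ)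
    (hσ : 0 < σ) (hψ : ContinuousOn ψ (Set.Icc (-1 : ℝ) 0))
    (hB : IsStdBrownian P F B) (hX : IsSolutionSFDE P F a b σ ψ B X)
    (U : ℝ → Ω → ℝ) (hU : IsOUProcess P F a σ B U)
    (ha : a < 0) (hab : a + b < 0) (h2ba : 0 < 2 * b + a) :
    ∀ᵐ ω ∂P,
      Filter.limsup (fun t : ℝ => ((|X t ω - U t ω| / t ^ (-1 - b / a) : ℝ) : EReal)) Filter.atTop
        ∈ Set.Ico (0 : EReal) ⊤ := by
  obtain ⟨κ, hκ⟩ : ∃ κ, κ = -b / a := ⟨_, rfl⟩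
  have hb : b = -a * κ := by rw [hκ]; field_simp [ha.ne]
  have hκ1 : 1 / 2 < κ := by nlinarith
  have hκ2 : κ < 1 := by nlinarith
  obtain ⟨γ, hγ1, hγ2⟩ := exists_between hκ1
  obtain ⟨n, hn⟩ := exists_nat_gt (1 / (2 * γ - 1))
  rw [div_lt_iff₀ (by linarith)] at hn
  have hn0 : n ≠ 0 := by rintro rfl; norm_num at hn
  filter_upwards [hB.ae_exists_integral_pow_le (by linarith) hn, hX.2.2, hU.2.2] with ω hBω hXω hUω
  obtain ⟨C, hC⟩ := hBω
  have hBc : Continuous fun s => B s ω := hB.2.2.1 ω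
  have ext_cont : ∀ f : ℝ → ℝ, ContinuousOn f (Ici 0) → Continuous fun s => f (max s 0) :=
    fun f hf => hf.comp_continuous (by fun_prop) fun s => le_max_right s 0
  have hxc := ext_cont _ (hX.2.1 ω)
  have huc := ext_cont _ (hU.2.1 ω)
  set x : ℝ → ℝ := fun s => X (max s 0) ω with hx
  set u : ℝ → ℝ := fun s => U (max s 0) ω with hu
  have hxt : ∀ t, 0 ≤ t → x t = X t ω := fun t ht => by simp only [hx, max_eq_left ht]
  have hut : ∀ t, 0 ≤ t → u t = U t ω := fun t ht => by simp only [hu, max_eq_left ht]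
  have hxI : ∀ t, 0 ≤ t → ∫ s in (0:ℝ)..t, X s ω = ∫ s in (0:ℝ)..t, x s := fun t ht =>
    intervalIntegral.integral_congr fun s hs =>
      (hxt s (by rw [uIcc_of_le ht] at hs; exact hs.1)).symm
  have huI : ∀ t, 0 ≤ t → ∫ s in (0:ℝ)..t, U s ω = ∫ s in (0:ℝ)..t, u s := fun t ht =>
    intervalIntegral.integral_congr fun s hs =>
      (hut s (by rw [uIcc_of_le ht] at hs; exact hs.1)).symm
  set V : ℝ → ℝ := fun t => ∫ s in (0:ℝ)..t, u s with hV
  set Y : ℝ → ℝ := fun t => ∫ s in (0:ℝ)..t, (x s - u s) with hY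
  have hVd : ∀ t, HasDerivAt V (u t) t := fun t => (huc.integral_hasStrictDerivAt 0 t).hasDerivAt
  have hYd : ∀ t, HasDerivAt Y (x t - u t) t := fun t =>
    ((hxc.sub huc).integral_hasStrictDerivAt 0 t).hasDerivAt
  have hVc : Continuous V := continuous_iff_continuousAt.2 fun t => (hVd t).continuousAt
  have hYc : Continuous Y := continuous_iff_continuousAt.2 fun t => (hYd t).continuousAt
  have hYV : ∀ t, Y t + V t = ∫ s in (0:ℝ)..t, x s := fun t => by
    rw [hY, hV]
    simp only
    rw [intervalIntegral.integral_sub (hxc.intervalIntegrable _ _) (huc.intervalIntegrable _ _)]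
    ring
  obtain ⟨C', hC'⟩ := exists_bound_of_hasDerivAt_linear hn0 ha hσ hBc (V := V) (by simp [hV])
    (fun t ht => (hVd t).congr_deriv (by rw [hut t ht, hUω t ht, huI t ht])) hC
  set c := ∫ v in (-1:ℝ)..(0:ℝ), ψ v
  set g : ℝ → ℝ := fun s => a * (x s - u s) + b / (1 + max s 0) * (c + Y s + V s) with hg
  have hgc : Continuous g := by
    have h1 : Continuous fun s : ℝ => b / (1 + max s 0) :=
      continuous_const.div (by fun_prop) fun s => by
        have := le_max_right s 0
        positivity
    fun_prop
  set D : ℝ → ℝ := fun t => ψ 0 + ∫ s in (0:ℝ)..t, g s with hD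
  have hDd : ∀ t, HasDerivAt D (g t) t := fun t =>
    (hgc.integral_hasStrictDerivAt 0 t).hasDerivAt.const_add _
  have hDt : ∀ t, 0 ≤ t → D t = X t ω - U t ω := fun t ht => by
    have h1 : ∫ s in (0:ℝ)..t,
        (a * X s ω + b / (1 + s) * (c + ∫ v in (0:ℝ)..s, X v ω))
        = ∫ s in (0:ℝ)..t, (g s + a * u s) := by
      refine intervalIntegral.integral_congr fun s hs => ?_
      have hs0 : 0 ≤ s := by rw [uIcc_of_le ht] at hs; exact hs.1
      simp only [hg, max_eq_left hs0]
      rw [hxI s hs0, ← hYV s, hxt s hs0]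
      ring
    rw [hXω t ht, hUω t ht, huI t ht, h1, intervalIntegral.integral_add
      (hgc.intervalIntegrable _ _) ((huc.const_mul a).intervalIntegrable _ _),
      intervalIntegral.integral_const_mul]
    ring
  obtain ⟨K, hK⟩ := exists_bound_of_hasDerivAt_volterra (D := D) (Y := Y) (V := V) (c := c) ha hκ1
    hγ2 (by linarith)
    (fun t ht => (hYd t).congr_deriv (by rw [hDt t ht, hxt t ht, hut t ht]))
    (fun t ht => (hDd t).congr_deriv (by
      simp only [hg, max_eq_left ht]
      rw [hDt t ht, hxt t ht, hut t ht, hb])) hC'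
  have hexp : -1 - b / a = κ - 1 := by rw [hκ]; ring
  rw [hexp]
  have hK0 : 0 ≤ K := by simpa using (abs_nonneg _).trans (hK 0 le_rfl)
  have hbound : ∀ᶠ t : ℝ in atTop,
      ((|X t ω - U t ω| / t ^ (κ - 1) : ℝ) : EReal) ≤ ((K : ℝ) : EReal) := by
    filter_upwards [eventually_gt_atTop 0] with t ht
    refine EReal.coe_le_coe_iff.2 ?_
    rw [div_le_iff₀ (by positivity), ← hDt t ht.le]
    refine (hK t ht.le).trans (mul_le_mul_of_nonneg_left ?_ hK0)
    exact rpow_le_rpow_of_nonpos ht (by linarith) (by linarith)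
  refine ⟨?_, (limsup_le_of_le (h := hbound)).trans_lt (EReal.coe_lt_top K)⟩
  refine le_limsup_of_frequently_le (Eventually.frequently ?_)
  filter_upwards [eventually_gt_atTop 0] with t ht
  exact EReal.coe_nonneg.2 (by positivity)
end
end

section
/- Suppose a < 0, a + b < 0 and 2b + a < 0. Then, almost surely, limsup_{t→∞} |X(t) − U(t)| / ( t^{−1/2} √(log log t) ) is finite (i.e. lies in [0,∞)). -/
open MeasureTheory ProbabilityTheory Filter Real Set

noncomputable section

/-- Chaining over dyadic points: a continuous function on `[0, 1]` is controlled by the sum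
of bounds on its dyadic increments. -/
lemma abs_sub_le_of_dyadic_increments {g : ℝ → ℝ} (hg : Continuous g) {δ : ℕ → ℝ} {D : ℝ}
    (hD : ∀ m, ∑ k ∈ Finset.range m, δ k ≤ D)
    (h : ∀ k j : ℕ, j < 2 ^ k → |g ((j + 1 : ℝ) / 2 ^ k) - g ((j : ℝ) / 2 ^ k)| ≤ δ k)
    {t : ℝ} (ht0 : 0 ≤ t) (ht1 : t ≤ 1) : |g t - g 0| ≤ D := by
  have hδ : ∀ k, 0 ≤ δ k := fun k => (abs_nonneg _).trans (h k 0 (by positivity))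
  have key : ∀ m j : ℕ, j ≤ 2 ^ m →
      |g ((j : ℝ) / 2 ^ m) - g 0| ≤ ∑ k ∈ Finset.range (m + 1), δ k := by
    intro m
    induction m with
    | zero =>
      intro j hj
      have hj' : j = 0 ∨ j = 1 := by simp at hj; omega
      rcases hj' with rfl | rfl
      · simpa using hδ 0
      · simpa using h 0 0 (by simp)
    | succ m ih =>
      intro j hj
      rw [Finset.sum_range_succ]
      obtain ⟨i, hi⟩ : ∃ i, j = 2 * i ∨ j = 2 * i + 1 := ⟨j / 2, by omega⟩
      have hi' : i ≤ 2 ^ m := by rw [pow_succ] at hj; omega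
      have hdiv : ((2 * i : ℕ) : ℝ) / 2 ^ (m + 1) = (i : ℝ) / 2 ^ m := by
        push_cast; rw [pow_succ]; field_simp
      rcases hi with rfl | rfl
      · rw [hdiv]
        linarith [ih i hi', hδ (m + 1)]
      · have h1 := h (m + 1) (2 * i) (by omega)
        rw [hdiv] at h1
        have h2 := ih i hi'
        push_cast at h1 ⊢
        have := abs_sub_le (g ((2 * (i : ℝ) + 1) / 2 ^ (m + 1))) (g ((i : ℝ) / 2 ^ m)) (g 0)
        linarith
  have hlim : Tendsto (fun m : ℕ => ((⌊t * 2 ^ m⌋₊ : ℝ) / 2 ^ m)) atTop (nhds t) :=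
    (tendsto_nat_floor_mul_div_atTop ht0).comp
      (tendsto_pow_atTop_atTop_of_one_lt (by norm_num : (1 : ℝ) < 2))
  have hlim2 := ((hg.tendsto t).comp hlim).sub_const (g 0) |>.abs
  refine le_of_tendsto hlim2 (Eventually.of_forall fun m => ?_)
  refine (key m _ ?_).trans (hD _)
  have : t * 2 ^ m ≤ ((2 ^ m : ℕ) : ℝ) := by
    push_cast
    exact mul_le_of_le_one_left (by positivity) ht1
  exact (Nat.floor_le_floor this).trans (Nat.floor_natCast _).le

/-- Two-sided Gaussian tail bound. -/
lemma measure_abs_ge_le_of_map_gaussianReal {Ω : Type*} {mΩ : MeasurableSpace Ω} {P : Measure Ω}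
    [IsProbabilityMeasure P] {Z : Ω → ℝ} {v : NNReal} (hZ : P.map Z = gaussianReal 0 v)
    {x : ℝ} (hx : 0 ≤ x) :
    P {ω | x ≤ |Z ω|} ≤ ENNReal.ofReal (2 * exp (-x ^ 2 / (2 * v))) := by
  have hsub : HasSubgaussianMGF Z v P := by
    have hm : AEMeasurable Z P := aemeasurable_of_map_neZero (by rw [hZ]; infer_instance)
    refine ⟨fun t => ?_, fun t => ?_⟩
    · have := integrable_exp_mul_gaussianReal (μ := 0) (v := v) t
      rw [← hZ] at this
      exact this.comp_aemeasurable hm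
    · rw [mgf_gaussianReal hZ]; simp
  have hsub' : {ω | x ≤ |Z ω|} ⊆ {ω | x ≤ Z ω} ∪ {ω | x ≤ (-Z) ω} := by
    intro ω hω
    simpa [le_abs] using hω
  refine (measure_mono hsub').trans ((measure_union_le _ _).trans ?_)
  rw [two_mul, ENNReal.ofReal_add (by positivity) (by positivity)]
  gcongr
  · exact (ENNReal.le_ofReal_iff_toReal_le (by simp) (by positivity)).2 (hsub.measure_ge_le hx)
  · exact (ENNReal.le_ofReal_iff_toReal_le (by simp) (by positivity)).2
      (hsub.neg.measure_ge_le hx)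

/-- The size `8 (3/4)^k √(2^n log (n + 2))` allowed for the increments of Brownian motion over
dyadic intervals of length `2^n / 2^k`. -/
def dyadicIncrementBound (n k : ℕ) : ℝ := 8 * (3 / 4) ^ k * √(2 ^ n * log (n + 2))

lemma exp_dyadicIncrementBound_le (n k : ℕ) :
    2 * exp (-dyadicIncrementBound n k ^ 2 / (2 * ((2 : ℝ) ^ n / 2 ^ k))) ≤
      2 * ((1 / 4) ^ k * (1 / (n + 2 : ℝ) ^ 2)) := by
  have hn : (2 : ℝ) ≤ n + 2 := by linarith [(Nat.cast_nonneg n : (0 : ℝ) ≤ n)]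
  have hl : 0 ≤ log ((n : ℝ) + 2) := log_nonneg (by linarith)
  have h98 : (1 : ℝ) + k * (1 / 8) ≤ (9 / 8) ^ k := by
    have := one_add_mul_le_pow (by norm_num : (-2 : ℝ) ≤ 1 / 8) k
    norm_num at this ⊢
    linarith
  have heq : dyadicIncrementBound n k ^ 2 / (2 * ((2 : ℝ) ^ n / 2 ^ k)) =
      32 * (9 / 8) ^ k * log (n + 2) := by
    rw [dyadicIncrementBound, mul_pow, sq_sqrt (by positivity), mul_pow, ← pow_mul, mul_comm k 2,
      pow_mul]
    have : ((9 : ℝ) / 8) ^ k = ((3 / 4) ^ 2) ^ k * 2 ^ k := by rw [← mul_pow]; norm_num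
    rw [this]
    field_simp
    ring
  rw [neg_div, heq]
  gcongr
  calc exp (-(32 * (9 / 8) ^ k * log (n + 2))) ≤ exp (-(((2 * k + 2 : ℕ) : ℝ) * log (n + 2))) := by
        gcongr
        push_cast
        have : (0 : ℝ) ≤ k := Nat.cast_nonneg k
        linarith
    _ = ((n + 2 : ℝ) ^ (2 * k + 2))⁻¹ := by
        rw [exp_neg, exp_nat_mul, exp_log (by linarith)]
    _ ≤ (1 / 4) ^ k * (1 / (n + 2 : ℝ) ^ 2) := by
        rw [pow_add, mul_inv, pow_mul, ← inv_pow, one_div ((n + 2 : ℝ) ^ 2)]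
        gcongr
        rw [inv_eq_one_div]
        gcongr
        nlinarith

lemma IsStdBrownian.ae_eventually_dyadic_increment_lt {Ω : Type*} {mΩ : MeasurableSpace Ω}
    {P : Measure Ω} [IsProbabilityMeasure P] {F : MeasureTheory.Filtration ℝ mΩ} {B : ℝ → Ω → ℝ}
    (hB : IsStdBrownian P F B) :
    ∀ᵐ ω ∂P, ∀ᶠ n : ℕ in atTop, ∀ k j : ℕ, j < 2 ^ k →
      |B (2 ^ n * ((j + 1 : ℝ) / 2 ^ k)) ω - B (2 ^ n * ((j : ℝ) / 2 ^ k)) ω| <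
        dyadicIncrementBound n k := by
  obtain ⟨-, -, -, hgauss, -⟩ := hB
  set E : ℕ → Set Ω := fun n => ⋃ k : ℕ, ⋃ j ∈ Finset.range (2 ^ k),
    {ω | dyadicIncrementBound n k ≤
      |B (2 ^ n * ((j + 1 : ℝ) / 2 ^ k)) ω - B (2 ^ n * ((j : ℝ) / 2 ^ k)) ω|} with hE
  have hone : ∀ n k j : ℕ, P {ω | dyadicIncrementBound n k ≤
      |B (2 ^ n * ((j + 1 : ℝ) / 2 ^ k)) ω - B (2 ^ n * ((j : ℝ) / 2 ^ k)) ω|} ≤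
      ENNReal.ofReal (2 * ((1 / 4) ^ k * (1 / (n + 2 : ℝ) ^ 2))) := by
    intro n k j
    have hlen : (2 : ℝ) ^ n * ((j + 1 : ℝ) / 2 ^ k) - 2 ^ n * ((j : ℝ) / 2 ^ k) =
        2 ^ n / 2 ^ k := by ring
    have hpos : (0 : ℝ) < 2 ^ n / 2 ^ k := by positivity
    have hmap := hgauss (2 ^ n * ((j : ℝ) / 2 ^ k)) (2 ^ n * ((j + 1 : ℝ) / 2 ^ k))
      (by positivity) (by linarith)
    have h1 := measure_abs_ge_le_of_map_gaussianReal hmap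
      (x := dyadicIncrementBound n k) (by unfold dyadicIncrementBound; positivity)
    refine h1.trans (ENNReal.ofReal_le_ofReal ?_)
    rw [hlen, Real.coe_toNNReal _ hpos.le]
    exact exp_dyadicIncrementBound_le n k
  have hEn : ∀ n, P (E n) ≤ ENNReal.ofReal (4 * (1 / (n + 2 : ℝ) ^ 2)) := by
    intro n
    have hgeom := summable_geometric_two.mul_left (2 * (1 / (n + 2 : ℝ) ^ 2))
    calc P (E n) ≤ ∑' k : ℕ, ENNReal.ofReal (2 * (1 / (n + 2 : ℝ) ^ 2) * (1 / 2) ^ k) := by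
          refine (measure_iUnion_le _).trans (ENNReal.tsum_le_tsum fun k => ?_)
          refine (measure_biUnion_finset_le _ _).trans ?_
          refine (Finset.sum_le_sum fun j _ => hone n k j).trans ?_
          rw [Finset.sum_const, Finset.card_range, nsmul_eq_mul, ← ENNReal.ofReal_natCast,
            ← ENNReal.ofReal_mul (by positivity)]
          refine ENNReal.ofReal_le_ofReal (le_of_eq ?_)
          have : ((1 : ℝ) / 2) ^ k = 2 ^ k * (1 / 4) ^ k := by rw [← mul_pow]; norm_num
          rw [this]
          push_cast
          ring
      _ = ENNReal.ofReal (4 * (1 / (n + 2 : ℝ) ^ 2)) := by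
          rw [← ENNReal.ofReal_tsum_of_nonneg (fun k => by positivity) hgeom, tsum_mul_left,
            tsum_geometric_two]
          congr 1
          ring
  have hsum : ∑' n, P (E n) ≠ ⊤ := by
    have hs : Summable fun n : ℕ => 4 * (1 / (n + 2 : ℝ) ^ 2) := by
      have := (summable_nat_add_iff 2).2 (Real.summable_one_div_nat_pow.2 (by norm_num : 1 < 2))
      simpa using this.mul_left 4
    exact ne_top_of_le_ne_top hs.tsum_ofReal_ne_top (ENNReal.tsum_le_tsum hEn)
  filter_upwards [ae_eventually_notMem hsum] with ω hω
  filter_upwards [hω] with n hn k j hj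
  by_contra hcon
  refine hn ?_
  simp only [hE, mem_iUnion, Finset.mem_range]
  exact ⟨k, j, hj, not_lt.1 hcon⟩

/-- A smooth increasing version of `log log`, bounded below by `1` on `[0, ∞)`. -/
def iterLog (t : ℝ) : ℝ := log (3 + log (1 + t))

lemma one_le_iterLog {t : ℝ} (ht : 0 ≤ t) : 1 ≤ iterLog t := by
  have h1 : 0 ≤ log (1 + t) := log_nonneg (by linarith)
  rw [iterLog, le_log_iff_exp_le (by linarith)]
  linarith [exp_one_lt_three]

lemma log_add_three_le_iterLog {n : ℕ} {t : ℝ} (ht : 0 ≤ t) (hn : (2 : ℝ) ^ n ≤ 1 + t) :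
    log (n + 3) ≤ 2 * iterLog t := by
  have h1 : 0 ≤ log (1 + t) := log_nonneg (by linarith)
  have h2 : n * log 2 ≤ log (1 + t) := by
    rw [← log_pow]
    exact log_le_log (by positivity) hn
  have h3 : (n : ℝ) ≤ 2 * log (1 + t) := by
    have := log_two_gt_d9
    nlinarith [(Nat.cast_nonneg n : (0 : ℝ) ≤ n)]
  calc log (n + 3) ≤ log (2 * (3 + log (1 + t))) := log_le_log (by positivity) (by linarith)
    _ = log 2 + iterLog t := by rw [log_mul (by norm_num) (by positivity), iterLog]
    _ ≤ 2 * iterLog t := by linarith [one_le_iterLog ht, log_two_lt_d9]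

/-- The upper half of the law of the iterated logarithm for Brownian motion, up to a constant. -/
lemma IsStdBrownian.ae_exists_sq_le {Ω : Type*} {mΩ : MeasurableSpace Ω}
    {P : Measure Ω} [IsProbabilityMeasure P] {F : MeasureTheory.Filtration ℝ mΩ} {B : ℝ → Ω → ℝ}
    (hB : IsStdBrownian P F B) :
    ∀ᵐ ω ∂P, ∃ C, 0 ≤ C ∧ ∀ t, 0 ≤ t → B t ω ^ 2 ≤ C * ((1 + t) * iterLog t) := by
  filter_upwards [hB.ae_eventually_dyadic_increment_lt] with ω hω
  obtain ⟨-, hB0, hBc, -⟩ := hB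
  obtain ⟨N, hN⟩ := eventually_atTop.1 hω
  have hbound : ∀ n, N ≤ n → ∀ t, 0 ≤ t → t ≤ 2 ^ n →
      B t ω ^ 2 ≤ 1024 * (2 ^ n * log (n + 2)) := by
    intro n hn t ht0 ht1
    have hl : 0 ≤ (2 : ℝ) ^ n * log (n + 2) :=
      mul_nonneg (by positivity) (log_nonneg (by linarith [(Nat.cast_nonneg n : (0 : ℝ) ≤ n)]))
    have h2n : (0 : ℝ) < 2 ^ n := by positivity
    have hgc : Continuous fun s : ℝ => B (2 ^ n * s) ω := (hBc ω).comp (by fun_prop)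
    have hsum : ∀ m, ∑ k ∈ Finset.range m, dyadicIncrementBound n k ≤
        32 * √(2 ^ n * log (n + 2)) := by
      intro m
      have h1 : ∑ k ∈ Finset.range m, ((3 : ℝ) / 4) ^ k ≤ 4 := by
        rw [geom_sum_eq (by norm_num)]
        have : (0 : ℝ) ≤ (3 / 4) ^ m := by positivity
        rw [div_le_iff_of_neg (by norm_num)]
        linarith
      simp only [dyadicIncrementBound]
      rw [← Finset.sum_mul, ← Finset.mul_sum]
      gcongr
      linarith
    have h1 := abs_sub_le_of_dyadic_increments hgc hsum
      (fun k j hj => (hN n hn k j hj).le) (t := t / 2 ^ n) (by positivity)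
      ((div_le_one h2n).2 ht1)
    simp only [mul_zero, hB0, sub_zero, mul_div_cancel₀ t h2n.ne'] at h1
    calc B t ω ^ 2 = |B t ω| ^ 2 := (sq_abs _).symm
      _ ≤ (32 * √(2 ^ n * log (n + 2))) ^ 2 := by gcongr
      _ = 1024 * (2 ^ n * log (n + 2)) := by rw [mul_pow, sq_sqrt hl]; norm_num
  have hlN : 0 ≤ log ((N : ℝ) + 2) :=
    log_nonneg (by linarith [(Nat.cast_nonneg N : (0 : ℝ) ≤ N)])
  refine ⟨4096 + 1024 * (2 ^ N * log (N + 2)), by positivity, fun t ht => ?_⟩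
  have hL := one_le_iterLog ht
  have hΦ : 1 ≤ (1 + t) * iterLog t := by nlinarith
  rcases le_total t (2 ^ N) with h | h
  · have h1 := hbound N le_rfl t ht h
    have : 0 ≤ 1024 * ((2 : ℝ) ^ N * log (N + 2)) := by positivity
    nlinarith
  · obtain ⟨n, hn1, hn2⟩ := exists_nat_pow_near (by linarith : (1 : ℝ) ≤ 1 + t)
      (by norm_num : (1 : ℝ) < 2)
    have hNn : N ≤ n + 1 := by
      by_contra hcon
      have : (2 : ℝ) ^ (n + 1) ≤ 2 ^ N := pow_le_pow_right₀ (by norm_num) (by omega)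
      linarith
    have h1 := hbound (n + 1) hNn t ht (by linarith)
    have h2 := log_add_three_le_iterLog ht hn1
    push_cast at h1
    rw [show (n : ℝ) + 1 + 2 = n + 3 by ring, pow_succ (2 : ℝ) n] at h1
    have h3 : (2 : ℝ) ^ n * log (n + 3) ≤ (1 + t) * (2 * iterLog t) := by
      gcongr
      exact log_nonneg (by linarith [(Nat.cast_nonneg n : (0 : ℝ) ≤ n)])
    have : 0 ≤ 1024 * ((2 : ℝ) ^ N * log (N + 2)) := by positivity
    nlinarith

lemma hasDerivAt_iterLog {t : ℝ} (ht : 0 ≤ t) :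
    HasDerivAt iterLog (1 / (1 + t) / (3 + log (1 + t))) t := by
  have h1 : 0 ≤ log (1 + t) := log_nonneg (by linarith)
  exact ((((hasDerivAt_id t).const_add 1).log (by simp; linarith)).const_add 3).log
    (by simp; linarith)

lemma deriv_iterLog_nonneg {t : ℝ} (ht : 0 ≤ t) : 0 ≤ 1 / (1 + t) / (3 + log (1 + t)) := by
  have h1 : 0 ≤ log (1 + t) := log_nonneg (by linarith)
  positivity

/-- Linear differential comparison: `G' ≤ p G` on `[t₀, ∞)` preserves `G ≤ 0`. -/
lemma nonpos_of_hasDerivAt_le {G G' q p : ℝ → ℝ} {t₀ : ℝ}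
    (hG : ∀ t, t₀ ≤ t → HasDerivAt G (G' t) t) (hq : ∀ t, t₀ ≤ t → HasDerivAt q (p t) t)
    (hle : ∀ t, t₀ ≤ t → G' t ≤ p t * G t) (h0 : G t₀ ≤ 0) {t : ℝ} (ht : t₀ ≤ t) : G t ≤ 0 := by
  have hd : ∀ s, t₀ ≤ s → HasDerivAt (fun s => G s * exp (-q s))
      (G' s * exp (-q s) + G s * (exp (-q s) * (-p s))) s :=
    fun s hs => (hG s hs).mul (hq s hs).neg.exp
  have hanti : AntitoneOn (fun s => G s * exp (-q s)) (Ici t₀) := by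
    refine antitoneOn_of_deriv_nonpos (convex_Ici t₀)
      (fun s hs => (hd s hs).continuousAt.continuousWithinAt)
      (fun s hs => (hd s (interior_subset hs)).differentiableAt.differentiableWithinAt)
      fun s hs => ?_
    rw [(hd s (interior_subset hs)).deriv]
    have h1 := hle s (interior_subset hs)
    have h2 := exp_pos (-q s)
    nlinarith
  have h1 := hanti self_mem_Ici ht ht
  have h2 : G t * exp (-q t) ≤ 0 :=
    h1.trans (mul_nonpos_of_nonpos_of_nonneg h0 (exp_pos _).le)
  exact nonpos_of_mul_nonpos_left h2 (exp_pos _)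

/-- A stable scalar linear equation forced by a term of order `√((1 + t) log log t)` has a
response of the same order. -/
lemma sq_le_of_hasDerivAt_linear {a σ C : ℝ} (ha : a < 0) (hC : 0 ≤ C) {J f : ℝ → ℝ}
    (hJ : ∀ t, 0 ≤ t → HasDerivAt J (a * J t + σ * f t) t) (hJ0 : J 0 = 0)
    (hf : ∀ t, 0 ≤ t → f t ^ 2 ≤ C * ((1 + t) * iterLog t)) {t : ℝ} (ht : 0 ≤ t) :
    J t ^ 2 ≤ σ ^ 2 * C / a ^ 2 * ((1 + t) * iterLog t) := by
  set M := σ ^ 2 * C / a ^ 2 with hM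
  have hM0 : 0 ≤ M := by positivity
  have ha' : a ≠ 0 := ha.ne
  have hMa : M * a ^ 2 = σ ^ 2 * C := by rw [hM]; field_simp
  have hG : ∀ t, 0 ≤ t → HasDerivAt (fun t => J t ^ 2 - M * ((1 + t) * iterLog t))
      (2 * J t * (a * J t + σ * f t) -
        M * (iterLog t + (1 + t) * (1 / (1 + t) / (3 + log (1 + t))))) t := by
    intro t ht
    have h := ((hJ t ht).pow 2).sub
      ((((hasDerivAt_id t).const_add 1).mul (hasDerivAt_iterLog ht)).const_mul M)
    refine h.congr_deriv ?_
    simp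
  have hq : ∀ t : ℝ, 0 ≤ t → HasDerivAt (fun t => a * t) a t := fun t _ => by
    simpa using (hasDerivAt_id t).const_mul a
  have h := nonpos_of_hasDerivAt_le (p := fun _ => a) hG hq (fun t ht => ?_) ?_ ht
  · linarith
  · have hL := one_le_iterLog ht
    have h1 : 0 ≤ M * (iterLog t + (1 + t) * (1 / (1 + t) / (3 + log (1 + t)))) :=
      mul_nonneg hM0 (add_nonneg (by linarith)
        (mul_nonneg (by linarith) (deriv_iterLog_nonneg ht)))
    have h2 := mul_le_mul_of_nonneg_left (hf t ht) (sq_nonneg σ)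
    rw [← mul_assoc, ← hMa] at h2
    have h3 : -a * (2 * J t * (a * J t + σ * f t) - a * (J t ^ 2 - M * ((1 + t) * iterLog t))) ≤
        0 := by
      nlinarith [sq_nonneg (a * J t + σ * f t)]
    have h4 : 2 * J t * (a * J t + σ * f t) - a * (J t ^ 2 - M * ((1 + t) * iterLog t)) ≤ 0 :=
      nonpos_of_mul_nonpos_right h3 (by linarith)
    linarith
  · have hL := one_le_iterLog le_rfl
    simp only [hJ0]
    nlinarith [mul_nonneg hM0 (by linarith : 0 ≤ iterLog 0)]

/-- The perturbed averaged equation: `K' = Y`, `Y' = a Y + b (K + J) / (1 + t)` with forcing `J`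
of order `√((1 + t) log log t)`. In the regime `2 b + a < 0` the forcing dominates, and
`K + J` is of the same order. -/
lemma exists_sq_add_le_of_averaged_equation {a b C : ℝ} (ha : a < 0) (h2ba : 2 * b + a < 0)
    (hC : 0 ≤ C) {Y K J : ℝ → ℝ} (hK : ∀ t, 0 ≤ t → HasDerivAt K (Y t) t)
    (hY : ∀ t, 0 ≤ t → HasDerivAt Y (a * Y t + b / (1 + t) * (K t + J t)) t)
    (hJ : ∀ t, 0 ≤ t → J t ^ 2 ≤ C * ((1 + t) * iterLog t)) :
    ∃ Q t₀, 0 ≤ Q ∧ 0 ≤ t₀ ∧ 2 ≤ -a * (1 + t₀) ∧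
      ∀ t, t₀ ≤ t → (K t + J t) ^ 2 ≤ Q * ((1 + t) * iterLog t) := by
  have ha' : a ≠ 0 := ha.ne
  obtain ⟨α, hα⟩ : ∃ α, b = -a * α := ⟨-b / a, by field_simp⟩
  set ε := 1 / 2 - α with hε
  have hε0 : 0 < ε := by
    have : -a * ε > 0 := by rw [hε]; nlinarith
    exact (pos_iff_pos_of_mul_pos this).1 (by linarith)
  set D := b ^ 2 / ε + b ^ 2 with hD
  have hD0 : 0 ≤ D := by positivity
  obtain ⟨t₀, ht₀, ht₀a, ht₀b⟩ : ∃ t₀ : ℝ, 0 ≤ t₀ ∧ 1 / 2 - 3 * α ≤ -2 * a * (1 + t₀) ∧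
      2 ≤ -a * (1 + t₀) := by
    refine ⟨(|1 / 2 - 3 * α| + 2) / -a, by have := neg_pos.2 ha; positivity, ?_, ?_⟩ <;>
    · have h1 : -a * ((|1 / 2 - 3 * α| + 2) / -a) = |1 / 2 - 3 * α| + 2 := by
        field_simp [ha.ne]
      nlinarith [le_abs_self (1 / 2 - 3 * α), abs_nonneg (1 / 2 - 3 * α)]
  have hmono : ∀ t, t₀ ≤ t → 1 / 2 - 3 * α ≤ -2 * a * (1 + t) := fun t ht => by nlinarith
  set W : ℝ → ℝ := fun t => Y t - a * K t with hWdef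
  have hW : ∀ t, 0 ≤ t → HasDerivAt W (b / (1 + t) * (K t + J t)) t := by
    intro t ht
    refine ((hY t ht).sub ((hK t ht).const_mul a)).congr_deriv ?_
    ring
  set M := D * C / ε + (W t₀ ^ 2 + Y t₀ ^ 2) with hM
  have hM0 : 0 ≤ M := by positivity
  have hMε : D * C ≤ ε * M := by
    have : ε * M = D * C + ε * (W t₀ ^ 2 + Y t₀ ^ 2) := by rw [hM]; field_simp
    rw [this]
    have : 0 ≤ ε * (W t₀ ^ 2 + Y t₀ ^ 2) := by positivity
    linarith
  have hV : ∀ t, t₀ ≤ t → W t ^ 2 + Y t ^ 2 ≤ M * ((1 + t) * iterLog t) := by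
    intro t ht
    have hG : ∀ t, t₀ ≤ t → HasDerivAt
        (fun t => W t ^ 2 + Y t ^ 2 - M * ((1 + t) * iterLog t))
        (2 * W t * (b / (1 + t) * (K t + J t)) +
          2 * Y t * (a * Y t + b / (1 + t) * (K t + J t)) -
          M * (iterLog t + (1 + t) * (1 / (1 + t) / (3 + log (1 + t))))) t := by
      intro t ht
      have ht' : 0 ≤ t := ht₀.trans ht
      have h := (((hW t ht').pow 2).add ((hY t ht').pow 2)).sub
        ((((hasDerivAt_id t).const_add 1).mul (hasDerivAt_iterLog ht')).const_mul M)
      refine h.congr_deriv ?_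
      simp
    have hq : ∀ t, t₀ ≤ t → HasDerivAt (fun t => (1 / 2 + α) * log (1 + t))
        ((1 / 2 + α) / (1 + t)) t := by
      intro t ht
      refine ((((hasDerivAt_id t).const_add 1).log (by simp; linarith)).const_mul
        (1 / 2 + α)).congr_deriv ?_
      simp [div_eq_mul_inv]
    have h := nonpos_of_hasDerivAt_le hG hq (fun t ht => ?_) ?_ ht
    · linarith
    · have ht' : 0 ≤ t := ht₀.trans ht
      have h1t : 0 < 1 + t := by linarith
      have hL := one_le_iterLog ht'
      have hLd : 0 ≤ M * ((1 + t) * (1 / (1 + t) / (3 + log (1 + t)))) :=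
        mul_nonneg hM0 (mul_nonneg h1t.le (deriv_iterLog_nonneg ht'))
      suffices hs : 2 * W t * (b * (K t + J t)) + 2 * Y t * (b * (K t + J t)) +
          2 * a * (1 + t) * Y t ^ 2 ≤ (1 / 2 + α) * (W t ^ 2 + Y t ^ 2) +
            M * ε * ((1 + t) * iterLog t) by
        have h5 := div_le_div_of_nonneg_right hs h1t.le
        have e1 : (2 * W t * (b * (K t + J t)) + 2 * Y t * (b * (K t + J t)) +
          2 * a * (1 + t) * Y t ^ 2) / (1 + t) = 2 * W t * (b / (1 + t) * (K t + J t)) +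
          2 * Y t * (a * Y t + b / (1 + t) * (K t + J t)) := by
          field_simp
          ring
        have e2 : ((1 / 2 + α) * (W t ^ 2 + Y t ^ 2) + M * ε * ((1 + t) * iterLog t)) / (1 + t) =
            (1 / 2 + α) / (1 + t) * (W t ^ 2 + Y t ^ 2 - M * ((1 + t) * iterLog t)) +
              M * iterLog t := by
          rw [hε]
          field_simp
          ring
        rw [e1, e2] at h5
        linarith
      have hbK : b * K t = α * (W t - Y t) := by rw [hα, hWdef]; ring
      have hcross : 2 * W t * (b * (K t + J t)) + 2 * Y t * (b * (K t + J t)) =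
          2 * α * W t ^ 2 - 2 * α * Y t ^ 2 + 2 * W t * (b * J t) + 2 * Y t * (b * J t) := by
        linear_combination (2 * W t + 2 * Y t) * hbK
      have hWJ : 2 * W t * (b * J t) ≤ ε * W t ^ 2 + b ^ 2 / ε * J t ^ 2 := by
        have h6 : ε * W t ^ 2 + b ^ 2 / ε * J t ^ 2 - 2 * W t * (b * J t) =
            (ε * W t - b * J t) ^ 2 / ε := by
          field_simp
          ring
        have : 0 ≤ (ε * W t - b * J t) ^ 2 / ε := by positivity
        linarith
      have hYJ : 2 * Y t * (b * J t) ≤ Y t ^ 2 + b ^ 2 * J t ^ 2 := by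
        nlinarith [sq_nonneg (Y t - b * J t)]
      have hJD : D * J t ^ 2 ≤ M * ε * ((1 + t) * iterLog t) := by
        calc D * J t ^ 2 ≤ D * (C * ((1 + t) * iterLog t)) :=
              mul_le_mul_of_nonneg_left (hJ t ht') hD0
          _ = D * C * ((1 + t) * iterLog t) := by ring
          _ ≤ ε * M * ((1 + t) * iterLog t) := by gcongr
          _ = _ := by ring
      have hYY := mul_le_mul_of_nonneg_right (hmono t ht) (sq_nonneg (Y t))
      have e3 : D * J t ^ 2 = b ^ 2 / ε * J t ^ 2 + b ^ 2 * J t ^ 2 := by rw [hD]; ring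
      have e4 : ε * W t ^ 2 = (1 / 2 - α) * W t ^ 2 := by rw [hε]
      rw [hcross]
      linarith
    · have hL := one_le_iterLog ht₀
      have h1 : M ≤ M * ((1 + t₀) * iterLog t₀) := le_mul_of_one_le_right hM0 (by nlinarith)
      have h2 : 0 ≤ D * C / ε := by positivity
      linarith
  refine ⟨4 * M / a ^ 2 + 2 * C, t₀, by positivity, ht₀, ht₀b, fun t ht => ?_⟩
  have h1 : K t ^ 2 ≤ 2 * M / a ^ 2 * ((1 + t) * iterLog t) := by
    rw [div_mul_eq_mul_div, le_div_iff₀ (by positivity)]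
    have e : K t ^ 2 * a ^ 2 = (Y t - W t) ^ 2 := by rw [hWdef]; ring
    rw [e]
    nlinarith [hV t ht, sq_nonneg (Y t + W t)]
  have h2 := hJ t (ht₀.trans ht)
  have e : (4 * M / a ^ 2 + 2 * C) * ((1 + t) * iterLog t) =
      2 * (2 * M / a ^ 2 * ((1 + t) * iterLog t)) +
      2 * (C * ((1 + t) * iterLog t)) := by ring
  rw [e]
  nlinarith [sq_nonneg (K t - J t)]

/-- A stable equation `Y' = a Y + b S / (1 + t)` whose input `S` is of order
`√((1 + t) log log t)` has solutions of order `√(log log t / (1 + t))`. -/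
lemma exists_sq_le_of_hasDerivAt_damped {a b Q t₀ : ℝ} (ha : a < 0) (hQ0 : 0 ≤ Q) (ht₀ : 0 ≤ t₀)
    (ht₀b : 2 ≤ -a * (1 + t₀)) {Y S : ℝ → ℝ}
    (hY : ∀ t, 0 ≤ t → HasDerivAt Y (a * Y t + b / (1 + t) * S t) t)
    (hS : ∀ t, t₀ ≤ t → S t ^ 2 ≤ Q * ((1 + t) * iterLog t)) :
    ∃ N, 0 ≤ N ∧ ∀ t, t₀ ≤ t → Y t ^ 2 ≤ N * (iterLog t / (1 + t)) := by
  have ha' : a ≠ 0 := ha.ne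
  have hmono : ∀ t, t₀ ≤ t → 2 ≤ -a * (1 + t) := fun t ht => by nlinarith
  set N := 2 * b ^ 2 * Q / a ^ 2 + Y t₀ ^ 2 * (1 + t₀) with hN
  have hN0 : 0 ≤ N := by positivity
  refine ⟨N, hN0, fun t ht => ?_⟩
  have hH : ∀ t, t₀ ≤ t → HasDerivAt (fun t => Y t ^ 2 - N * (iterLog t / (1 + t)))
      (2 * Y t * (a * Y t + b / (1 + t) * S t) -
        N * ((1 / (1 + t) / (3 + log (1 + t)) * (1 + t) - iterLog t) / (1 + t) ^ 2)) t := by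
    intro t ht
    have ht' : 0 ≤ t := ht₀.trans ht
    have h := ((hY t ht').pow 2).sub
      (((hasDerivAt_iterLog ht').div ((hasDerivAt_id t).const_add 1) (by simp; linarith)).const_mul N)
    refine h.congr_deriv ?_
    simp
  have hq : ∀ t : ℝ, t₀ ≤ t → HasDerivAt (fun t => a * t) a t := fun t _ => by
    simpa using (hasDerivAt_id t).const_mul a
  have h := nonpos_of_hasDerivAt_le (p := fun _ => a) hH hq (fun t ht => ?_) ?_ ht
  · linarith
  · have ht' : 0 ≤ t := ht₀.trans ht
    have h1t : 0 < 1 + t := by linarith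
    have hL := one_le_iterLog ht'
    set R := iterLog t / (1 + t) with hR
    have hR0 : 0 ≤ R := by positivity
    have hR' : -N * ((1 / (1 + t) / (3 + log (1 + t)) * (1 + t) - iterLog t) / (1 + t) ^ 2) ≤
        N * (-a / 2) * R := by
      have h1 : -((1 / (1 + t) / (3 + log (1 + t)) * (1 + t) - iterLog t) / (1 + t) ^ 2) ≤
          iterLog t / (1 + t) ^ 2 := by
        rw [← neg_div]
        gcongr
        nlinarith [deriv_iterLog_nonneg ht']
      have h2 : iterLog t / (1 + t) ^ 2 ≤ (-a / 2) * R := by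
        rw [hR, ← mul_div_assoc, div_le_div_iff₀ (by positivity) h1t]
        have h3 := hmono t ht
        have h4 : 0 ≤ iterLog t * (1 + t) := by positivity
        nlinarith
      nlinarith
    have hcross : -a * (2 * Y t * (b / (1 + t) * S t)) ≤
        -a * (-a * Y t ^ 2) + b ^ 2 * Q * R := by
      have h1 : (b / (1 + t) * S t) ^ 2 ≤ b ^ 2 * Q * R := by
        have e : b ^ 2 * Q * R = (b / (1 + t)) ^ 2 * (Q * ((1 + t) * iterLog t)) := by
          rw [hR]
          field_simp
        rw [e, mul_pow]
        exact mul_le_mul_of_nonneg_left (hS t ht) (sq_nonneg _)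
      nlinarith [sq_nonneg (a * Y t + b / (1 + t) * S t)]
    have hNQ : b ^ 2 * Q * R ≤ -a * (-a / 2 * N * R) := by
      have e : -a * (-a / 2 * N * R) = b ^ 2 * Q * R + a ^ 2 / 2 * (Y t₀ ^ 2 * (1 + t₀)) * R := by
        rw [hN]
        field_simp
      have : 0 ≤ a ^ 2 / 2 * (Y t₀ ^ 2 * (1 + t₀)) * R := by positivity
      linarith
    have h5 : 2 * Y t * (b / (1 + t) * S t) ≤ -a * Y t ^ 2 + -a / 2 * N * R := by
      refine le_of_mul_le_mul_left ?_ (by linarith : 0 < -a)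
      linarith
    linarith
  · have hL := one_le_iterLog ht₀
    have h1 : Y t₀ ^ 2 ≤ N * (iterLog t₀ / (1 + t₀)) := by
      rw [← mul_div_assoc, le_div_iff₀ (by linarith)]
      have h2 : 0 ≤ 2 * b ^ 2 * Q / a ^ 2 := by positivity
      calc Y t₀ ^ 2 * (1 + t₀) ≤ N := by linarith
        _ ≤ N * iterLog t₀ := le_mul_of_one_le_right hN0 hL
    linarith

/-- Pathwise form of the comparison between the averaged equation and its Ornstein–Uhlenbeck part. -/
lemma exists_sq_sub_le_of_integral_equations {a b σ C c x₀ : ℝ} (ha : a < 0)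
    (h2ba : 2 * b + a < 0) (hC : 0 ≤ C) {x u f : ℝ → ℝ} (hx : ContinuousOn x (Ici 0))
    (hu : ContinuousOn u (Ici 0)) (hf : ∀ t, 0 ≤ t → f t ^ 2 ≤ C * ((1 + t) * iterLog t))
    (hxeq : ∀ t, 0 ≤ t → x t = x₀ +
      (∫ s in (0 : ℝ)..t, (a * x s + b / (1 + s) * (c + ∫ r in (0 : ℝ)..s, x r))) + σ * f t)
    (hueq : ∀ t, 0 ≤ t → u t = a * (∫ s in (0 : ℝ)..t, u s) + σ * f t) :
    ∃ N t₀, 0 ≤ N ∧ 0 ≤ t₀ ∧ ∀ t, t₀ ≤ t → (x t - u t) ^ 2 ≤ N * (iterLog t / (1 + t)) := by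
  set x' : ℝ → ℝ := fun t => x (max t 0) with hx'
  set u' : ℝ → ℝ := fun t => u (max t 0) with hu'
  have hxc : Continuous x' := hx.comp_continuous (by fun_prop) fun t => le_max_right t 0
  have huc : Continuous u' := hu.comp_continuous (by fun_prop) fun t => le_max_right t 0
  have hxx : ∀ t, 0 ≤ t → x t = x' t := fun t ht => by simp [hx', max_eq_left ht]
  have huu : ∀ t, 0 ≤ t → u t = u' t := fun t ht => by simp [hu', max_eq_left ht]
  have hIx : ∀ t, 0 ≤ t → ∫ s in (0 : ℝ)..t, x s = ∫ s in (0 : ℝ)..t, x' s := fun t ht =>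
    intervalIntegral.integral_congr fun s hs => hxx s (by rw [uIcc_of_le ht] at hs; exact hs.1)
  have hIu : ∀ t, 0 ≤ t → ∫ s in (0 : ℝ)..t, u s = ∫ s in (0 : ℝ)..t, u' s := fun t ht =>
    intervalIntegral.integral_congr fun s hs => huu s (by rw [uIcc_of_le ht] at hs; exact hs.1)
  set J : ℝ → ℝ := fun t => ∫ s in (0 : ℝ)..t, u' s with hJdef
  set K : ℝ → ℝ := fun t => c + ∫ s in (0 : ℝ)..t, (x' s - u' s) with hKdef
  have hJd : ∀ t, HasDerivAt J (u' t) t := fun t => huc.integral_hasStrictDerivAt 0 t |>.hasDerivAt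
  have hKd : ∀ t, HasDerivAt K (x' t - u' t) t := fun t =>
    ((hxc.sub huc).integral_hasStrictDerivAt 0 t |>.hasDerivAt).const_add c
  have hKJ : ∀ t, c + ∫ s in (0 : ℝ)..t, x' s = K t + J t := by
    intro t
    simp only [hKdef, hJdef]
    rw [intervalIntegral.integral_sub (hxc.intervalIntegrable _ _) (huc.intervalIntegrable _ _)]
    ring
  have hJc : Continuous J := continuous_iff_continuousAt.2 fun t => (hJd t).continuousAt
  have hKc : Continuous K := continuous_iff_continuousAt.2 fun t => (hKd t).continuousAt
  set g : ℝ → ℝ := fun s => a * (x' s - u' s) + b / (1 + |s|) * (K s + J s) with hg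
  have hbc : Continuous fun s : ℝ => b / (1 + |s|) :=
    continuous_const.div (by fun_prop) fun s => by positivity
  have hgc : Continuous g := by
    simp only [hg]
    fun_prop
  set Y : ℝ → ℝ := fun t => x₀ + ∫ s in (0 : ℝ)..t, g s with hYdef
  have hYd : ∀ t, HasDerivAt Y (g t) t := fun t =>
    (hgc.integral_hasStrictDerivAt 0 t |>.hasDerivAt).const_add x₀
  have hYeq : ∀ t, 0 ≤ t → x t - u t = Y t := by
    intro t ht
    rw [hxeq t ht, hueq t ht, hIu t ht]
    have h1 : ∫ s in (0 : ℝ)..t, (a * x s + b / (1 + s) * (c + ∫ r in (0 : ℝ)..s, x r)) =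
        ∫ s in (0 : ℝ)..t, (g s + a * u' s) := by
      refine intervalIntegral.integral_congr fun s hs => ?_
      rw [uIcc_of_le ht] at hs
      simp only [hg]
      rw [hxx s hs.1, hIx s hs.1, hKJ s, abs_of_nonneg hs.1]
      ring
    rw [h1, intervalIntegral.integral_add (hgc.intervalIntegrable _ _)
      ((huc.const_mul a).intervalIntegrable _ _), intervalIntegral.integral_const_mul]
    simp only [hYdef]
    ring
  have hJ2 : ∀ t, 0 ≤ t → J t ^ 2 ≤ σ ^ 2 * C / a ^ 2 * ((1 + t) * iterLog t) := fun t ht =>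
    sq_le_of_hasDerivAt_linear ha hC
      (fun s hs => by
        have h1 : u' s = a * J s + σ * f s := by rw [← huu s hs, hueq s hs, hIu s hs]
        exact h1 ▸ hJd s)
      (by simp [hJdef]) hf ht
  have hY' : ∀ t, 0 ≤ t → HasDerivAt Y (a * Y t + b / (1 + t) * (K t + J t)) t := by
    intro t ht
    have h1 := hYd t
    simp only [hg] at h1
    rwa [← hxx t ht, ← huu t ht, hYeq t ht, abs_of_nonneg ht] at h1
  have hK' : ∀ t, 0 ≤ t → HasDerivAt K (Y t) t := fun t ht => by
    rw [← hYeq t ht, hxx t ht, huu t ht]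
    exact hKd t
  obtain ⟨Q, t₀, hQ, ht₀, ht₀a, hS⟩ :=
    exists_sq_add_le_of_averaged_equation ha h2ba (by positivity) hK' hY' hJ2
  obtain ⟨N, hN, h⟩ := exists_sq_le_of_hasDerivAt_damped ha hQ ht₀ ht₀a hY' hS
  exact ⟨N, t₀, hN, ht₀, fun t ht => by rw [hYeq t (ht₀.trans ht)]; exact h t ht⟩

lemma eventually_iterLog_le : ∀ᶠ t : ℝ in atTop, iterLog t ≤ 2 * log (log t) := by
  filter_upwards [tendsto_log_atTop.eventually_ge_atTop 3, eventually_ge_atTop 1] with t h3 h1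
  have h2 : log (1 + t) ≤ log 2 + log t := by
    rw [← log_mul (by norm_num) (by linarith)]
    exact log_le_log (by linarith) (by linarith)
  have h0 : 0 ≤ log (1 + t) := log_nonneg (by linarith)
  calc iterLog t ≤ log (log t ^ 2) :=
        log_le_log (by linarith) (by nlinarith [log_two_lt_d9])
    _ = 2 * log (log t) := by rw [log_pow]; norm_num

lemma limsup_abs_div_mem_Ico {y : ℝ → ℝ} {N t₀ : ℝ} (hN : 0 ≤ N)
    (hy : ∀ t, t₀ ≤ t → y t ^ 2 ≤ N * (iterLog t / (1 + t))) :
    Filter.limsup (fun t : ℝ =>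
      ((|y t| / (t ^ (-(1 : ℝ) / 2) * √(log (log t))) : ℝ) : EReal)) atTop ∈ Ico (0 : EReal) ⊤ := by
  constructor
  · refine le_limsup_of_frequently_le' (Eventually.frequently ?_)
    filter_upwards [eventually_ge_atTop 0] with t ht
    exact_mod_cast (by positivity : 0 ≤ |y t| / (t ^ (-(1 : ℝ) / 2) * √(log (log t))))
  · refine lt_of_le_of_lt (limsup_le_of_le (a := ((√(2 * N) : ℝ) : EReal)) (by isBoundedDefault) ?_)
      (EReal.coe_lt_top _)
    filter_upwards [eventually_iterLog_le, eventually_ge_atTop 1, eventually_ge_atTop t₀]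
      with t hL h1 ht
    have ht0 : 0 < t := by linarith
    have hL1 := one_le_iterLog ht0.le
    have hll : 0 < log (log t) := by linarith
    have hpow : t ^ (-(1 : ℝ) / 2) = (√t)⁻¹ := by
      rw [sqrt_eq_rpow, ← rpow_neg ht0.le, neg_div]
    rw [EReal.coe_le_coe_iff, div_le_iff₀ (by positivity), hpow, ← sqrt_inv, ← sqrt_mul (by positivity),
      ← sqrt_mul (by positivity)]
    refine abs_le_sqrt ((hy t ht).trans ?_)
    calc N * (iterLog t / (1 + t)) ≤ N * (2 * log (log t) / t) := by
          gcongr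
          linarith
      _ = 2 * N * (t⁻¹ * log (log t)) := by ring

theorem sfde_XU_rate_sqrt {Ω : Type*} {mΩ : MeasurableSpace Ω} (P : Measure Ω) [IsProbabilityMeasure P]
    (F : MeasureTheory.Filtration ℝ mΩ) (a b σ : ℝ) (ψ : ℝ → ℝ) (B X : ℝ → Ω → ℝ)
    (hσ : 0 < σ) (hψ : ContinuousOn ψ (Set.Icc (-1 : ℝ) 0))
    (hB : IsStdBrownian P F B) (hX : IsSolutionSFDE P F a b σ ψ B X)
    (U : ℝ → Ω → ℝ) (hU : IsOUProcess P F a σ B U)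
    (ha : a < 0) (hab : a + b < 0) (h2ba : 2 * b + a < 0) :
    ∀ᵐ ω ∂P,
      Filter.limsup (fun t : ℝ => ((|X t ω - U t ω| / (t ^ (-(1:ℝ)/2) * Real.sqrt (Real.log (Real.log t))) : ℝ) : EReal)) Filter.atTop
        ∈ Set.Ico (0 : EReal) ⊤ := by
  filter_upwards [hB.ae_exists_sq_le, hX.2.2, hU.2.2] with ω ⟨C, hC, hBC⟩ hXeq hUeq
  obtain ⟨N, t₀, hN, -, h⟩ := exists_sq_sub_le_of_integral_equations ha h2ba hC (hX.2.1 ω)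
    (hU.2.1 ω) hBC hXeq hUeq
  exact limsup_abs_div_mem_Ico hN h
end
end

section
/- Suppose a < 0, a + b < 0 and 2b + a = 0. Then, almost surely, limsup_{t→∞} |X(t) − U(t)| / ( t^{−1/2} (log t) √(log log t) ) is finite (i.e. lies in [0,∞)). -/
open MeasureTheory ProbabilityTheory Filter Real Set

noncomputable section

/-- The shifted logarithm `log (t + 16)`. -/
def shiftedLog (t : ℝ) : ℝ := Real.log (t + 16)

/-- The shifted iterated logarithm, which is at least `1` on `[0, ∞)`. -/
def shiftedLogLog (t : ℝ) : ℝ := Real.log (shiftedLog t)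

/-- The growth rate `log t * √(log log t)`, shifted to be regular on `[0, ∞)`. -/
def logRate (t : ℝ) : ℝ := shiftedLog t * √(shiftedLogLog t)

/-- An integrable weight: the derivative of `-1 / log log (t + 16)`. -/
def logWeight (t : ℝ) : ℝ := ((t + 16) * shiftedLog t * shiftedLogLog t ^ 2)⁻¹

lemma exp_one_le_shiftedLog {t : ℝ} (ht : 0 ≤ t) : Real.exp 1 ≤ shiftedLog t := by
  have h16 : Real.log 16 = 4 * Real.log 2 := by
    rw [show (16 : ℝ) = 2 ^ 4 by norm_num, Real.log_pow]; norm_num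
  have h1 : Real.log 16 ≤ shiftedLog t := Real.log_le_log (by norm_num) (by linarith)
  linarith [Real.log_two_gt_d9, Real.exp_one_lt_d9]

lemma one_le_shiftedLog {t : ℝ} (ht : 0 ≤ t) : 1 ≤ shiftedLog t := by
  linarith [exp_one_le_shiftedLog ht, Real.add_one_le_exp (1 : ℝ)]

lemma one_le_shiftedLogLog {t : ℝ} (ht : 0 ≤ t) : 1 ≤ shiftedLogLog t := by
  rw [shiftedLogLog, Real.le_log_iff_exp_le (by linarith [one_le_shiftedLog ht])]
  exact exp_one_le_shiftedLog ht

lemma one_le_sqrt_shiftedLogLog {t : ℝ} (ht : 0 ≤ t) : 1 ≤ √(shiftedLogLog t) :=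
  Real.one_le_sqrt.2 (one_le_shiftedLogLog ht)

lemma shiftedLog_mono {s t : ℝ} (hs : 0 ≤ s) (hst : s ≤ t) : shiftedLog s ≤ shiftedLog t :=
  Real.log_le_log (by linarith) (by linarith)

lemma shiftedLogLog_mono {s t : ℝ} (hs : 0 ≤ s) (hst : s ≤ t) :
    shiftedLogLog s ≤ shiftedLogLog t :=
  Real.log_le_log (by linarith [one_le_shiftedLog hs]) (shiftedLog_mono hs hst)

lemma logRate_mono {s t : ℝ} (hs : 0 ≤ s) (hst : s ≤ t) : logRate s ≤ logRate t :=
  mul_le_mul (shiftedLog_mono hs hst) (Real.sqrt_le_sqrt (shiftedLogLog_mono hs hst))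
    (Real.sqrt_nonneg _) (by linarith [one_le_shiftedLog (hs.trans hst)])

lemma shiftedLog_le_logRate {t : ℝ} (ht : 0 ≤ t) : shiftedLog t ≤ logRate t :=
  le_mul_of_one_le_right (by linarith [one_le_shiftedLog ht]) (one_le_sqrt_shiftedLogLog ht)

lemma one_le_logRate {t : ℝ} (ht : 0 ≤ t) : 1 ≤ logRate t :=
  (one_le_shiftedLog ht).trans (shiftedLog_le_logRate ht)

lemma hasDerivAt_shiftedLog {t : ℝ} (ht : 0 ≤ t) :
    HasDerivAt shiftedLog (t + 16)⁻¹ t := by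
  have h : HasDerivAt (fun t => Real.log (t + 16)) (1 / (t + 16)) t :=
    ((hasDerivAt_id t).add_const (16 : ℝ)).log (by simp; linarith)
  rwa [one_div] at h

lemma hasDerivAt_shiftedLogLog {t : ℝ} (ht : 0 ≤ t) :
    HasDerivAt shiftedLogLog ((t + 16)⁻¹ / shiftedLog t) t :=
  (hasDerivAt_shiftedLog ht).log (by linarith [one_le_shiftedLog ht])

lemma logWeight_nonneg {t : ℝ} (ht : 0 ≤ t) : 0 ≤ logWeight t := by
  have := one_le_shiftedLog ht
  rw [logWeight]; positivity

lemma measurable_logWeight : Measurable logWeight := by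
  unfold logWeight shiftedLogLog shiftedLog; fun_prop

lemma integrableOn_logWeight : IntegrableOn logWeight (Ioi 0) := by
  have hd : ∀ t : ℝ, 0 ≤ t → HasDerivAt (fun t => -(shiftedLogLog t)⁻¹) (logWeight t) t := by
    intro t ht
    have h1 := one_le_shiftedLogLog ht
    have h2 := one_le_shiftedLog ht
    refine HasDerivAt.congr_deriv ((hasDerivAt_shiftedLogLog ht).inv (by linarith)).neg ?_
    rw [logWeight]
    field_simp
  have hlim : Tendsto (fun t => -(shiftedLogLog t)⁻¹) atTop (nhds (-0)) :=
    ((Real.tendsto_log_atTop.comp (Real.tendsto_log_atTop.comp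
      (tendsto_atTop_add_const_right _ (16 : ℝ) tendsto_id))).inv_tendsto_atTop).neg
  exact integrableOn_Ioi_deriv_of_nonneg (hd 0 le_rfl).continuousAt.continuousWithinAt
    (fun t ht => hd t (le_of_lt ht)) (fun t ht => logWeight_nonneg (le_of_lt ht)) hlim

lemma lintegral_exp_abs_le_of_map_eq_gaussianReal {Ω : Type*} {mΩ : MeasurableSpace Ω}
    {P : Measure Ω} {Y : Ω → ℝ} (hY : Measurable Y) {v : NNReal}
    (hlaw : P.map Y = gaussianReal 0 v) {c : ℝ} (hc : v * c ^ 2 ≤ 1) :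
    ∫⁻ ω, ENNReal.ofReal (Real.exp |c * Y ω|) ∂P ≤ ENNReal.ofReal (2 * Real.exp 1) := by
  have hint : ∀ r : ℝ, Integrable (fun ω => Real.exp (r * Y ω)) P := by
    intro r
    have h := integrable_exp_mul_gaussianReal (μ := 0) (v := v) r
    rw [← hlaw] at h
    exact h.comp_measurable hY
  have hmgf : ∀ r : ℝ, v * r ^ 2 ≤ 1 → ∫ ω, Real.exp (r * Y ω) ∂P ≤ Real.exp 1 := by
    intro r hr
    have h := mgf_gaussianReal hlaw r
    rw [mgf] at h
    rw [h]
    exact Real.exp_le_exp.2 (by linarith)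
  calc ∫⁻ ω, ENNReal.ofReal (Real.exp |c * Y ω|) ∂P
      ≤ ∫⁻ ω, ENNReal.ofReal (Real.exp (c * Y ω) + Real.exp ((-c) * Y ω)) ∂P := by
        refine lintegral_mono fun ω => ENNReal.ofReal_le_ofReal ?_
        rcases abs_cases (c * Y ω) with ⟨h, _⟩ | ⟨h, _⟩
        · rw [h]; linarith [Real.exp_pos (-c * Y ω)]
        · rw [h, neg_mul]; linarith [Real.exp_pos (c * Y ω)]
    _ = ENNReal.ofReal (∫ ω, (Real.exp (c * Y ω) + Real.exp ((-c) * Y ω)) ∂P) :=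
        (ofReal_integral_eq_lintegral_ofReal ((hint c).add (hint (-c)))
          (Eventually.of_forall fun ω => (add_pos (Real.exp_pos _) (Real.exp_pos _)).le)).symm
    _ ≤ ENNReal.ofReal (2 * Real.exp 1) := by
        refine ENNReal.ofReal_le_ofReal ?_
        rw [integral_add (hint c) (hint (-c))]
        linarith [hmgf c hc, hmgf (-c) (by simpa using hc)]

lemma IsStdBrownian.ae_integrableOn_exp {Ω : Type*} {mΩ : MeasurableSpace Ω} {P : Measure Ω}
    [IsProbabilityMeasure P] {F : MeasureTheory.Filtration ℝ mΩ} {B : ℝ → Ω → ℝ}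
    (hB : IsStdBrownian P F B) :
    ∀ᵐ ω ∂P, IntegrableOn (fun s => Real.exp (|B s ω| / √(1 + s)) * logWeight s) (Ioi 0) := by
  obtain ⟨had, h0, hcont, hlaw, -⟩ := hB
  have hmeas : ∀ t, Measurable (B t) := fun t => (had t).mono (F.le t) le_rfl
  have hunc : Measurable (Function.uncurry B) :=
    measurable_uncurry_of_continuous_of_measurable hcont hmeas
  set f : Ω → ℝ → ENNReal := fun ω s =>
    ENNReal.ofReal (Real.exp (|B s ω| / √(1 + s)) * logWeight s) with hf
  have hB' : Measurable (fun p : Ω × ℝ => B p.2 p.1) := hunc.comp measurable_swap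
  have hw : Measurable (fun p : Ω × ℝ => logWeight p.2) := measurable_logWeight.comp measurable_snd
  have hfm : Measurable (Function.uncurry f) := by
    have : Measurable (fun p : Ω × ℝ =>
        ENNReal.ofReal (Real.exp (|B p.2 p.1| / √(1 + p.2)) * logWeight p.2)) := by
      have := hB'.abs
      fun_prop
    exact this
  have hbound : ∀ s : ℝ, 0 < s →
      ∫⁻ ω, f ω s ∂P ≤ ENNReal.ofReal (2 * Real.exp 1) * ENNReal.ofReal (logWeight s) := by
    intro s hs
    have hl : P.map (B s) = gaussianReal 0 (Real.toNNReal s) := by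
      simpa [h0] using hlaw 0 s le_rfl hs.le
    have hc : (Real.toNNReal s : ℝ) * ((√(1 + s))⁻¹) ^ 2 ≤ 1 := by
      rw [Real.coe_toNNReal _ hs.le, inv_pow, Real.sq_sqrt (by linarith), ← div_eq_mul_inv,
        div_le_one (by linarith)]
      linarith
    have h := lintegral_exp_abs_le_of_map_eq_gaussianReal (hmeas s) hl hc
    calc ∫⁻ ω, f ω s ∂P
        = ∫⁻ ω, ENNReal.ofReal (Real.exp |(√(1 + s))⁻¹ * B s ω|)
            * ENNReal.ofReal (logWeight s) ∂P := by
          refine lintegral_congr fun ω => ?_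
          rw [← ENNReal.ofReal_mul (Real.exp_pos _).le, abs_mul,
            abs_of_nonneg (inv_nonneg.2 (Real.sqrt_nonneg _)), hf]
          simp only [div_eq_inv_mul]
      _ = (∫⁻ ω, ENNReal.ofReal (Real.exp |(√(1 + s))⁻¹ * B s ω|) ∂P)
            * ENNReal.ofReal (logWeight s) := by
          refine lintegral_mul_const _ ?_
          have := hmeas s
          fun_prop
      _ ≤ _ := by gcongr
  have hfin : ∫⁻ ω, (∫⁻ s in Ioi 0, f ω s) ∂P ≠ ⊤ := by
    rw [lintegral_lintegral_swap hfm.aemeasurable]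
    refine ne_top_of_le_ne_top (b := ENNReal.ofReal (2 * Real.exp 1)
      * ∫⁻ s in Ioi 0, ENNReal.ofReal (logWeight s)) ?_ ?_
    · refine ENNReal.mul_ne_top ENNReal.ofReal_ne_top ?_
      exact integrableOn_logWeight.lintegral_lt_top.ne
    · have hm : Measurable fun s => ENNReal.ofReal (logWeight s) :=
        measurable_logWeight.ennreal_ofReal
      rw [← lintegral_const_mul _ hm]
      exact setLIntegral_mono (hm.const_mul _) fun s hs => hbound s hs
  filter_upwards [ae_lt_top (Measurable.lintegral_prod_right hfm) hfin] with ω hω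
  have hBω := (hcont ω).measurable
  have hwm := measurable_logWeight
  refine (lintegral_ofReal_ne_top_iff_integrable ?_ ?_).1 hω.ne
  · exact Measurable.aestronglyMeasurable (by fun_prop)
  · filter_upwards [ae_restrict_mem measurableSet_Ioi] with s hs
    exact mul_nonneg (Real.exp_pos _).le (logWeight_nonneg (le_of_lt hs))

section HalfLine

variable {f : ℝ → ℝ}

lemma intervalIntegrable_of_continuousOn_Ici (hf : ContinuousOn f (Ici 0)) {t : ℝ} (ht : 0 ≤ t) :
    IntervalIntegrable f volume 0 t :=
  (hf.mono Icc_subset_Ici_self).intervalIntegrable_of_Icc ht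

lemma integral_eq_integral_comp_max (f : ℝ → ℝ) {t : ℝ} (ht : 0 ≤ t) :
    ∫ s in (0 : ℝ)..t, f s = ∫ s in (0 : ℝ)..t, f (max s 0) := by
  refine intervalIntegral.integral_congr fun s hs => ?_
  rw [uIcc_of_le ht] at hs
  simp [max_eq_left hs.1]

lemma continuous_comp_max (hf : ContinuousOn f (Ici 0)) : Continuous fun s => f (max s 0) :=
  hf.comp_continuous (by fun_prop) fun s => le_max_right s 0

lemma hasDerivAt_integral_of_continuousOn_Ici (hf : ContinuousOn f (Ici 0)) {t : ℝ} (ht : 0 < t) :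
    HasDerivAt (fun t => ∫ s in (0 : ℝ)..t, f s) (f t) t := by
  have h := ((continuous_comp_max hf).integral_hasStrictDerivAt 0 t).hasDerivAt
  simp only [max_eq_left ht.le] at h
  refine h.congr_of_eventuallyEq ?_
  filter_upwards [lt_mem_nhds ht] with s hs
  exact integral_eq_integral_comp_max f (le_of_lt hs)

lemma continuousOn_integral_Ici (hf : ContinuousOn f (Ici 0)) :
    ContinuousOn (fun t => ∫ s in (0 : ℝ)..t, f s) (Ici 0) := by
  have h : Continuous fun t => ∫ s in (0 : ℝ)..t, f (max s 0) :=
    intervalIntegral.continuous_primitive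
      (fun a b => (continuous_comp_max hf).intervalIntegrable a b) 0
  exact h.continuousOn.congr fun t ht => integral_eq_integral_comp_max f ht

lemma continuousOn_inv_one_add_mul_sqrt :
    ContinuousOn (fun t : ℝ => ((1 + t) * √(1 + t))⁻¹) (Ici 0) := by
  refine ContinuousOn.inv₀ (by fun_prop) fun t ht => ?_
  have h : (0 : ℝ) < 1 + t := by linarith [mem_Ici.1 ht]
  positivity

/-- A continuous function on `[0, ∞)` with nonpositive derivative is bounded by its initial
value. -/
lemma le_apply_zero_of_hasDerivAt_nonpos {f' : ℝ → ℝ} (hf : ContinuousOn f (Ici 0))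
    (hd : ∀ t, 0 < t → HasDerivAt f (f' t) t) (hf' : ∀ t, 0 < t → f' t ≤ 0) {t : ℝ}
    (ht : 0 ≤ t) : f t ≤ f 0 := by
  have hanti : AntitoneOn f (Ici 0) := by
    refine antitoneOn_of_deriv_nonpos (convex_Ici 0) hf ?_ ?_
    · intro s hs
      rw [interior_Ici] at hs
      exact (hd s hs).differentiableAt.differentiableWithinAt
    · intro s hs
      rw [interior_Ici] at hs
      rw [(hd s hs).deriv]
      exact hf' s hs
  exact hanti (mem_Ici.2 le_rfl) (mem_Ici.2 ht) ht

/-- The variation of constants formula for a scalar linear equation. -/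
lemma eq_variation_of_constants {y : ℝ → ℝ} {r : ℝ} (hf : ContinuousOn f (Ici 0))
    (hy : ContinuousOn y (Ici 0)) (hy' : ∀ t, 0 < t → HasDerivAt y (-r * y t + f t) t) {t : ℝ}
    (ht : 0 ≤ t) :
    y t = Real.exp (-r * t) * y 0 + ∫ s in (0 : ℝ)..t, Real.exp (-r * (t - s)) * f s := by
  have he : ∀ s, HasDerivAt (fun s => Real.exp (-r * (t - s))) (r * Real.exp (-r * (t - s))) s := by
    intro s
    have h : HasDerivAt (fun s => -r * (t - s)) (-r * (-1)) s :=
      ((hasDerivAt_id s).const_sub t).const_mul (-r)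
    refine h.exp.congr_deriv (by ring)
  have hint : IntervalIntegrable (fun s => Real.exp (-r * (t - s)) * f s) volume 0 t :=
    intervalIntegrable_of_continuousOn_Ici (ContinuousOn.mul (by fun_prop) hf) ht
  have h := intervalIntegral.integral_eq_sub_of_hasDerivAt_of_le ht
    (f := fun s => Real.exp (-r * (t - s)) * y s)
    (f' := fun s => Real.exp (-r * (t - s)) * f s)
    ((ContinuousOn.mul (by fun_prop) hy).mono Icc_subset_Ici_self)
    (fun s hs => ((he s).mul (hy' s hs.1)).congr_deriv (by ring)) hint
  rw [h]
  simp

lemma abs_le_variation_of_constants {y : ℝ → ℝ} {r : ℝ} (hf : ContinuousOn f (Ici 0))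
    (hy : ContinuousOn y (Ici 0)) (hy' : ∀ t, 0 < t → HasDerivAt y (-r * y t + f t) t) {t : ℝ}
    (ht : 0 ≤ t) :
    |y t| ≤ Real.exp (-r * t) * |y 0| + ∫ s in (0 : ℝ)..t, Real.exp (-r * (t - s)) * |f s| := by
  rw [eq_variation_of_constants hf hy hy' ht]
  refine (abs_add_le _ _).trans (add_le_add ?_ ?_)
  · rw [abs_mul, Real.abs_exp]
  · refine (intervalIntegral.abs_integral_le_integral_abs ht).trans_eq ?_
    simp only [abs_mul, Real.abs_exp]

lemma integral_exp_neg_mul_sub_le {r : ℝ} (hr : 0 < r) (t : ℝ) :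
    ∫ s in (0 : ℝ)..t, Real.exp (-r * (t - s)) ≤ 1 / r := by
  have he : ∀ s ∈ uIcc 0 t,
      HasDerivAt (fun s => Real.exp (-r * (t - s)) / r) (Real.exp (-r * (t - s))) s := by
    intro s _
    have h : HasDerivAt (fun s => -r * (t - s)) (-r * (-1)) s :=
      ((hasDerivAt_id s).const_sub t).const_mul (-r)
    refine (h.exp.div_const r).congr_deriv ?_
    field_simp
  rw [intervalIntegral.integral_eq_sub_of_hasDerivAt he
    (Continuous.intervalIntegrable (by fun_prop) _ _)]
  have : 0 ≤ Real.exp (-r * (t - 0)) / r := by positivity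
  simp only [sub_self, mul_zero, Real.exp_zero]
  linarith

lemma exp_neg_mul_le_div_sqrt {r : ℝ} (hr : 0 < r) {u : ℝ} (hu : 0 ≤ u) :
    Real.exp (-r * u) ≤ (1 + 1 / r) / √(1 + u) := by
  have hs : √(1 + u) ≤ 1 + u := by
    rw [Real.sqrt_le_left (by linarith)]; nlinarith
  have hs0 : 0 < √(1 + u) := Real.sqrt_pos.2 (by linarith)
  rw [le_div_iff₀ hs0, neg_mul, Real.exp_neg, inv_mul_le_iff₀ (Real.exp_pos _)]
  have h1 : 1 + r * u ≤ Real.exp (r * u) := by linarith [Real.add_one_le_exp (r * u)]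
  calc √(1 + u) ≤ 1 + u := hs
    _ ≤ (1 + r * u) * (1 + 1 / r) := by
        have : (1 + r * u) * (1 + 1 / r) = 1 + u + (r * u + 1 / r) := by field_simp; ring
        rw [this]
        have : 0 ≤ r * u + 1 / r := by positivity
        linarith
    _ ≤ Real.exp (r * u) * (1 + 1 / r) := by gcongr

lemma integral_exp_neg_mul_sub_div_sqrt_le {r : ℝ} (hr : 0 < r) {t : ℝ} (ht : 0 ≤ t) :
    ∫ s in (0 : ℝ)..t, Real.exp (-(2 * r) * (t - s)) * (√(1 + s))⁻¹
      ≤ (1 + 1 / r) / r / √(1 + t) := by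
  have hc : ContinuousOn (fun s : ℝ => (√(1 + s))⁻¹) (Ici 0) := by
    refine ContinuousOn.inv₀ (by fun_prop) fun s hs => ?_
    exact (Real.sqrt_pos.2 (by linarith [mem_Ici.1 hs])).ne'
  have hpt : ∀ s ∈ Icc 0 t, Real.exp (-(2 * r) * (t - s)) * (√(1 + s))⁻¹
      ≤ (1 + 1 / r) / √(1 + t) * Real.exp (-r * (t - s)) := by
    rintro s ⟨hs, hst⟩
    have hsplit : √(1 + t) ≤ √(1 + s) * √(1 + (t - s)) := by
      rw [← Real.sqrt_mul (by linarith)]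
      exact Real.sqrt_le_sqrt (by nlinarith)
    have h1 : 0 < √(1 + s) := Real.sqrt_pos.2 (by linarith)
    have h2 : 0 < √(1 + t) := Real.sqrt_pos.2 (by linarith)
    have h3 : 0 < √(1 + (t - s)) := Real.sqrt_pos.2 (by linarith)
    have h4 := exp_neg_mul_le_div_sqrt hr (sub_nonneg.2 hst)
    rw [show -(2 * r) * (t - s) = -r * (t - s) + -r * (t - s) by ring, Real.exp_add]
    have h5 : Real.exp (-r * (t - s)) * (√(1 + s))⁻¹ ≤ (1 + 1 / r) / √(1 + t) := by
      calc Real.exp (-r * (t - s)) * (√(1 + s))⁻¹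
          ≤ (1 + 1 / r) / √(1 + (t - s)) * (√(1 + s))⁻¹ := by gcongr
        _ = (1 + 1 / r) / (√(1 + s) * √(1 + (t - s))) := by field_simp
        _ ≤ _ := by gcongr
    calc _ = Real.exp (-r * (t - s)) * (√(1 + s))⁻¹ * Real.exp (-r * (t - s)) := by ring
      _ ≤ _ := by gcongr
  calc _ ≤ ∫ s in (0 : ℝ)..t, (1 + 1 / r) / √(1 + t) * Real.exp (-r * (t - s)) :=
        intervalIntegral.integral_mono_on ht
          (intervalIntegrable_of_continuousOn_Ici (ContinuousOn.mul (by fun_prop) hc) ht)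
          (Continuous.intervalIntegrable (by fun_prop) _ _) hpt
    _ = (1 + 1 / r) / √(1 + t) * ∫ s in (0 : ℝ)..t, Real.exp (-r * (t - s)) := by
        rw [intervalIntegral.integral_const_mul]
    _ ≤ (1 + 1 / r) / √(1 + t) * (1 / r) := by
        gcongr
        exact integral_exp_neg_mul_sub_le hr t
    _ = _ := by field_simp

end HalfLine

/-- Integrating a linear stable filter against the decreasing weight `(1 + t) ^ (-3 / 2)`
costs only a constant factor. -/
lemma integral_filter_weighted_le {y f : ℝ → ℝ} {r : ℝ} (hr : 0 < r)
    (hf : ContinuousOn f (Ici 0)) (hy : ContinuousOn y (Ici 0)) (hy0 : y 0 = 0)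
    (hynn : ∀ t, 0 ≤ t → 0 ≤ y t) (hy' : ∀ t, 0 < t → HasDerivAt y (-r * y t + f t) t) {t : ℝ}
    (ht : 0 ≤ t) :
    ∫ s in (0 : ℝ)..t, y s * ((1 + s) * √(1 + s))⁻¹
      ≤ 1 / r * ∫ s in (0 : ℝ)..t, f s * ((1 + s) * √(1 + s))⁻¹ := by
  set h : ℝ → ℝ := fun s => ((1 + s) * √(1 + s))⁻¹ with hh
  have hc : ContinuousOn h (Ici 0) := continuousOn_inv_one_add_mul_sqrt
  have hder : ∀ s, 0 < s → HasDerivAt h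
      (-(1 * √(1 + s) + (1 + s) * (1 / (2 * √(1 + s)))) / ((1 + s) * √(1 + s)) ^ 2) s := by
    intro s hs
    have hp : 0 < 1 + s := by linarith
    have h1 : HasDerivAt (fun s : ℝ => 1 + s) 1 s := (hasDerivAt_id s).const_add 1
    exact (h1.mul (h1.sqrt hp.ne')).inv (mul_pos hp (Real.sqrt_pos.2 hp)).ne'
  have hyh := continuousOn_integral_Ici (hy.mul hc)
  have hfh := continuousOn_integral_Ici (hf.mul hc)
  have key := le_apply_zero_of_hasDerivAt_nonpos
    (f := fun t => y t * h t + (r * (∫ s in (0 : ℝ)..t, y s * h s)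
      - ∫ s in (0 : ℝ)..t, f s * h s))
    ((hy.mul hc).add ((hyh.const_smul r).sub hfh))
    (fun s hs => ((hy' s hs).mul (hder s hs)).add
      (((hasDerivAt_integral_of_continuousOn_Ici (hy.mul hc) hs).const_mul r).sub
        (hasDerivAt_integral_of_continuousOn_Ici (hf.mul hc) hs)))
    (fun s hs => by
      have hp : 0 < 1 + s := by linarith
      have hy1 := hynn s hs.le
      have : 0 ≤ y s * ((1 * √(1 + s) + (1 + s) * (1 / (2 * √(1 + s))))
        / ((1 + s) * √(1 + s)) ^ 2) := by positivity
      simp only [Pi.mul_apply, neg_div]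
      linarith) ht
  simp only [hy0, zero_mul, intervalIntegral.integral_same, mul_zero, sub_zero, add_zero] at key
  have hp : 0 < 1 + t := by linarith
  have h0 : 0 ≤ y t * h t := mul_nonneg (hynn t ht) (by rw [hh]; positivity)
  rw [one_div, ← div_eq_inv_mul, le_div_iff₀ hr]
  linarith

/-- Energy estimate for the second-order equation `W'' = -2b W' + b (W + V) / (1 + t)`. -/
lemma abs_le_of_second_order_linear {W D V : ℝ → ℝ} {b : ℝ} (hb : 0 < b)
    (hW : ContinuousOn W (Ici 0)) (hD : ContinuousOn D (Ici 0)) (hV : ContinuousOn V (Ici 0))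
    (hW' : ∀ t, 0 < t → HasDerivAt W (D t) t)
    (hD' : ∀ t, 0 < t → HasDerivAt D (-(2 * b) * D t + b * (W t + V t) / (1 + t)) t) :
    ∃ C, 0 ≤ C ∧ ∀ t, 0 ≤ t →
      |W t| ≤ √(1 + t) * (C + 2 * ∫ s in (0 : ℝ)..t, |V s| * ((1 + s) * √(1 + s))⁻¹) := by
  set d : ℝ → ℝ := fun t => D t / b with hd
  set R : ℝ → ℝ := fun t => 2 * W t + d t with hR
  set Φ : ℝ → ℝ := fun t => (R t ^ 2 + d t ^ 2) / (1 + t) with hΦ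
  set g : ℝ → ℝ := fun t => √(1 + Φ t) with hg
  have hdc : ContinuousOn d (Ici 0) := hD.div_const b
  have hRc : ContinuousOn R (Ici 0) := (hW.const_smul (2 : ℝ)).add hdc
  have hgc : ContinuousOn g (Ici 0) := by
    refine ((ContinuousOn.div ((hRc.pow 2).add (hdc.pow 2)) (by fun_prop) ?_).const_add _).sqrt
    intro t ht
    linarith [mem_Ici.1 ht]
  have hΦnn : ∀ t, 0 ≤ t → 0 ≤ Φ t := fun t ht => by
    have : 0 < 1 + t := by linarith
    positivity
  have hvc := hV.abs.mul continuousOn_inv_one_add_mul_sqrt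
  have hdd : ∀ t, 0 < t → HasDerivAt d (-(2 * b) * d t + (W t + V t) / (1 + t)) t := by
    intro t ht
    refine ((hD' t ht).div_const b).congr_deriv ?_
    simp only [hd]
    field_simp
  have hRd : ∀ t, 0 < t → HasDerivAt R ((W t + V t) / (1 + t)) t := by
    intro t ht
    refine (((hW' t ht).const_mul 2).add (hdd t ht)).congr_deriv ?_
    simp only [hd]
    field_simp
    ring
  have hΦd : ∀ t, 0 < t → HasDerivAt Φ
      (((-2 * d t ^ 2 + 2 * ((R t + d t) * V t)) / (1 + t) - 4 * b * d t ^ 2) / (1 + t)) t := by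
    intro t ht
    have hp : (0 : ℝ) < 1 + t := by linarith
    have h1 : HasDerivAt (fun s : ℝ => 1 + s) 1 t := (hasDerivAt_id t).const_add 1
    have hWt : W t = (R t - d t) / 2 := by simp only [hR]; ring
    refine ((((hRd t ht).pow 2).add ((hdd t ht).pow 2)).div h1 hp.ne').congr_deriv ?_
    simp only [Pi.add_apply, Pi.pow_apply]
    rw [hWt]
    field_simp
    norm_num
    ring
  refine ⟨g 0, Real.sqrt_nonneg _, fun t ht => ?_⟩
  have key : g t - 2 * ∫ s in (0 : ℝ)..t, |V s| * ((1 + s) * √(1 + s))⁻¹ ≤ g 0 := by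
    have h := le_apply_zero_of_hasDerivAt_nonpos
      (f := fun t => g t - 2 * ∫ s in (0 : ℝ)..t, |V s| * ((1 + s) * √(1 + s))⁻¹)
      (hgc.sub ((continuousOn_integral_Ici hvc).const_smul (2 : ℝ)))
      (fun s hs => by
        have hgs : 1 + Φ s ≠ 0 := by linarith [hΦnn s hs.le]
        exact (((hΦd s hs).const_add 1).sqrt hgs).sub
          ((hasDerivAt_integral_of_continuousOn_Ici hvc hs).const_mul 2))
      (fun s hs => by
        have hp : (0 : ℝ) < 1 + s := by linarith
        have hg0 : 0 < g s := Real.sqrt_pos.2 (by linarith [hΦnn s hs.le])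
        have hg2 : g s ^ 2 = 1 + Φ s := Real.sq_sqrt (by linarith [hΦnn s hs.le])
        have hr0 : 0 < √(1 + s) := Real.sqrt_pos.2 hp
        have hr2 : √(1 + s) ^ 2 = 1 + s := Real.sq_sqrt hp.le
        have hΦs : Φ s * (1 + s) = R s ^ 2 + d s ^ 2 := by
          simp only [hΦ]; field_simp
        have hsum : |R s + d s| ≤ 2 * (g s * √(1 + s)) := by
          refine abs_le_of_sq_le_sq ?_ (by positivity)
          have : (2 * (g s * √(1 + s))) ^ 2 = 4 * (1 + Φ s) * (1 + s) := by
            rw [mul_pow, mul_pow, hg2, hr2]; ring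
          rw [this]
          nlinarith [sq_nonneg (R s - d s), sq_nonneg (R s), sq_nonneg (d s)]
        have hnum : (R s + d s) * V s ≤ 2 * (g s * √(1 + s)) * |V s| :=
          (le_abs_self _).trans (by rw [abs_mul]; gcongr)
        have hcancel : 2 * √(1 + Φ s) = 2 * g s := rfl
        have hle : ((-2 * d s ^ 2 + 2 * ((R s + d s) * V s)) / (1 + s) - 4 * b * d s ^ 2)
            / (1 + s) ≤ (2 * (2 * (g s * √(1 + s)) * |V s|) / (1 + s)) / (1 + s) := by
          have : 0 ≤ 4 * b * d s ^ 2 := by positivity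
          have hle' : (-2 * d s ^ 2 + 2 * ((R s + d s) * V s)) / (1 + s)
              ≤ 2 * (2 * (g s * √(1 + s)) * |V s|) / (1 + s) := by
            gcongr
            nlinarith [sq_nonneg (d s)]
          gcongr
          linarith
        rw [hcancel, sub_nonpos, div_le_iff₀ (by positivity)]
        refine hle.trans (le_of_eq ?_)
        simp only [Pi.mul_apply]
        rw [← hr2]
        simp only [Real.sqrt_sq hr0.le]
        field_simp) ht
    simpa using h
  have hp : (0 : ℝ) < 1 + t := by linarith
  have hgt : |W t| ≤ √(1 + t) * g t := by
    refine abs_le_of_sq_le_sq ?_ (by positivity)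
    have hΦt : Φ t * (1 + t) = R t ^ 2 + d t ^ 2 := by
      simp only [hΦ]; field_simp
    have hWt : W t = (R t - d t) / 2 := by simp only [hR]; ring
    rw [mul_pow, Real.sq_sqrt hp.le, Real.sq_sqrt (by linarith [hΦnn t ht]), hWt]
    nlinarith [sq_nonneg (R t + d t), sq_nonneg (R t), sq_nonneg (d t)]
  refine hgt.trans ?_
  gcongr
  linarith

lemma abs_le_sqrt_mul_log_add_weight (x : ℝ) {s : ℝ} (hs : 0 ≤ s) :
    |x| ≤ √(1 + s) * (2 * shiftedLog s + 8 * (Real.exp (|x| / √(1 + s)) * logWeight s)) := by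
  have hr0 : 0 < √(1 + s) := Real.sqrt_pos.2 (by linarith)
  set y := |x| / √(1 + s) with hy
  have hx : |x| = √(1 + s) * y := by rw [hy]; field_simp
  have hL := one_le_shiftedLog hs
  have hM := one_le_shiftedLogLog hs
  have hp : 0 < s + 16 := by linarith
  have hexpL : Real.exp (shiftedLog s) = s + 16 := Real.exp_log hp
  have hML : shiftedLogLog s ^ 2 ≤ 4 * shiftedLog s := by
    have h1 : shiftedLogLog s = 2 * Real.log √(shiftedLog s) := by
      rw [Real.log_sqrt (by linarith), shiftedLogLog]; ring
    have h2 : Real.log √(shiftedLog s) ≤ √(shiftedLog s) := Real.log_le_self (Real.sqrt_nonneg _)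
    calc shiftedLogLog s ^ 2 ≤ (2 * √(shiftedLog s)) ^ 2 := by
          gcongr
          linarith
      _ = 4 * shiftedLog s := by rw [mul_pow, Real.sq_sqrt (by linarith)]; norm_num
  have hw : (s + 16) * shiftedLog s * shiftedLogLog s ^ 2 ≤ 8 * (s + 16) ^ 2 := by
    have h3 := Real.quadratic_le_exp_of_nonneg (by linarith : 0 ≤ shiftedLog s)
    rw [hexpL] at h3
    calc (s + 16) * shiftedLog s * shiftedLogLog s ^ 2
        ≤ (s + 16) * shiftedLog s * (4 * shiftedLog s) := by gcongr
      _ = (s + 16) * (4 * shiftedLog s ^ 2) := by ring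
      _ ≤ (s + 16) * (8 * (s + 16)) := mul_le_mul_of_nonneg_left (by linarith) hp.le
      _ = _ := by ring
  have hexp : Real.exp (y - 2 * shiftedLog s) ≤ 8 * (Real.exp y * logWeight s) := by
    have h4 : Real.exp (2 * shiftedLog s) = (s + 16) ^ 2 := by
      rw [two_mul, Real.exp_add, hexpL]; ring
    rw [Real.exp_sub, h4, logWeight, div_le_iff₀ (by positivity)]
    have h5 : 0 < (s + 16) * shiftedLog s * shiftedLogLog s ^ 2 := by positivity
    have h6 : 1 ≤ 8 * (s + 16) ^ 2 * ((s + 16) * shiftedLog s * shiftedLogLog s ^ 2)⁻¹ := by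
      rw [← div_eq_mul_inv, one_le_div h5]
      exact hw
    nlinarith [Real.exp_pos y]
  rw [hx]
  gcongr
  linarith [Real.add_one_le_exp (y - 2 * shiftedLog s)]

lemma abs_mul_le_rate_add_weight (x : ℝ) {s t : ℝ} (hs : 0 ≤ s) (hst : s ≤ t) :
    |x| * ((1 + s) * √(1 + s))⁻¹ ≤ 16 * √(shiftedLogLog t) * (s + 16)⁻¹
      + 96 * logRate t * (Real.exp (|x| / √(1 + s)) * logWeight s) := by
  have hr0 : 0 < √(1 + s) := Real.sqrt_pos.2 (by linarith)
  have hp : 0 < s + 16 := by linarith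
  have hp1 : 0 < 1 + s := by linarith
  set y := |x| / √(1 + s) with hy
  have hy0 : 0 ≤ y := by positivity
  have hx : |x| * ((1 + s) * √(1 + s))⁻¹ = y * (1 + s)⁻¹ := by rw [hy]; field_simp
  have hL := one_le_shiftedLog hs
  have hM := one_le_shiftedLogLog hs
  set m := √(shiftedLogLog s) with hm
  have hm1 : 1 ≤ m := one_le_sqrt_shiftedLogLog hs
  have hm2 : m ^ 2 = shiftedLogLog s := Real.sq_sqrt (by linarith)
  have hmt : m ≤ √(shiftedLogLog t) := Real.sqrt_le_sqrt (shiftedLogLog_mono hs hst)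
  have hinv : (1 + s)⁻¹ ≤ 16 * (s + 16)⁻¹ := by
    rw [← div_eq_mul_inv, le_div_iff₀ hp, inv_mul_le_iff₀ hp1]; linarith
  have hcube : m ^ 3 ≤ 6 * Real.exp m := by
    have h := Real.pow_div_factorial_le_exp m (by linarith) 3
    norm_num [Nat.factorial] at h
    linarith
  have hexp : Real.exp (y - m) ≤ 6 * logRate t * (Real.exp y * logWeight s) * (s + 16) := by
    have hq : logRate s ≤ logRate t := logRate_mono hs hst
    have h1 : Real.exp (y - m) ≤ 6 * logRate s * (Real.exp y * logWeight s) * (s + 16) := by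
      have h2 : 6 * logRate s * (Real.exp y * logWeight s) * (s + 16)
          = 6 * Real.exp y / m ^ 3 := by
        rw [logRate, logWeight, ← hm, ← hm2]
        field_simp
      rw [h2, Real.exp_sub, div_le_div_iff₀ (Real.exp_pos _) (by positivity)]
      nlinarith [Real.exp_pos y]
    have h3 := logWeight_nonneg hs
    refine h1.trans ?_
    gcongr
  have hym : y ≤ √(shiftedLogLog t) + 6 * logRate t * (Real.exp y * logWeight s) * (s + 16) := by
    linarith [Real.add_one_le_exp (y - m)]
  rw [hx]
  calc y * (1 + s)⁻¹ ≤ y * (16 * (s + 16)⁻¹) := by gcongr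
    _ ≤ (√(shiftedLogLog t) + 6 * logRate t * (Real.exp y * logWeight s) * (s + 16))
        * (16 * (s + 16)⁻¹) := by gcongr
    _ = _ := by field_simp; ring

lemma intervalIntegral_le_integral_Ioi {f : ℝ → ℝ} (hf : IntegrableOn f (Ioi 0))
    (hnn : ∀ s, 0 ≤ s → 0 ≤ f s) {t : ℝ} (ht : 0 ≤ t) :
    ∫ s in (0 : ℝ)..t, f s ≤ ∫ s in Ioi 0, f s := by
  rw [intervalIntegral.integral_of_le ht]
  exact setIntegral_mono_set hf
    ((ae_restrict_mem measurableSet_Ioi).mono fun s hs => hnn s (le_of_lt hs))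
    (Ioc_subset_Ioi_self.eventuallyLE)

lemma integral_inv_add_le_shiftedLog {t : ℝ} (ht : 0 ≤ t) :
    ∫ s in (0 : ℝ)..t, (s + 16)⁻¹ ≤ shiftedLog t := by
  rw [intervalIntegral.integral_eq_sub_of_hasDerivAt_of_le ht (f := shiftedLog)
    (fun s hs => (hasDerivAt_shiftedLog hs.1).continuousAt.continuousWithinAt)
    (fun s hs => hasDerivAt_shiftedLog hs.1.le)]
  · linarith [one_le_shiftedLog le_rfl]
  · refine intervalIntegrable_of_continuousOn_Ici (ContinuousOn.inv₀ (by fun_prop) ?_) ht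
    intro s hs
    linarith [mem_Ici.1 hs]

/-- A path whose normalised exponential is integrable against `logWeight` is controlled,
in weighted mean, by `logRate`. -/
lemma exists_integral_abs_weighted_le {β : ℝ → ℝ} (hβ : ContinuousOn β (Ici 0))
    (hG : IntegrableOn (fun s => Real.exp (|β s| / √(1 + s)) * logWeight s) (Ioi 0)) :
    ∃ C, 0 ≤ C ∧ ∀ t, 0 ≤ t →
      ∫ s in (0 : ℝ)..t, |β s| * ((1 + s) * √(1 + s))⁻¹ ≤ C * logRate t := by
  have hnn : ∀ s, 0 ≤ s → 0 ≤ Real.exp (|β s| / √(1 + s)) * logWeight s := fun s hs =>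
    mul_nonneg (Real.exp_pos _).le (logWeight_nonneg hs)
  set G := ∫ s in Ioi 0, Real.exp (|β s| / √(1 + s)) * logWeight s
  have hG0 : 0 ≤ G := setIntegral_nonneg measurableSet_Ioi fun s hs => hnn s (le_of_lt hs)
  refine ⟨16 + 96 * G, by positivity, fun t ht => ?_⟩
  have hGi : IntervalIntegrable (fun s => Real.exp (|β s| / √(1 + s)) * logWeight s) volume 0 t :=
    (intervalIntegrable_iff_integrableOn_Ioc_of_le ht).2 (hG.mono_set Ioc_subset_Ioi_self)
  have hIi : IntervalIntegrable (fun s : ℝ => (s + 16)⁻¹) volume 0 t := by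
    refine intervalIntegrable_of_continuousOn_Ici (ContinuousOn.inv₀ (by fun_prop) ?_) ht
    intro s hs
    linarith [mem_Ici.1 hs]
  have hq := one_le_logRate ht
  calc ∫ s in (0 : ℝ)..t, |β s| * ((1 + s) * √(1 + s))⁻¹
      ≤ ∫ s in (0 : ℝ)..t, (16 * √(shiftedLogLog t) * (s + 16)⁻¹
        + 96 * logRate t * (Real.exp (|β s| / √(1 + s)) * logWeight s)) :=
        intervalIntegral.integral_mono_on ht
          (intervalIntegrable_of_continuousOn_Ici (hβ.abs.mul continuousOn_inv_one_add_mul_sqrt) ht)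
          ((hIi.const_mul _).add (hGi.const_mul _))
          fun s hs => abs_mul_le_rate_add_weight _ hs.1 hs.2
    _ = 16 * √(shiftedLogLog t) * (∫ s in (0 : ℝ)..t, (s + 16)⁻¹)
        + 96 * logRate t * ∫ s in (0 : ℝ)..t, Real.exp (|β s| / √(1 + s)) * logWeight s := by
        rw [intervalIntegral.integral_add (hIi.const_mul _) (hGi.const_mul _),
          intervalIntegral.integral_const_mul, intervalIntegral.integral_const_mul]
    _ ≤ 16 * √(shiftedLogLog t) * shiftedLog t + 96 * logRate t * G := by
        gcongr
        · exact integral_inv_add_le_shiftedLog ht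
        · exact intervalIntegral_le_integral_Ioi hG hnn ht
    _ = (16 + 96 * G) * logRate t := by rw [logRate]; ring

/-- A path whose normalised exponential is integrable against `logWeight` is controlled,
after exponential averaging, by `√(1 + t) * logRate t`. -/
lemma exists_integral_exp_mul_abs_le {β : ℝ → ℝ} (hβ : ContinuousOn β (Ici 0)) {r : ℝ}
    (hr : 0 < r)
    (hG : IntegrableOn (fun s => Real.exp (|β s| / √(1 + s)) * logWeight s) (Ioi 0)) :
    ∃ C, 0 ≤ C ∧ ∀ t, 0 ≤ t →
      ∫ s in (0 : ℝ)..t, Real.exp (-r * (t - s)) * |β s| ≤ C * (√(1 + t) * logRate t) := by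
  have hnn : ∀ s, 0 ≤ s → 0 ≤ Real.exp (|β s| / √(1 + s)) * logWeight s := fun s hs =>
    mul_nonneg (Real.exp_pos _).le (logWeight_nonneg hs)
  set G := ∫ s in Ioi 0, Real.exp (|β s| / √(1 + s)) * logWeight s
  have hG0 : 0 ≤ G := setIntegral_nonneg measurableSet_Ioi fun s hs => hnn s (le_of_lt hs)
  refine ⟨2 * (1 / r) + 8 * G, by positivity, fun t ht => ?_⟩
  have hGi : IntervalIntegrable (fun s => Real.exp (|β s| / √(1 + s)) * logWeight s) volume 0 t :=
    (intervalIntegrable_iff_integrableOn_Ioc_of_le ht).2 (hG.mono_set Ioc_subset_Ioi_self)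
  have hq := one_le_logRate ht
  have hL := one_le_shiftedLog ht
  have hei : IntervalIntegrable (fun s => Real.exp (-r * (t - s))) volume 0 t :=
    Continuous.intervalIntegrable (by fun_prop) _ _
  have hpt : ∀ s ∈ Icc 0 t, Real.exp (-r * (t - s)) * |β s| ≤
      √(1 + t) * (2 * shiftedLog t) * Real.exp (-r * (t - s))
      + √(1 + t) * 8 * (Real.exp (|β s| / √(1 + s)) * logWeight s) := by
    rintro s ⟨hs, hst⟩
    have h1 := abs_le_sqrt_mul_log_add_weight (β s) hs
    have h2 : Real.exp (-r * (t - s)) ≤ 1 := by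
      rw [Real.exp_le_one_iff]; nlinarith
    have h3 := hnn s hs
    have h4 := shiftedLog_mono hs hst
    have h5 : √(1 + s) ≤ √(1 + t) := Real.sqrt_le_sqrt (by linarith)
    have h6 := one_le_shiftedLog hs
    set e := Real.exp (-r * (t - s)) with he
    set w := Real.exp (|β s| / √(1 + s)) * logWeight s with hw
    have he0 : 0 < e := Real.exp_pos _
    calc e * |β s| ≤ e * (√(1 + s) * (2 * shiftedLog s + 8 * w)) := by gcongr
      _ ≤ e * (√(1 + t) * (2 * shiftedLog t + 8 * w)) := by gcongr
      _ = √(1 + t) * (2 * shiftedLog t) * e + √(1 + t) * 8 * (e * w) := by ring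
      _ ≤ √(1 + t) * (2 * shiftedLog t) * e + √(1 + t) * 8 * (1 * w) := by gcongr
      _ = _ := by ring
  calc ∫ s in (0 : ℝ)..t, Real.exp (-r * (t - s)) * |β s|
      ≤ ∫ s in (0 : ℝ)..t, (√(1 + t) * (2 * shiftedLog t) * Real.exp (-r * (t - s))
        + √(1 + t) * 8 * (Real.exp (|β s| / √(1 + s)) * logWeight s)) :=
        intervalIntegral.integral_mono_on ht
          (intervalIntegrable_of_continuousOn_Ici (ContinuousOn.mul (by fun_prop) hβ.abs) ht)
          ((hei.const_mul _).add (hGi.const_mul _)) hpt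
    _ = √(1 + t) * (2 * shiftedLog t) * (∫ s in (0 : ℝ)..t, Real.exp (-r * (t - s)))
        + √(1 + t) * 8 * ∫ s in (0 : ℝ)..t, Real.exp (|β s| / √(1 + s)) * logWeight s := by
        rw [intervalIntegral.integral_add (hei.const_mul _) (hGi.const_mul _),
          intervalIntegral.integral_const_mul, intervalIntegral.integral_const_mul]
    _ ≤ √(1 + t) * (2 * shiftedLog t) * (1 / r) + √(1 + t) * 8 * G := by
        gcongr
        · exact integral_exp_neg_mul_sub_le hr t
        · exact intervalIntegral_le_integral_Ioi hG hnn ht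
    _ ≤ √(1 + t) * (2 * logRate t) * (1 / r) + √(1 + t) * (8 * logRate t) * G := by
        gcongr
        · exact shiftedLog_le_logRate ht
        · linarith
    _ = _ := by ring

/-- Bounds on `V = σ ∫ exp (-r (t - s)) β s ds` inherited from integrability of the path `β`. -/
lemma exists_filter_bounds {β V : ℝ → ℝ} {r σ : ℝ} (hr : 0 < r)
    (hβ : ContinuousOn β (Ici 0)) (hV : ContinuousOn V (Ici 0)) (hV0 : V 0 = 0)
    (hV' : ∀ t, 0 < t → HasDerivAt V (-r * V t + σ * β t) t)
    (hG : IntegrableOn (fun s => Real.exp (|β s| / √(1 + s)) * logWeight s) (Ioi 0)) :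
    ∃ C, 0 ≤ C ∧ ∀ t, 0 ≤ t → |V t| ≤ C * (√(1 + t) * logRate t) ∧
      ∫ s in (0 : ℝ)..t, |V s| * ((1 + s) * √(1 + s))⁻¹ ≤ C * logRate t := by
  obtain ⟨C₁, hC₁, h₁⟩ := exists_integral_abs_weighted_le hβ hG
  obtain ⟨C₂, hC₂, h₂⟩ := exists_integral_exp_mul_abs_le hβ hr hG
  set N : ℝ → ℝ := fun t => Real.exp (-r * t) * ∫ s in (0 : ℝ)..t, Real.exp (r * s) * |σ * β s|
    with hN
  have hfc : ContinuousOn (fun s => |σ * β s|) (Ici 0) := (hβ.const_smul σ).abs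
  have hec : ContinuousOn (fun s => Real.exp (r * s) * |σ * β s|) (Ici 0) :=
    ContinuousOn.mul (by fun_prop) hfc
  have hNc : ContinuousOn N (Ici 0) := ContinuousOn.mul (by fun_prop) (continuousOn_integral_Ici hec)
  have hNeq : ∀ t, N t = |σ| * ∫ s in (0 : ℝ)..t, Real.exp (-r * (t - s)) * |β s| := by
    intro t
    simp only [hN]
    rw [← intervalIntegral.integral_const_mul, ← intervalIntegral.integral_const_mul]
    refine intervalIntegral.integral_congr fun s _ => ?_
    rw [← mul_assoc, ← Real.exp_add, abs_mul, show -r * t + r * s = -r * (t - s) by ring]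
    ring
  have hVN : ∀ t, 0 ≤ t → |V t| ≤ N t := by
    intro t ht
    have h := abs_le_variation_of_constants (hβ.const_smul σ) hV hV' ht
    rw [hV0, abs_zero, mul_zero, zero_add] at h
    refine h.trans_eq ?_
    rw [hNeq, ← intervalIntegral.integral_const_mul]
    refine intervalIntegral.integral_congr fun s _ => ?_
    simp only [Pi.smul_apply, smul_eq_mul, abs_mul]
    ring
  have hN' : ∀ t, 0 < t → HasDerivAt N (-r * N t + |σ * β t|) t := by
    intro t ht
    have he : HasDerivAt (fun t => Real.exp (-r * t)) (Real.exp (-r * t) * (-r * 1)) t :=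
      ((hasDerivAt_id t).const_mul (-r)).exp
    refine (he.mul (hasDerivAt_integral_of_continuousOn_Ici hec ht)).congr_deriv ?_
    rw [← mul_assoc (Real.exp (-r * t)) (Real.exp (r * t)), ← Real.exp_add,
      show -r * t + r * t = 0 by ring, Real.exp_zero, hN]
    ring
  refine ⟨|σ| * C₂ + 1 / r * (|σ| * C₁), by positivity, fun t ht => ?_⟩
  have hq := one_le_logRate ht
  constructor
  · calc |V t| ≤ |σ| * (C₂ * (√(1 + t) * logRate t)) := by
          refine (hVN t ht).trans ?_
          rw [hNeq]
          gcongr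
          exact h₂ t ht
      _ = |σ| * C₂ * (√(1 + t) * logRate t) := by ring
      _ ≤ _ := by
          gcongr
          exact le_add_of_nonneg_right (by positivity)
  · calc ∫ s in (0 : ℝ)..t, |V s| * ((1 + s) * √(1 + s))⁻¹
        ≤ ∫ s in (0 : ℝ)..t, N s * ((1 + s) * √(1 + s))⁻¹ := by
          refine intervalIntegral.integral_mono_on ht
            (intervalIntegrable_of_continuousOn_Ici
              (hV.abs.mul continuousOn_inv_one_add_mul_sqrt) ht)
            (intervalIntegrable_of_continuousOn_Ici
              (hNc.mul continuousOn_inv_one_add_mul_sqrt) ht) fun s hs => ?_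
          have hp : 0 < 1 + s := by linarith [hs.1]
          gcongr
          exact hVN s hs.1
      _ ≤ 1 / r * ∫ s in (0 : ℝ)..t, |σ * β s| * ((1 + s) * √(1 + s))⁻¹ :=
          integral_filter_weighted_le hr hfc hNc (by simp [hN])
            (fun s hs => (abs_nonneg _).trans (hVN s hs)) hN' ht
      _ = 1 / r * (|σ| * ∫ s in (0 : ℝ)..t, |β s| * ((1 + s) * √(1 + s))⁻¹) := by
          simp only [abs_mul, mul_assoc, intervalIntegral.integral_const_mul]
      _ ≤ 1 / r * (|σ| * (C₁ * logRate t)) := by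
          gcongr
          exact h₁ t ht
      _ = 1 / r * (|σ| * C₁) * logRate t := by ring
      _ ≤ _ := by
          gcongr
          exact le_add_of_nonneg_left (by positivity)

/-- Pathwise estimate: the difference of the solution of the averaged functional equation and
the filtered path is `O(log t * √(log log t) / √t)`. -/
lemma exists_abs_sub_le {x u β : ℝ → ℝ} {b c x₀ σ : ℝ} (hb : 0 < b)
    (hβ : ContinuousOn β (Ici 0)) (hx : ContinuousOn x (Ici 0)) (hu : ContinuousOn u (Ici 0))
    (hxeq : ∀ t, 0 ≤ t → x t = x₀ + (∫ s in (0 : ℝ)..t,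
      (-(2 * b) * x s + b / (1 + s) * (c + ∫ v in (0 : ℝ)..s, x v))) + σ * β t)
    (hueq : ∀ t, 0 ≤ t → u t = -(2 * b) * (∫ s in (0 : ℝ)..t, u s) + σ * β t)
    (hG : IntegrableOn (fun s => Real.exp (|β s| / √(1 + s)) * logWeight s) (Ioi 0)) :
    ∃ C, 0 ≤ C ∧ ∀ t, 0 ≤ t → |x t - u t| ≤ C * logRate t / √(1 + t) := by
  set V : ℝ → ℝ := fun t => ∫ s in (0 : ℝ)..t, u s with hVdef
  set D : ℝ → ℝ := fun t => x t - u t with hDdef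
  set W : ℝ → ℝ := fun t => c + ∫ s in (0 : ℝ)..t, D s with hWdef
  have hV : ContinuousOn V (Ici 0) := continuousOn_integral_Ici hu
  have hD : ContinuousOn D (Ici 0) := hx.sub hu
  have hW : ContinuousOn W (Ici 0) := (continuousOn_integral_Ici hD).const_add c
  have hV' : ∀ t, 0 < t → HasDerivAt V (-(2 * b) * V t + σ * β t) t := fun t ht =>
    (hasDerivAt_integral_of_continuousOn_Ici hu ht).congr_deriv (hueq t ht.le)
  have hW' : ∀ t, 0 < t → HasDerivAt W (D t) t := fun t ht =>
    (hasDerivAt_integral_of_continuousOn_Ici hD ht).const_add c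
  have hWV : ∀ t, 0 ≤ t → c + ∫ v in (0 : ℝ)..t, x v = W t + V t := by
    intro t ht
    simp only [hWdef, hVdef, hDdef]
    rw [intervalIntegral.integral_sub (intervalIntegrable_of_continuousOn_Ici hx ht)
      (intervalIntegrable_of_continuousOn_Ici hu ht)]
    ring
  have hfc : ContinuousOn (fun s => b * (W s + V s) / (1 + s)) (Ici 0) := by
    refine ContinuousOn.div ((hW.add hV).const_smul b) (by fun_prop) fun s hs => ?_
    linarith [mem_Ici.1 hs]
  have hDeq : ∀ t, 0 ≤ t → D t = x₀ + ∫ s in (0 : ℝ)..t,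
      (-(2 * b) * D s + b * (W s + V s) / (1 + s)) := by
    intro t ht
    have h1 : ∫ s in (0 : ℝ)..t, (-(2 * b) * x s + b / (1 + s) * (c + ∫ v in (0 : ℝ)..s, x v))
        = ∫ s in (0 : ℝ)..t, ((-(2 * b) * D s + b * (W s + V s) / (1 + s)) + -(2 * b) * u s) := by
      refine intervalIntegral.integral_congr fun s hs => ?_
      rw [uIcc_of_le ht] at hs
      simp only [hWV s hs.1, hDdef]
      ring
    have hDi : IntervalIntegrable (fun s => -(2 * b) * D s + b * (W s + V s) / (1 + s))
        volume 0 t :=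
      intervalIntegrable_of_continuousOn_Ici ((hD.const_smul (-(2 * b))).add hfc) ht
    rw [intervalIntegral.integral_add hDi
      ((intervalIntegrable_of_continuousOn_Ici hu ht).const_mul _),
      intervalIntegral.integral_const_mul] at h1
    have h2 : D t = x t - u t := rfl
    rw [h2, hxeq t ht, hueq t ht, h1]
    ring
  have hD' : ∀ t, 0 < t → HasDerivAt D (-(2 * b) * D t + b * (W t + V t) / (1 + t)) t := by
    intro t ht
    refine ((hasDerivAt_integral_of_continuousOn_Ici ((hD.const_smul (-(2 * b))).add hfc)
      ht).const_add x₀).congr_of_eventuallyEq ?_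
    filter_upwards [lt_mem_nhds ht] with s hs
    exact hDeq s (le_of_lt hs)
  obtain ⟨C₁, hC₁, h₁⟩ := abs_le_of_second_order_linear hb hW hD hV hW' hD'
  obtain ⟨C₂, hC₂, h₂⟩ := exists_filter_bounds (by linarith : 0 < 2 * b) hβ hV (by simp [hVdef])
    hV' hG
  set C₃ := b * (C₁ + 3 * C₂) with hC₃
  have hforce : ∀ s t, 0 ≤ s → s ≤ t →
      |b * (W s + V s) / (1 + s)| ≤ C₃ * logRate t * (√(1 + s))⁻¹ := by
    intro s t hs hst
    have hp : 0 < 1 + s := by linarith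
    have hr0 : 0 < √(1 + s) := Real.sqrt_pos.2 hp
    have hr2 : √(1 + s) * √(1 + s) = 1 + s := Real.mul_self_sqrt hp.le
    have hq := one_le_logRate hs
    have hqt := logRate_mono hs hst
    obtain ⟨hVs, hIs⟩ := h₂ s hs
    have hsum : |W s + V s| ≤ √(1 + s) * ((C₁ + 3 * C₂) * logRate s) := by
      calc |W s + V s| ≤ |W s| + |V s| := abs_add_le _ _
        _ ≤ √(1 + s) * (C₁ + 2 * (C₂ * logRate s)) + C₂ * (√(1 + s) * logRate s) := by
            refine add_le_add ((h₁ s hs).trans ?_) hVs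
            gcongr
        _ ≤ √(1 + s) * (C₁ * logRate s + 2 * (C₂ * logRate s))
            + C₂ * (√(1 + s) * logRate s) := by
            gcongr
            exact le_mul_of_one_le_right hC₁ hq
        _ = _ := by ring
    calc |b * (W s + V s) / (1 + s)| = b * |W s + V s| / (1 + s) := by
          rw [abs_div, abs_mul, abs_of_pos hb, abs_of_pos hp]
      _ ≤ b * (√(1 + s) * ((C₁ + 3 * C₂) * logRate s)) / (1 + s) := by gcongr
      _ = C₃ * logRate s * (√(1 + s))⁻¹ := by
          rw [hC₃, div_eq_iff hp.ne']
          nth_rewrite 3 [← hr2]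
          field_simp
      _ ≤ _ := by gcongr
  have hic : ContinuousOn (fun s : ℝ => (√(1 + s))⁻¹) (Ici 0) := by
    refine ContinuousOn.inv₀ (by fun_prop) fun s hs => ?_
    exact (Real.sqrt_pos.2 (by linarith [mem_Ici.1 hs])).ne'
  refine ⟨(1 + 1 / (2 * b)) * |D 0| + C₃ * ((1 + 1 / b) / b), by positivity, fun t ht => ?_⟩
  have hq := one_le_logRate ht
  have hr0 : 0 < √(1 + t) := Real.sqrt_pos.2 (by linarith)
  calc |x t - u t|
      ≤ Real.exp (-(2 * b) * t) * |D 0| + ∫ s in (0 : ℝ)..t,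
        Real.exp (-(2 * b) * (t - s)) * |b * (W s + V s) / (1 + s)| :=
        abs_le_variation_of_constants hfc hD hD' ht
    _ ≤ (1 + 1 / (2 * b)) / √(1 + t) * |D 0| + ∫ s in (0 : ℝ)..t,
        C₃ * logRate t * (Real.exp (-(2 * b) * (t - s)) * (√(1 + s))⁻¹) := by
        gcongr
        · exact exp_neg_mul_le_div_sqrt (by linarith) ht
        · refine intervalIntegral.integral_mono_on ht
            (intervalIntegrable_of_continuousOn_Ici (ContinuousOn.mul (by fun_prop) hfc.abs) ht)
            ((intervalIntegrable_of_continuousOn_Ici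
              (ContinuousOn.mul (by fun_prop) hic) ht).const_mul _) fun s hs => ?_
          calc _ ≤ Real.exp (-(2 * b) * (t - s)) * (C₃ * logRate t * (√(1 + s))⁻¹) := by
                gcongr
                exact hforce s t hs.1 hs.2
            _ = _ := by ring
    _ ≤ (1 + 1 / (2 * b)) / √(1 + t) * |D 0|
        + C₃ * logRate t * ((1 + 1 / b) / b / √(1 + t)) := by
        rw [intervalIntegral.integral_const_mul]
        gcongr
        exact integral_exp_neg_mul_sub_div_sqrt_le hb ht
    _ ≤ (1 + 1 / (2 * b)) / √(1 + t) * |D 0| * logRate t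
        + C₃ * logRate t * ((1 + 1 / b) / b / √(1 + t)) := by
        refine add_le_add_left ?_ _
        exact le_mul_of_one_le_right (by positivity) hq
    _ = _ := by ring

lemma logRate_div_sqrt_le {t : ℝ} (ht : Real.exp 2 ≤ t) :
    logRate t / √(1 + t) ≤ 4 * (t ^ (-(1 : ℝ) / 2) * Real.log t * √(Real.log (Real.log t))) := by
  have h5 : 5 ≤ t := by
    have := Real.quadratic_le_exp_of_nonneg (by norm_num : (0 : ℝ) ≤ 2)
    linarith
  have ht0 : 0 < t := by linarith
  have hlog : 2 ≤ Real.log t := (Real.le_log_iff_exp_le ht0).2 ht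
  have hL : shiftedLog t ≤ 2 * Real.log t := by
    rw [shiftedLog, show 2 * Real.log t = Real.log (t ^ 2) by rw [Real.log_pow]; norm_num]
    exact Real.log_le_log (by linarith) (by nlinarith)
  have hL1 := one_le_shiftedLog ht0.le
  have hM : shiftedLogLog t ≤ 2 * Real.log (Real.log t) := by
    rw [shiftedLogLog, show 2 * Real.log (Real.log t) = Real.log (Real.log t ^ 2) by
      rw [Real.log_pow]; norm_num]
    exact Real.log_le_log (by linarith) (by nlinarith)
  have hll : 0 ≤ Real.log (Real.log t) := Real.log_nonneg (by linarith)
  have hsM : √(shiftedLogLog t) ≤ 2 * √(Real.log (Real.log t)) := by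
    rw [Real.sqrt_le_left (by positivity), mul_pow, Real.sq_sqrt hll]
    linarith
  have hpow : t ^ (-(1 : ℝ) / 2) = (√t)⁻¹ := by
    rw [neg_div, Real.rpow_neg ht0.le, Real.sqrt_eq_rpow]
  have hst : 0 < √t := Real.sqrt_pos.2 ht0
  rw [hpow]
  calc logRate t / √(1 + t)
      ≤ (2 * Real.log t * (2 * √(Real.log (Real.log t)))) / √t := by
        rw [logRate]
        gcongr
        linarith
    _ = _ := by field_simp; ring

lemma limsup_mem_Ico_of_abs_le {y : ℝ → ℝ} {C : ℝ}
    (hy : ∀ t, 0 ≤ t → |y t| ≤ C * logRate t / √(1 + t)) (hC : 0 ≤ C) :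
    Filter.limsup (fun t : ℝ => ((|y t| / (t ^ (-(1:ℝ)/2) * Real.log t
      * Real.sqrt (Real.log (Real.log t))) : ℝ) : EReal)) Filter.atTop ∈ Set.Ico (0 : EReal) ⊤ := by
  constructor
  · refine Filter.le_limsup_of_frequently_le (Eventually.frequently ?_)
    filter_upwards [eventually_ge_atTop 1] with t ht
    have := Real.log_nonneg ht
    exact EReal.coe_nonneg.2 (by positivity)
  · refine lt_of_le_of_lt (Filter.limsup_le_of_le (a := ((4 * C : ℝ) : EReal)) (by isBoundedDefault)
      ?_) (EReal.coe_lt_top _)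
    filter_upwards [eventually_ge_atTop (Real.exp 2)] with t ht
    have ht0 : 0 < t := (Real.exp_pos 2).trans_le ht
    have hlog : 2 ≤ Real.log t := (Real.le_log_iff_exp_le ht0).2 ht
    have hll : 0 < Real.log (Real.log t) := Real.log_pos (by linarith)
    have hpos : 0 < t ^ (-(1:ℝ)/2) * Real.log t * √(Real.log (Real.log t)) := by positivity
    rw [EReal.coe_le_coe_iff, div_le_iff₀ hpos]
    calc |y t| ≤ C * (logRate t / √(1 + t)) := by rw [← mul_div_assoc]; exact hy t ht0.le
      _ ≤ C * (4 * (t ^ (-(1 : ℝ) / 2) * Real.log t * √(Real.log (Real.log t)))) := by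
          gcongr
          exact logRate_div_sqrt_le ht
      _ = _ := by ring

theorem sfde_XU_rate_log {Ω : Type*} {mΩ : MeasurableSpace Ω} (P : Measure Ω) [IsProbabilityMeasure P]
    (F : MeasureTheory.Filtration ℝ mΩ) (a b σ : ℝ) (ψ : ℝ → ℝ) (B X : ℝ → Ω → ℝ)
    (hσ : 0 < σ) (hψ : ContinuousOn ψ (Set.Icc (-1 : ℝ) 0))
    (hB : IsStdBrownian P F B) (hX : IsSolutionSFDE P F a b σ ψ B X)
    (U : ℝ → Ω → ℝ) (hU : IsOUProcess P F a σ B U)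
    (ha : a < 0) (hab : a + b < 0) (h2ba : 2 * b + a = 0) :
    ∀ᵐ ω ∂P,
      Filter.limsup (fun t : ℝ => ((|X t ω - U t ω| / (t ^ (-(1:ℝ)/2) * Real.log t * Real.sqrt (Real.log (Real.log t))) : ℝ) : EReal)) Filter.atTop
        ∈ Set.Ico (0 : EReal) ⊤ := by
  have hb : 0 < b := by linarith
  have haeq : a = -(2 * b) := by linarith
  obtain ⟨-, hXc, hXeq⟩ := hX
  obtain ⟨-, hUc, hUeq⟩ := hU
  filter_upwards [hXeq, hUeq, hB.ae_integrableOn_exp] with ω hXω hUω hGω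
  rw [haeq] at hXω hUω
  obtain ⟨C, hC, h⟩ := exists_abs_sub_le hb (hB.2.2.1 ω).continuousOn (hXc ω) (hUc ω) hXω hUω hGω
  exact limsup_mem_Ico_of_abs_le h hC
end
end

section
/- Suppose a < 0 and a + b ≤ 0, and fix t ≥ 0. Then there exists a real constant c_t such that lim_{Δ→∞} Δ^{1 + b/a} · Cov(X(t), X(t+Δ)) = c_t; that is, the autocovariance Cov(X(t), X(t+Δ)) decays like c_t · Δ^{−(1+b/a)} as the lag Δ → ∞. -/
open MeasureTheory ProbabilityTheory Filter Real Set

noncomputable section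

/-- The covariance `Cov(Y, Z) = E[Y Z] - E[Y] E[Z]` of two real random variables. -/
def rcov {Ω : Type*} {mΩ : MeasurableSpace Ω} (P : Measure Ω) (Y Z : Ω → ℝ) : ℝ :=
  (∫ ω, Y ω * Z ω ∂P) - (∫ ω, Y ω ∂P) * (∫ ω, Z ω ∂P)

theorem bounded_sum_sq_of_linear_system {α c κ s₀ : ℝ} (hα : 0 < α) (hs₀ : 0 ≤ s₀) {u p : ℝ → ℝ}
    (hu : ∀ s > s₀, HasDerivAt u (p s / (1 + s)) s)
    (hp : ∀ s > s₀, HasDerivAt p (-(α + c / (1 + s)) * p s - κ * u s / (1 + s)) s) :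
    ∃ M s₁ : ℝ, s₀ < s₁ ∧ ∀ s ≥ s₁, u s ^ 2 + p s ^ 2 ≤ M ∧ |c / (1 + s)| ≤ α / 2 := by
  set s₁ : ℝ := s₀ + 1 + 2 * |c| / α with hs₁
  have hq : 0 ≤ 2 * |c| / α := by positivity
  have hlt : s₀ < s₁ := by linarith
  have hc : ∀ s ≥ s₁, |c / (1 + s)| ≤ α / 2 := by
    intro s hs
    have h1 : 0 < 1 + s := by linarith
    rw [abs_div, abs_of_pos h1, div_le_iff₀ h1]
    have : 2 * |c| / α ≤ 1 + s := by linarith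
    rw [div_le_iff₀ hα] at this
    linarith
  set K : ℝ := (1 - κ) ^ 2 / α with hK
  have hK0 : 0 ≤ K := by positivity
  set V : ℝ → ℝ := fun s => (u s ^ 2 + p s ^ 2) * Real.exp (K / (1 + s)) with hV
  have hVd : ∀ s > s₀, HasDerivAt V
      ((2 * u s * (p s / (1 + s)) + 2 * p s * (-(α + c / (1 + s)) * p s - κ * u s / (1 + s)))
          * Real.exp (K / (1 + s))
        + (u s ^ 2 + p s ^ 2) * (Real.exp (K / (1 + s)) * (-K / (1 + s) ^ 2))) s := by
    intro s hs
    have h1 : 1 + s ≠ 0 := by linarith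
    have hτ : HasDerivAt (fun s : ℝ => 1 + s) 1 s := (hasDerivAt_id s).const_add 1
    have he : HasDerivAt (fun s : ℝ => K / (1 + s)) (-K / (1 + s) ^ 2) s := by
      convert! (hasDerivAt_const s K).div hτ h1 using 1
      ring
    convert! (((hu s hs).pow 2).add ((hp s hs).pow 2)).mul he.exp using 1
    simp [Pi.add_apply, Pi.pow_apply]
  have hanti : AntitoneOn V (Ici s₁) := by
    apply antitoneOn_of_deriv_nonpos (convex_Ici _)
    · intro s hs
      exact (hVd s (lt_of_lt_of_le hlt hs)).continuousAt.continuousWithinAt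
    · intro s hs
      rw [interior_Ici] at hs
      exact (hVd s (hlt.trans hs)).differentiableAt.differentiableWithinAt
    · intro s hs
      rw [interior_Ici] at hs
      rw [(hVd s (hlt.trans hs)).deriv]
      have hs' : s₁ < s := hs
      have h1 : 0 < 1 + s := by linarith
      have hcs := (abs_le.1 (hc s hs'.le)).1
      have key : (2 * u s * (p s / (1 + s)) + 2 * p s * (-(α + c / (1 + s)) * p s - κ * u s / (1 + s)))
          + (u s ^ 2 + p s ^ 2) * (-K / (1 + s) ^ 2) ≤ 0 := by
        set w := u s / (1 + s) with hw
        have e1 : (2 * u s * (p s / (1 + s)) + 2 * p s * (-(α + c / (1 + s)) * p s - κ * u s / (1 + s)))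
          + (u s ^ 2 + p s ^ 2) * (-K / (1 + s) ^ 2)
          = 2 * (1 - κ) * w * p s - 2 * (α + c / (1 + s)) * p s ^ 2 - K * w ^ 2
            - K * (p s / (1 + s)) ^ 2 := by
          rw [hw]; field_simp; ring
        have e2 : α * p s ^ 2 - 2 * (1 - κ) * w * p s + K * w ^ 2
            = (α * p s - (1 - κ) * w) ^ 2 / α := by
          rw [hK]; field_simp; ring
        have e3 : 0 ≤ (α * p s - (1 - κ) * w) ^ 2 / α := by positivity
        have e4 : 0 ≤ K * (p s / (1 + s)) ^ 2 := by positivity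
        rw [e1]
        nlinarith [sq_nonneg (p s)]
      have := mul_nonpos_of_nonpos_of_nonneg key (Real.exp_pos (K / (1 + s))).le
      linarith
  refine ⟨V s₁, s₁, hlt, fun s hs => ⟨?_, hc s hs⟩⟩
  have h := hanti self_mem_Ici hs hs
  refine le_trans ?_ h
  have h1 : 0 < 1 + s := by linarith
  exact le_mul_of_one_le_right (by positivity) (Real.one_le_exp (by positivity))

theorem tendsto_of_linear_system {α c κ s₀ : ℝ} (hα : 0 < α) (hs₀ : 0 ≤ s₀) {u p : ℝ → ℝ}
    (hu : ∀ s > s₀, HasDerivAt u (p s / (1 + s)) s)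
    (hp : ∀ s > s₀, HasDerivAt p (-(α + c / (1 + s)) * p s - κ * u s / (1 + s)) s) :
    Tendsto p atTop (nhds 0) ∧ ∃ L : ℝ, Tendsto u atTop (nhds L) := by
  obtain ⟨M, s₁, hlt, hM⟩ := bounded_sum_sq_of_linear_system hα hs₀ hu hp
  have hτtop : Tendsto (fun s : ℝ => 1 + s) atTop atTop := tendsto_atTop_add_const_left _ _ tendsto_id
  have hinv : ∀ C : ℝ, Tendsto (fun s : ℝ => C / (1 + s)) atTop (nhds 0) :=
    fun C => hτtop.const_div_atTop C
  have hp0 : Tendsto p atTop (nhds 0) := by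
    -- `(1 + s) * p ^ 2` stays bounded
    set C : ℝ := M + κ ^ 2 * M * (2 / α) with hC
    set W : ℝ → ℝ := fun s => ((1 + s) * p s ^ 2 - 2 * C / α) * Real.exp (α / 2 * s) with hW
    have hWd : ∀ s > s₀, HasDerivAt W
        ((p s ^ 2 + (1 + s) * (2 * p s * (-(α + c / (1 + s)) * p s - κ * u s / (1 + s))))
            * Real.exp (α / 2 * s)
          + ((1 + s) * p s ^ 2 - 2 * C / α) * (Real.exp (α / 2 * s) * (α / 2))) s := by
      intro s hs
      have hτ : HasDerivAt (fun s : ℝ => 1 + s) 1 s := (hasDerivAt_id s).const_add 1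
      have he : HasDerivAt (fun s : ℝ => α / 2 * s) (α / 2) s := by
        simpa using (hasDerivAt_id s).const_mul (α / 2)
      convert! ((hτ.mul ((hp s hs).pow 2)).sub_const (2 * C / α)).mul he.exp using 1
      simp [Pi.pow_apply]
    have hanti : AntitoneOn W (Ici s₁) := by
      apply antitoneOn_of_deriv_nonpos (convex_Ici _)
      · intro s hs
        exact (hWd s (lt_of_lt_of_le hlt hs)).continuousAt.continuousWithinAt
      · intro s hs
        rw [interior_Ici] at hs
        exact (hWd s (hlt.trans hs)).differentiableAt.differentiableWithinAt
      · intro s hs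
        rw [interior_Ici] at hs
        rw [(hWd s (hlt.trans hs)).deriv]
        have hs' : s₁ < s := hs
        have h1 : 0 < 1 + s := by linarith
        have hcs := (abs_le.1 (hM s hs'.le).2).1
        have hMs := (hM s hs'.le).1
        have key : (p s ^ 2 + (1 + s) * (2 * p s * (-(α + c / (1 + s)) * p s - κ * u s / (1 + s))))
            + ((1 + s) * p s ^ 2 - 2 * C / α) * (α / 2) ≤ 0 := by
          have e1 : (p s ^ 2 + (1 + s) * (2 * p s * (-(α + c / (1 + s)) * p s - κ * u s / (1 + s))))
            + ((1 + s) * p s ^ 2 - 2 * C / α) * (α / 2)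
            = p s ^ 2 - C - 2 * κ * (u s * p s) + (1 + s) * (p s ^ 2 * (α / 2 - 2 * (α + c / (1 + s)))) := by
            field_simp; ring
          have e2 : α / 2 * p s ^ 2 + 2 * κ * (u s * p s) + κ ^ 2 * u s ^ 2 * (2 / α)
              = (α / 2 * p s + κ * u s) ^ 2 * (2 / α) := by
            field_simp; ring
          have e3 : 0 ≤ (α / 2 * p s + κ * u s) ^ 2 * (2 / α) := by positivity
          have e4 : κ ^ 2 * u s ^ 2 * (2 / α) ≤ κ ^ 2 * M * (2 / α) := by
            have : u s ^ 2 ≤ M := by nlinarith [sq_nonneg (p s)]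
            gcongr
          have e5 : p s ^ 2 ≤ M := by nlinarith [sq_nonneg (u s)]
          have e6 : p s ^ 2 * (α / 2 - 2 * (α + c / (1 + s))) ≤ -(α / 2 * p s ^ 2) := by
            nlinarith [sq_nonneg (p s)]
          have e7 : (1 + s) * (p s ^ 2 * (α / 2 - 2 * (α + c / (1 + s)))) ≤ -(α / 2 * p s ^ 2) := by
            have : 0 ≤ α / 2 * p s ^ 2 := by positivity
            nlinarith
          rw [e1, hC]
          linarith
        have := mul_nonpos_of_nonpos_of_nonneg key (Real.exp_pos (α / 2 * s)).le
        linarith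
    have hbd : ∀ s ≥ s₁, p s ^ 2 ≤ (2 * C / α + |W s₁|) / (1 + s) := by
      intro s hs
      have h1 : 0 < 1 + s := by linarith
      have h := (hanti self_mem_Ici hs hs).trans (le_abs_self (W s₁))
      have h2 : (1 : ℝ) ≤ Real.exp (α / 2 * s) := Real.one_le_exp (mul_nonneg (by linarith) (by linarith))
      rw [le_div_iff₀ h1]
      by_contra! hcon
      have h3 : |W s₁| < (1 + s) * p s ^ 2 - 2 * C / α := by linarith
      have h4 : (1 + s) * p s ^ 2 - 2 * C / α ≤ W s :=
        le_mul_of_one_le_right ((abs_nonneg _).trans h3.le) h2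
      linarith
    have hsq : Tendsto (fun s => p s ^ 2) atTop (nhds 0) := by
      refine squeeze_zero' (.of_forall fun s => sq_nonneg _) ?_ (hinv (2 * C / α + |W s₁|))
      filter_upwards [eventually_ge_atTop s₁] with s hs using hbd s hs
    have := hsq.sqrt
    simp only [Real.sqrt_sq_eq_abs, Real.sqrt_zero] at this
    exact tendsto_zero_iff_abs_tendsto_zero _ |>.2 this
  refine ⟨hp0, ?_⟩
  -- `u + p / (α (1 + s))` has an integrable derivative
  set g : ℝ → ℝ := fun s => u s + p s / (1 + s) / α with hg
  set g' : ℝ → ℝ := fun s => (-(c + 1) * p s - κ * u s) / (α * (1 + s) ^ 2) with hg'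
  have hgd : ∀ s > s₀, HasDerivAt g (g' s) s := by
    intro s hs
    have h1 : 1 + s ≠ 0 := by linarith
    have hτ : HasDerivAt (fun s : ℝ => 1 + s) 1 s := (hasDerivAt_id s).const_add 1
    convert! (hu s hs).add (((hp s hs).div hτ h1).div_const α) using 1
    rw [hg']
    field_simp
    ring
  have hg'c : ContinuousOn g' (Ioi s₁) := by
    intro s hs
    have hs' : s₁ < s := hs
    have h1 : α * (1 + s) ^ 2 ≠ 0 := by
      have : 0 < 1 + s := by linarith
      positivity
    have hup := (hu s (hlt.trans hs)).continuousAt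
    have hpp := (hp s (hlt.trans hs)).continuousAt
    have hnum : ContinuousAt (fun s => -(c + 1) * p s - κ * u s) s := by fun_prop
    have hden : ContinuousAt (fun s : ℝ => α * (1 + s) ^ 2) s := by fun_prop
    exact (hnum.div hden h1).continuousWithinAt
  have hint : IntegrableOn g' (Ioi s₁) := by
    have hdom : IntegrableOn (fun s : ℝ => ((|c + 1| + |κ|) * (M + 1) / α) * (s + 1) ^ (-2 : ℝ)) (Ioi s₁) := by
      apply Integrable.const_mul
      exact integrableOn_add_rpow_Ioi_of_lt (by norm_num) (by linarith)
    refine Integrable.mono' hdom (hg'c.aestronglyMeasurable measurableSet_Ioi) ?_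
    refine (ae_restrict_iff' measurableSet_Ioi).2 (.of_forall fun s hs => ?_)
    have hs' : s₁ < s := hs
    have h1 : 0 < 1 + s := by linarith
    have hMs := (hM s hs'.le).1
    have hpa : |p s| ≤ M + 1 := by
      rw [abs_le]
      constructor <;> nlinarith [sq_nonneg (u s), sq_nonneg (p s - 1), sq_nonneg (p s + 1)]
    have hua : |u s| ≤ M + 1 := by
      rw [abs_le]
      constructor <;> nlinarith [sq_nonneg (p s), sq_nonneg (u s - 1), sq_nonneg (u s + 1)]
    have h2 : (s + 1) ^ (-2 : ℝ) = ((1 + s) ^ 2)⁻¹ := by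
      rw [Real.rpow_neg (by linarith), add_comm s 1]; norm_num
    rw [h2, hg', Real.norm_eq_abs, abs_div, abs_of_pos (show 0 < α * (1 + s) ^ 2 by positivity)]
    have h3 : |-(c + 1) * p s - κ * u s| ≤ (|c + 1| + |κ|) * (M + 1) := by
      calc |-(c + 1) * p s - κ * u s| ≤ |-(c + 1) * p s| + |κ * u s| := abs_sub _ _
        _ = |c + 1| * |p s| + |κ| * |u s| := by rw [abs_mul, abs_mul, abs_neg]
        _ ≤ |c + 1| * (M + 1) + |κ| * (M + 1) := by gcongr
        _ = _ := by ring
    calc |-(c + 1) * p s - κ * u s| / (α * (1 + s) ^ 2)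
        ≤ (|c + 1| + |κ|) * (M + 1) / (α * (1 + s) ^ 2) := by gcongr
      _ = _ := by field_simp
  have hlim := tendsto_limUnder_of_hasDerivAt_of_integrableOn_Ioi
    (fun s hs => hgd s (hlt.trans hs)) hint
  refine ⟨limUnder atTop g, ?_⟩
  have hq : Tendsto (fun s => p s / (1 + s) / α) atTop (nhds 0) := by
    simpa using (hp0.div_atTop hτtop).div_const α
  have := hlim.sub hq
  simpa [hg] using this

theorem tendsto_rpow_mul_of_second_order_ode {a b s₀ : ℝ} (ha : a < 0) (hs₀ : 0 ≤ s₀) {y v : ℝ → ℝ}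
    (hy : ∀ s > s₀, HasDerivAt y (v s) s)
    (hv : ∀ s > s₀, HasDerivAt v (a * v s + b / (1 + s) * y s) s) :
    ∃ L : ℝ, Tendsto (fun s => (1 + s) ^ (1 + b / a) * v s) atTop (nhds L) := by
  set β : ℝ := -(b / a) with hβ
  have hb : b = -a * β := by rw [hβ]; field_simp [ha.ne]
  set u : ℝ → ℝ := fun s => (1 + s) ^ (-β) * y s with hu
  set p : ℝ → ℝ := fun s => (1 + s) ^ (1 - β) * v s - β * u s with hp
  have hrp : ∀ r : ℝ, ∀ s > s₀, HasDerivAt (fun s : ℝ => (1 + s) ^ r) (r * ((1 + s) ^ r / (1 + s))) s := by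
    intro r s hs
    have h1 : 0 < 1 + s := by linarith
    have hτ : HasDerivAt (fun s : ℝ => 1 + s) 1 s := (hasDerivAt_id s).const_add 1
    convert! hτ.rpow_const (p := r) (Or.inl h1.ne') using 1
    rw [Real.rpow_sub_one h1.ne']; ring
  have hsplit : ∀ s > s₀, (1 + s) ^ (1 - β) = (1 + s) * (1 + s) ^ (-β) := by
    intro s hs
    have h1 : 0 < 1 + s := by linarith
    rw [sub_eq_add_neg, Real.rpow_add h1, Real.rpow_one]
  have hud : ∀ s > s₀, HasDerivAt u (p s / (1 + s)) s := by
    intro s hs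
    have h1 : 0 < 1 + s := by linarith
    convert! (hrp (-β) s hs).mul (hy s hs) using 1
    simp only [hp, hu]
    rw [hsplit s hs]
    field_simp
    ring
  have hpd : ∀ s > s₀, HasDerivAt p
      (-(-a + (2 * β - 1) / (1 + s)) * p s - (-(β * (1 - β))) * u s / (1 + s)) s := by
    intro s hs
    have h1 : 0 < 1 + s := by linarith
    convert! ((hrp (1 - β) s hs).mul (hv s hs)).sub ((hud s hs).const_mul β) using 1
    simp only [hp, hu]
    rw [hsplit s hs, hb]
    field_simp
    ring
  obtain ⟨h0, L, hL⟩ := tendsto_of_linear_system (neg_pos.2 ha) hs₀ hud hpd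
  refine ⟨0 + β * L, ?_⟩
  have := h0.add (hL.const_mul β)
  refine this.congr fun s => ?_
  have e : 1 + b / a = 1 - β := by rw [hβ]; ring
  rw [e]; simp only [hp]; ring

theorem exists_abs_le_of_functional_equation (a b σ x₀ q T : ℝ) (hT : 0 ≤ T) :
    ∃ D : ℝ, ∀ x β : ℝ → ℝ, Continuous x → Continuous β →
      (∀ s ∈ Icc 0 T, x s = x₀
        + (∫ r in (0:ℝ)..s, (a * x r + b / (1 + r) * (q + ∫ v in (0:ℝ)..r, x v))) + σ * β s) →
      ∀ s ∈ Icc 0 T, |x s| ≤ D * (1 + |β s| + ∫ r in (0:ℝ)..T, |β r|) := by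
  set K : ℝ := |a| + |b| * T with hK
  set c₀ : ℝ := |x₀| + |b| * |q| * T with hc₀
  have hK0 : 0 ≤ K := by positivity
  have hc0 : 0 ≤ c₀ := by positivity
  refine ⟨c₀ + |σ| + K * (Real.exp (K * T) * (c₀ * T + |σ|)), ?_⟩
  intro x β hx hβ heq
  set A : ℝ → ℝ := fun s => ∫ r in (0:ℝ)..s, |x r| with hA
  set f : ℝ → ℝ := fun s => c₀ + |σ| * |β s| with hf
  have hfc : Continuous f := by fun_prop
  have hA0 : ∀ s, 0 ≤ s → 0 ≤ A s := fun s hs =>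
    intervalIntegral.integral_nonneg hs fun _ _ => abs_nonneg _
  have hAmono : ∀ r s, 0 ≤ r → r ≤ s → A r ≤ A s := fun r s hr hrs =>
    intervalIntegral.integral_mono_interval le_rfl hr hrs (.of_forall fun _ => abs_nonneg _)
      (hx.abs.intervalIntegrable _ _)
  have hAd : ∀ s, HasDerivAt A |x s| s := fun s => hx.abs.integral_hasStrictDerivAt 0 s |>.hasDerivAt
  have hFd : ∀ s, HasDerivAt (fun s => ∫ r in (0:ℝ)..s, f r) (f s) s :=
    fun s => hfc.integral_hasStrictDerivAt 0 s |>.hasDerivAt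
  have hxle : ∀ s ∈ Icc 0 T, |x s| ≤ f s + K * A s := by
    intro s hs
    have hbound : |∫ r in (0:ℝ)..s, (a * x r + b / (1 + r) * (q + ∫ v in (0:ℝ)..r, x v))|
        ≤ ∫ r in (0:ℝ)..s, (|a| * |x r| + |b| * (|q| + A s)) := by
      rw [← Real.norm_eq_abs]
      refine intervalIntegral.norm_integral_le_of_norm_le hs.1 (.of_forall fun r hr => ?_)
        (Continuous.intervalIntegrable (by fun_prop) _ _)
      have h1 : 1 ≤ 1 + r := by linarith [hr.1]
      have h2 : |b / (1 + r)| ≤ |b| := by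
        rw [abs_div, abs_of_pos (by linarith : 0 < 1 + r)]
        exact div_le_self (abs_nonneg _) h1
      have h3 : |∫ v in (0:ℝ)..r, x v| ≤ A s :=
        (intervalIntegral.abs_integral_le_integral_abs hr.1.le).trans (hAmono r s hr.1.le hr.2)
      calc ‖a * x r + b / (1 + r) * (q + ∫ v in (0:ℝ)..r, x v)‖
          ≤ |a * x r| + |b / (1 + r) * (q + ∫ v in (0:ℝ)..r, x v)| := abs_add_le _ _
        _ = |a| * |x r| + |b / (1 + r)| * |q + ∫ v in (0:ℝ)..r, x v| := by rw [abs_mul, abs_mul]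
        _ ≤ |a| * |x r| + |b| * (|q| + A s) := by
          gcongr
          exact (abs_add_le _ _).trans (by linarith)
    have hval : ∫ r in (0:ℝ)..s, (|a| * |x r| + |b| * (|q| + A s))
        = |a| * A s + s * (|b| * (|q| + A s)) := by
      rw [intervalIntegral.integral_add (Continuous.intervalIntegrable (by fun_prop) _ _)
        (Continuous.intervalIntegrable (by fun_prop) _ _), intervalIntegral.integral_const_mul,
        intervalIntegral.integral_const]
      simp [hA]
    have h4 : s * (|b| * (|q| + A s)) ≤ T * (|b| * (|q| + A s)) := by
      have := hA0 s hs.1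
      have := hs.2
      gcongr
    have h5 : |x s| ≤ |x₀| + |∫ r in (0:ℝ)..s, (a * x r + b / (1 + r) * (q + ∫ v in (0:ℝ)..r, x v))|
        + |σ| * |β s| := by
      rw [heq s hs, ← abs_mul]
      exact abs_add_three _ _ _
    simp only [hf, hc₀, hK]
    linarith
  have hanti : AntitoneOn (fun s => A s * Real.exp (-(K * s)) - ∫ r in (0:ℝ)..s, f r) (Icc 0 T) := by
    have hd : ∀ s, HasDerivAt (fun s => A s * Real.exp (-(K * s)) - ∫ r in (0:ℝ)..s, f r)
        (|x s| * Real.exp (-(K * s)) + A s * (Real.exp (-(K * s)) * -K) - f s) s := by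
      intro s
      have he : HasDerivAt (fun s : ℝ => -(K * s)) (-K) s :=
        ((hasDerivAt_id s).const_mul K).neg.congr_deriv (by simp)
      exact ((hAd s).mul he.exp).sub (hFd s)
    apply antitoneOn_of_deriv_nonpos (convex_Icc _ _)
    · exact fun s _ => (hd s).continuousAt.continuousWithinAt
    · exact fun s _ => (hd s).differentiableAt.differentiableWithinAt
    · intro s hs
      have hs' := interior_subset hs
      rw [(hd s).deriv]
      have h1 := hxle s hs'
      have h2 : Real.exp (-(K * s)) ≤ 1 :=
        Real.exp_le_one_iff.2 (by have := mul_nonneg hK0 hs'.1; linarith)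
      have h3 : 0 ≤ f s := by positivity
      have h4 := Real.exp_pos (-(K * s))
      nlinarith
  intro s hs
  have hAT : A s ≤ Real.exp (K * T) * (c₀ * T + |σ| * ∫ r in (0:ℝ)..T, |β r|) := by
    have h1 := hanti (left_mem_Icc.2 hT) (right_mem_Icc.2 hT) hT
    have hval : ∫ r in (0:ℝ)..T, f r = c₀ * T + |σ| * ∫ r in (0:ℝ)..T, |β r| := by
      simp only [hf]
      rw [intervalIntegral.integral_add (Continuous.intervalIntegrable (by fun_prop) _ _)
        (Continuous.intervalIntegrable (by fun_prop) _ _), intervalIntegral.integral_const_mul,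
        intervalIntegral.integral_const]
      simp [mul_comm]
    have hz : A 0 = 0 := by simp [hA]
    simp only [intervalIntegral.integral_same, hz, hval] at h1
    have h2 : A T * Real.exp (-(K * T)) ≤ c₀ * T + |σ| * ∫ r in (0:ℝ)..T, |β r| := by linarith
    rw [Real.exp_neg, ← div_eq_mul_inv, div_le_iff₀ (Real.exp_pos _)] at h2
    have h3 := hAmono s T hs.1 hs.2
    linarith
  have hS : 0 ≤ ∫ r in (0:ℝ)..T, |β r| :=
    intervalIntegral.integral_nonneg hT fun _ _ => abs_nonneg _
  set S := ∫ r in (0:ℝ)..T, |β r| with hSdef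
  have hb := abs_nonneg (β s)
  have hE := Real.exp_pos (K * T)
  have h1 : c₀ * T + |σ| * S ≤ (c₀ * T + |σ|) * (1 + |β s| + S) := by
    have : 0 ≤ c₀ * T := by positivity
    nlinarith [abs_nonneg σ]
  calc |x s| ≤ c₀ + |σ| * |β s| + K * A s := hxle s hs
    _ ≤ c₀ + |σ| * |β s| + K * (Real.exp (K * T) * ((c₀ * T + |σ|) * (1 + |β s| + S))) := by
      have := hAT.trans (mul_le_mul_of_nonneg_left h1 hE.le)
      gcongr
    _ ≤ c₀ * (1 + |β s| + S) + |σ| * (1 + |β s| + S)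
        + K * (Real.exp (K * T) * ((c₀ * T + |σ|) * (1 + |β s| + S))) := by
      have := abs_nonneg σ
      gcongr
      · nlinarith
      · linarith
    _ = _ := by ring

namespace IsStdBrownian

variable {Ω : Type*} {mΩ : MeasurableSpace Ω} {P : Measure Ω} {F : MeasureTheory.Filtration ℝ mΩ}
  {B : ℝ → Ω → ℝ}

theorem measurable (hB : IsStdBrownian P F B) (s : ℝ) : Measurable (B s) :=
  (hB.1 s).mono (F.le s) le_rfl

theorem measurable_uncurry (hB : IsStdBrownian P F B) : Measurable (Function.uncurry B) :=
  measurable_uncurry_of_continuous_of_measurable hB.2.2.1 hB.measurable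

theorem map_eq (hB : IsStdBrownian P F B) {s : ℝ} (hs : 0 ≤ s) :
    P.map (B s) = gaussianReal 0 (Real.toNNReal s) := by
  have h := hB.2.2.2.1 0 s le_rfl hs
  simpa [hB.2.1] using h

theorem memLp_two (hB : IsStdBrownian P F B) {s : ℝ} (hs : 0 ≤ s) : MemLp (B s) 2 P := by
  have h : MemLp id 2 (P.map (B s)) := by
    rw [hB.map_eq hs]; exact memLp_id_gaussianReal 2
  exact (memLp_map_measure_iff aestronglyMeasurable_id (hB.measurable s).aemeasurable).1 h

theorem integral_sq (hB : IsStdBrownian P F B) {s : ℝ} (hs : 0 ≤ s) : ∫ ω, B s ω ^ 2 ∂P = s := by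
  have h1 : ∫ ω, B s ω ^ 2 ∂P = ∫ x, x ^ 2 ∂(P.map (B s)) :=
    (integral_map (f := fun x : ℝ => x ^ 2) (hB.measurable s).aemeasurable
      (measurable_id.pow_const 2).aestronglyMeasurable).symm
  have h2 : ∫ x, x ^ 2 ∂(gaussianReal 0 (Real.toNNReal s)) = Real.toNNReal s := by
    rw [← variance_id_gaussianReal (μ := 0),
      variance_of_integral_eq_zero aemeasurable_id (by simp)]
    simp
  rw [h1, hB.map_eq hs, h2, Real.coe_toNNReal _ hs]

theorem memLp_two_prod [IsProbabilityMeasure P] (hB : IsStdBrownian P F B) (T : ℝ) :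
    MemLp (Function.uncurry B) 2 ((volume.restrict (Ioc 0 T)).prod P) := by
  have hm := hB.measurable_uncurry
  rw [memLp_two_iff_integrable_sq hm.aestronglyMeasurable,
    integrable_prod_iff (hm.pow_const 2).aestronglyMeasurable]
  have hmem := ae_restrict_mem (μ := volume) (measurableSet_Ioc (a := (0:ℝ)) (b := T))
  refine ⟨?_, ?_⟩
  · filter_upwards [hmem] with s hs
    exact (hB.memLp_two hs.1.le).integrable_sq
  · have hid : Integrable (fun s : ℝ => s) (volume.restrict (Ioc 0 T)) :=
      (continuous_id.integrableOn_Icc (a := (0:ℝ)) (b := T)).mono_set Ioc_subset_Icc_self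
    refine hid.congr ?_
    filter_upwards [hmem] with s hs
    simp [Function.uncurry, hB.integral_sq hs.1.le]

theorem memLp_two_integral_abs [IsProbabilityMeasure P] (hB : IsStdBrownian P F B) {T : ℝ}
    (hT : 0 < T) : MemLp (fun ω => ∫ s in (0:ℝ)..T, |B s ω|) 2 P := by
  have hL2 := hB.memLp_two_prod T
  have hL1 := hL2.norm.integrable one_le_two
  have hS : Integrable (fun ω => ∫ s in (0:ℝ)..T, |B s ω|) P := by
    simpa [intervalIntegral.integral_of_le hT.le] using hL1.integral_prod_right
  have hQ : Integrable (fun ω => ∫ s in (0:ℝ)..T, B s ω ^ 2) P := by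
    simpa [intervalIntegral.integral_of_le hT.le] using hL2.integrable_sq.integral_prod_right
  rw [memLp_two_iff_integrable_sq hS.aestronglyMeasurable]
  refine (hQ.const_mul T).mono' (hS.aestronglyMeasurable.pow 2) (.of_forall fun ω => ?_)
  have hc := hB.2.2.1 ω
  set S := ∫ s in (0:ℝ)..T, |B s ω| with hSdef
  have h0 : 0 ≤ ∫ s in (0:ℝ)..T, (|B s ω| - S / T) ^ 2 :=
    intervalIntegral.integral_nonneg hT.le fun _ _ => sq_nonneg _
  have h1 : ∫ s in (0:ℝ)..T, (|B s ω| - S / T) ^ 2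
      = (∫ s in (0:ℝ)..T, B s ω ^ 2) - 2 * (S / T) * S + T * (S / T) ^ 2 := by
    have : ∀ s, (|B s ω| - S / T) ^ 2 = B s ω ^ 2 - 2 * (S / T) * |B s ω| + (S / T) ^ 2 := by
      intro s; rw [sub_sq, sq_abs]; ring
    simp_rw [this]
    rw [intervalIntegral.integral_add (Continuous.intervalIntegrable (by fun_prop) _ _)
        (Continuous.intervalIntegrable (by fun_prop) _ _),
      intervalIntegral.integral_sub (Continuous.intervalIntegrable (by fun_prop) _ _)
        (Continuous.intervalIntegrable (by fun_prop) _ _), intervalIntegral.integral_const_mul,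
      intervalIntegral.integral_const, sub_zero, smul_eq_mul]
  rw [h1] at h0
  rw [Real.norm_of_nonneg (sq_nonneg _)]
  have h2 := mul_nonneg hT.le h0
  have h3 : T * ((∫ s in (0:ℝ)..T, B s ω ^ 2) - 2 * (S / T) * S + T * (S / T) ^ 2)
      = T * (∫ s in (0:ℝ)..T, B s ω ^ 2) - S ^ 2 := by
    field_simp; ring
  linarith

theorem integral_mul_increment [IsProbabilityMeasure P] (hB : IsStdBrownian P F B) {Y : Ω → ℝ}
    {t s : ℝ} (ht : 0 ≤ t) (hts : t ≤ s) (hY : StronglyMeasurable[F t] Y)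
    (hY0 : ∫ ω, Y ω ∂P = 0) : ∫ ω, Y ω * (B s ω - B t ω) ∂P = 0 := by
  have hind : IndepFun (fun ω => B s ω - B t ω) Y P :=
    (IndepFun_iff_Indep _ _ _).2
      (indep_of_indep_of_le_right (hB.2.2.2.2 t s ht hts) hY.measurable.comap_le)
  rw [hind.symm.integral_fun_mul_eq_mul_integral (hY.mono (F.le t)).aestronglyMeasurable
    ((hB.measurable s).sub (hB.measurable t)).aestronglyMeasurable, hY0, zero_mul]

end IsStdBrownian

theorem tendsto_rpow_mul_of_integral_equation {a b k t : ℝ} (ha : a < 0) (ht : 0 ≤ t) {C : ℝ → ℝ}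
    (hC : ∀ T, 0 ≤ T → IntervalIntegrable C volume 0 T)
    (heq : ∀ s ≥ t, C s = k
      + ∫ r in (0:ℝ)..s, (a * C r + b / (1 + r) * ∫ v in (0:ℝ)..r, C v)) :
    ∃ L : ℝ, Tendsto (fun s => (1 + s) ^ (1 + b / a) * C s) atTop (nhds L) := by
  set y : ℝ → ℝ := fun s => ∫ v in (0:ℝ)..s, C v with hy
  set G : ℝ → ℝ := fun r => a * C r + b / (1 + r) * y r with hG
  have hprim : ∀ f : ℝ → ℝ, (∀ T, 0 ≤ T → IntervalIntegrable f volume 0 T) → ∀ T, 0 ≤ T →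
      ContinuousOn (fun s => ∫ v in (0:ℝ)..s, f v) (Icc 0 T) := by
    intro f hf T hT
    have := intervalIntegral.continuousOn_primitive_interval' (hf T hT) left_mem_uIcc
    rwa [uIcc_of_le hT] at this
  have hGi : ∀ T, 0 ≤ T → IntervalIntegrable G volume 0 T := by
    intro T hT
    refine ((hC T hT).const_mul a).add (ContinuousOn.intervalIntegrable ?_)
    rw [uIcc_of_le hT]
    refine ContinuousOn.mul (ContinuousOn.div (by fun_prop) (by fun_prop) fun r hr => ?_)
      (hprim C hC T hT)
    have := hr.1
    positivity
  have hat : ∀ f : ℝ → ℝ, (∀ T, 0 ≤ T → IntervalIntegrable f volume 0 T) → ∀ s > t,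
      ContinuousAt (fun s => ∫ v in (0:ℝ)..s, f v) s := fun f hf s hs =>
    (hprim f hf (s + 1) (by linarith)).continuousAt (Icc_mem_nhds (by linarith) (by linarith))
  have hCeq : ∀ s > t, C =ᶠ[nhds s] fun s => k + ∫ r in (0:ℝ)..s, G r := by
    intro s hs
    filter_upwards [Ioi_mem_nhds hs] with r hr using heq r (le_of_lt hr)
  have hCc : ∀ s > t, ContinuousAt C s := fun s hs =>
    ((hat G hGi s hs).const_add k).congr (hCeq s hs).symm
  have hGc : ∀ s > t, ContinuousAt G s := by
    intro s hs
    have h1 : 1 + s ≠ 0 := by linarith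
    have h2 : ContinuousAt (fun r : ℝ => b / (1 + r)) s :=
      ContinuousAt.div (by fun_prop) (by fun_prop) h1
    exact ((hCc s hs).const_mul a).add (h2.mul (hat C hC s hs))
  have hder : ∀ f : ℝ → ℝ, (∀ T, 0 ≤ T → IntervalIntegrable f volume 0 T) →
      (∀ s > t, ContinuousAt f s) → ∀ s > t,
      HasDerivAt (fun s => ∫ v in (0:ℝ)..s, f v) (f s) s := by
    intro f hf hfc s hs
    refine intervalIntegral.integral_hasDerivAt_right (hf s (by linarith)) ?_ (hfc s hs)
    exact ContinuousOn.stronglyMeasurableAtFilter isOpen_Ioi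
      (fun r hr => (hfc r hr).continuousWithinAt) s hs
  exact tendsto_rpow_mul_of_second_order_ode ha ht (hder C hC hCc) fun s hs =>
    ((hder G hGi hGc s hs).const_add k).congr_of_eventuallyEq (hCeq s hs)

section Moments

variable {Ω : Type*} {mΩ : MeasurableSpace Ω} {P : Measure Ω} [IsProbabilityMeasure P]
  {x : ℝ → Ω → ℝ} {Y : Ω → ℝ} {T : ℝ}

theorem integrable_prod_mul (hY : MemLp Y 2 P)
    (hL : MemLp (Function.uncurry x) 2 ((volume.restrict (Ioc 0 T)).prod P)) :
    Integrable (fun z : ℝ × Ω => Y z.2 * x z.1 z.2) ((volume.restrict (Ioc 0 T)).prod P) :=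
  (hY.comp_snd (volume.restrict (Ioc 0 T))).integrable_mul hL

theorem intervalIntegrable_integral_mul (hT : 0 ≤ T) (hY : MemLp Y 2 P)
    (hL : MemLp (Function.uncurry x) 2 ((volume.restrict (Ioc 0 T)).prod P)) :
    IntervalIntegrable (fun u => ∫ ω, Y ω * x u ω ∂P) volume 0 T :=
  (intervalIntegrable_iff_integrableOn_Ioc_of_le hT).2
    (integrable_prod_mul hY hL).integral_prod_left

theorem integral_mul_integral_eq (hT : 0 ≤ T) (hY : MemLp Y 2 P)
    (hL : MemLp (Function.uncurry x) 2 ((volume.restrict (Ioc 0 T)).prod P)) :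
    ∫ ω, Y ω * (∫ u in (0:ℝ)..T, x u ω) ∂P = ∫ u in (0:ℝ)..T, ∫ ω, Y ω * x u ω ∂P := by
  rw [intervalIntegral_integral_swap (by rw [uIoc_of_le hT]; exact integrable_prod_mul hY hL)]
  simp_rw [intervalIntegral.integral_const_mul]

theorem integrable_mul_integral_abs (hT : 0 ≤ T) (hY : MemLp Y 2 P)
    (hL : MemLp (Function.uncurry x) 2 ((volume.restrict (Ioc 0 T)).prod P)) :
    Integrable (fun ω => |Y ω| * ∫ u in (0:ℝ)..T, |x u ω|) P := by
  have := (integrable_prod_mul hY hL).abs.integral_prod_right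
  simpa [abs_mul, integral_const_mul, intervalIntegral.integral_of_le hT] using this

theorem measurable_uncurry_integral (hxc : ∀ ω, Continuous fun u => x u ω)
    (hxm : ∀ u, Measurable (x u)) :
    Measurable (Function.uncurry fun (r : ℝ) ω => ∫ v in (0:ℝ)..r, x v ω) := by
  refine measurable_uncurry_of_continuous_of_measurable (fun ω => ?_) fun r => ?_
  · exact intervalIntegral.continuous_primitive (fun _ _ => (hxc ω).intervalIntegrable _ _) 0
  · have hm : StronglyMeasurable (Function.uncurry fun ω u => x u ω) :=
      ((measurable_uncurry_of_continuous_of_measurable hxc hxm).comp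
        measurable_swap).stronglyMeasurable
    unfold intervalIntegral
    exact (hm.integral_prod_right.sub hm.integral_prod_right).measurable

theorem integrable_prod_mul_integral (hT : 0 ≤ T) (hxc : ∀ ω, Continuous fun u => x u ω)
    (hxm : ∀ u, Measurable (x u)) (hY : MemLp Y 2 P)
    (hL : MemLp (Function.uncurry x) 2 ((volume.restrict (Ioc 0 T)).prod P)) :
    Integrable (fun z : ℝ × Ω => Y z.2 * ∫ v in (0:ℝ)..z.1, x v z.2)
      ((volume.restrict (Ioc 0 T)).prod P) := by
  have hdom := (integrable_mul_integral_abs hT hY hL).comp_snd (volume.restrict (Ioc 0 T))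
  refine hdom.mono' (hY.aestronglyMeasurable.comp_snd.mul
    (measurable_uncurry_integral hxc hxm).aestronglyMeasurable) ?_
  have hmem : ∀ᵐ z ∂((volume.restrict (Ioc 0 T)).prod P), z.1 ∈ Ioc 0 T :=
    Measure.quasiMeasurePreserving_fst.ae (ae_restrict_mem measurableSet_Ioc)
  filter_upwards [hmem] with z hz
  rw [norm_mul, Real.norm_eq_abs, Real.norm_eq_abs]
  gcongr
  exact (intervalIntegral.abs_integral_le_integral_abs hz.1.le).trans
    (intervalIntegral.integral_mono_interval le_rfl hz.1.le hz.2 (.of_forall fun _ => abs_nonneg _)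
      ((hxc z.2).abs.intervalIntegrable _ _))

theorem integrable_prod_mul_drift (a b q : ℝ) (hT : 0 ≤ T)
    (hxc : ∀ ω, Continuous fun u => x u ω) (hxm : ∀ u, Measurable (x u)) (hY : MemLp Y 2 P)
    (hL : MemLp (Function.uncurry x) 2 ((volume.restrict (Ioc 0 T)).prod P)) :
    Integrable (fun z : ℝ × Ω =>
        Y z.2 * (a * x z.1 z.2 + b / (1 + z.1) * (q + ∫ v in (0:ℝ)..z.1, x v z.2)))
      ((volume.restrict (Ioc 0 T)).prod P) := by
  have hYi := (hY.comp_snd (volume.restrict (Ioc 0 T))).integrable one_le_two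
  have hI := (hYi.const_mul q).add (integrable_prod_mul_integral hT hxc hxm hY hL)
  have hmem : ∀ᵐ z ∂((volume.restrict (Ioc 0 T)).prod P), z.1 ∈ Ioc 0 T :=
    Measure.quasiMeasurePreserving_fst.ae (ae_restrict_mem measurableSet_Ioc)
  have hbI := hI.bdd_mul (c := |b|) (f := fun z : ℝ × Ω => b / (1 + z.1))
    (Measurable.aestronglyMeasurable (by fun_prop)) (by
      filter_upwards [hmem] with z hz
      have h1 : 1 ≤ 1 + z.1 := by linarith [hz.1]
      rw [Real.norm_eq_abs, abs_div, abs_of_pos (by linarith : 0 < 1 + z.1)]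
      exact div_le_self (abs_nonneg _) h1)
  refine (((integrable_prod_mul hY hL).const_mul a).add hbI).congr (.of_forall fun z => ?_)
  simp only [Pi.add_apply]
  ring

theorem integral_mul_drift_eq (a b q : ℝ) (hT : 0 ≤ T)
    (hxc : ∀ ω, Continuous fun u => x u ω) (hxm : ∀ u, Measurable (x u)) (hY : MemLp Y 2 P)
    (hY0 : ∫ ω, Y ω ∂P = 0) (hx2 : ∀ u, 0 ≤ u → MemLp (x u) 2 P)
    (hL : ∀ T, 0 ≤ T → MemLp (Function.uncurry x) 2 ((volume.restrict (Ioc 0 T)).prod P)) :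
    ∫ ω, Y ω * (∫ r in (0:ℝ)..T, (a * x r ω + b / (1 + r) * (q + ∫ v in (0:ℝ)..r, x v ω))) ∂P
      = ∫ r in (0:ℝ)..T, (a * (∫ ω, Y ω * x r ω ∂P)
          + b / (1 + r) * ∫ v in (0:ℝ)..r, ∫ ω, Y ω * x v ω ∂P) := by
  have hswap := intervalIntegral_integral_swap (μ := P) (a := 0) (b := T)
    (f := fun r ω => Y ω * (a * x r ω + b / (1 + r) * (q + ∫ v in (0:ℝ)..r, x v ω)))
    (by rw [uIoc_of_le hT]; exact integrable_prod_mul_drift a b q hT hxc hxm hY (hL T hT))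
  simp_rw [intervalIntegral.integral_const_mul] at hswap
  rw [← hswap]
  refine intervalIntegral.integral_congr fun r hr => ?_
  rw [uIcc_of_le hT] at hr
  have hi1 : Integrable (fun ω => Y ω * x r ω) P := hY.integrable_mul (hx2 r hr.1)
  have hi2 : Integrable (fun ω => Y ω * ∫ v in (0:ℝ)..r, x v ω) P := by
    refine (integrable_mul_integral_abs hr.1 hY (hL r hr.1)).mono'
      (hY.aestronglyMeasurable.mul ((measurable_uncurry_integral hxc hxm).comp
        measurable_prodMk_left).aestronglyMeasurable) (.of_forall fun ω => ?_)
    rw [norm_mul, Real.norm_eq_abs, Real.norm_eq_abs]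
    gcongr
    exact intervalIntegral.abs_integral_le_integral_abs hr.1
  have hYi := hY.integrable one_le_two
  have hi3 : Integrable (fun ω => q * Y ω + Y ω * ∫ v in (0:ℝ)..r, x v ω) P :=
    (hYi.const_mul q).add hi2
  have hsplit : ∀ ω, Y ω * (a * x r ω + b / (1 + r) * (q + ∫ v in (0:ℝ)..r, x v ω))
      = a * (Y ω * x r ω) + b / (1 + r) * (q * Y ω + Y ω * ∫ v in (0:ℝ)..r, x v ω) := by
    intro ω; ring
  simp only [hsplit]
  rw [integral_add (hi1.const_mul a) (hi3.const_mul _),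
    integral_const_mul, integral_const_mul, integral_add (hYi.const_mul q) hi2,
    integral_const_mul, hY0, integral_mul_integral_eq hr.1 hY (hL r hr.1)]
  ring

end Moments

namespace IsSolutionSFDE

variable {Ω : Type*} {mΩ : MeasurableSpace Ω} {P : Measure Ω} {F : MeasureTheory.Filtration ℝ mΩ}
  {a b σ : ℝ} {ψ : ℝ → ℝ} {B X : ℝ → Ω → ℝ}

theorem continuous_extend (hX : IsSolutionSFDE P F a b σ ψ B X) (ω : Ω) :
    Continuous fun u => X (max u 0) ω :=
  (hX.2.1 ω).comp_continuous (by fun_prop) fun u => le_max_right u 0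

theorem measurable_extend (hX : IsSolutionSFDE P F a b σ ψ B X) (u : ℝ) :
    Measurable (X (max u 0)) :=
  ((hX.1 _ (le_max_right u 0)).mono (F.le _)).measurable

theorem ae_eq_extend (hX : IsSolutionSFDE P F a b σ ψ B X) :
    ∀ᵐ ω ∂P, ∀ s : ℝ, 0 ≤ s → X (max s 0) ω = ψ 0
      + (∫ r in (0:ℝ)..s, (a * X (max r 0) ω
          + b / (1 + r) * ((∫ u in (-1:ℝ)..(0:ℝ), ψ u) + ∫ v in (0:ℝ)..r, X (max v 0) ω)))
      + σ * B s ω := by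
  filter_upwards [hX.2.2] with ω hω s hs
  rw [max_eq_left hs, hω s hs]
  congr 2
  refine intervalIntegral.integral_congr fun r hr => ?_
  rw [uIcc_of_le hs] at hr
  have h : ∫ v in (0:ℝ)..r, X v ω = ∫ v in (0:ℝ)..r, X (max v 0) ω := by
    refine intervalIntegral.integral_congr fun v hv => ?_
    rw [uIcc_of_le hr.1] at hv
    simp only [max_eq_left hv.1]
  simp only [max_eq_left hr.1, h]

theorem ae_abs_le (hB : IsStdBrownian P F B) (hX : IsSolutionSFDE P F a b σ ψ B X) {T : ℝ}
    (hT : 0 ≤ T) : ∃ D : ℝ, ∀ᵐ ω ∂P, ∀ s ∈ Icc 0 T,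
      |X (max s 0) ω| ≤ D * (1 + |B s ω| + ∫ r in (0:ℝ)..T, |B r ω|) := by
  obtain ⟨D, hD⟩ := exists_abs_le_of_functional_equation a b σ (ψ 0)
    (∫ u in (-1:ℝ)..(0:ℝ), ψ u) T hT
  refine ⟨D, ?_⟩
  filter_upwards [hX.ae_eq_extend] with ω hω
  exact hD _ _ (hX.continuous_extend ω) (hB.2.2.1 ω) fun s hs => hω s hs.1

variable [IsProbabilityMeasure P]

theorem memLp_two_extend (hB : IsStdBrownian P F B) (hX : IsSolutionSFDE P F a b σ ψ B X) {u : ℝ}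
    (hu : 0 ≤ u) : MemLp (X (max u 0)) 2 P := by
  obtain ⟨D, hD⟩ := hX.ae_abs_le hB (T := u + 1) (by linarith)
  have hS := hB.memLp_two_integral_abs (T := u + 1) (by linarith)
  have h1 : MemLp (fun _ : Ω => (1 : ℝ)) 2 P := memLp_const 1
  have hBn : MemLp (fun ω => |B u ω|) 2 P := (hB.memLp_two hu).norm
  have hg := ((h1.add hBn).add hS).const_mul D
  refine hg.mono (hX.measurable_extend u).aestronglyMeasurable ?_
  filter_upwards [hD] with ω hω
  exact (hω u ⟨hu, by linarith⟩).trans (le_abs_self _)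

theorem memLp_two_prod_extend (hB : IsStdBrownian P F B) (hX : IsSolutionSFDE P F a b σ ψ B X)
    {T : ℝ} (hT : 0 ≤ T) :
    MemLp (Function.uncurry fun u => X (max u 0)) 2 ((volume.restrict (Ioc 0 T)).prod P) := by
  obtain ⟨D, hD⟩ := hX.ae_abs_le hB (T := T + 1) (by linarith)
  have hS := (hB.memLp_two_integral_abs (T := T + 1) (by linarith)).comp_snd
    (volume.restrict (Ioc 0 T))
  have h1 : MemLp (fun _ : ℝ × Ω => (1 : ℝ)) 2 ((volume.restrict (Ioc 0 T)).prod P) :=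
    memLp_const 1
  have hBn : MemLp (fun z : ℝ × Ω => |B z.1 z.2|) 2 ((volume.restrict (Ioc 0 T)).prod P) :=
    (hB.memLp_two_prod T).norm
  have hg := ((h1.add hBn).add hS).const_mul D
  refine hg.mono (measurable_uncurry_of_continuous_of_measurable hX.continuous_extend
    hX.measurable_extend).aestronglyMeasurable ?_
  have hmem : ∀ᵐ z ∂((volume.restrict (Ioc 0 T)).prod P), z.1 ∈ Ioc 0 T :=
    Measure.quasiMeasurePreserving_fst.ae (ae_restrict_mem measurableSet_Ioc)
  filter_upwards [hmem, Measure.quasiMeasurePreserving_snd.ae hD] with z hz hω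
  exact (hω z.1 ⟨hz.1.le, by linarith [hz.2]⟩).trans (le_abs_self _)

theorem integral_mul_eq (hB : IsStdBrownian P F B) (hX : IsSolutionSFDE P F a b σ ψ B X)
    {Y : Ω → ℝ} {t s : ℝ} (ht : 0 ≤ t) (hts : t ≤ s) (hYm : StronglyMeasurable[F t] Y)
    (hY : MemLp Y 2 P) (hY0 : ∫ ω, Y ω ∂P = 0) :
    ∫ ω, Y ω * X (max s 0) ω ∂P = σ * (∫ ω, Y ω * B t ω ∂P)
      + ∫ r in (0:ℝ)..s, (a * (∫ ω, Y ω * X (max r 0) ω ∂P)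
          + b / (1 + r) * ∫ v in (0:ℝ)..r, ∫ ω, Y ω * X (max v 0) ω ∂P) := by
  have hs : 0 ≤ s := ht.trans hts
  set q := ∫ u in (-1:ℝ)..(0:ℝ), ψ u with hq
  set J : Ω → ℝ := fun ω => ∫ r in (0:ℝ)..s,
    (a * X (max r 0) ω + b / (1 + r) * (q + ∫ v in (0:ℝ)..r, X (max v 0) ω)) with hJ
  have hdrift : ∫ ω, Y ω * J ω ∂P = _ :=
    integral_mul_drift_eq a b q hs hX.continuous_extend hX.measurable_extend hY hY0
      (fun u => hX.memLp_two_extend hB) (fun T => hX.memLp_two_prod_extend hB)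
  rw [← hdrift]
  have hYi := hY.integrable one_le_two
  have hYB : ∀ r, 0 ≤ r → Integrable (fun ω => Y ω * B r ω) P := fun r hr =>
    hY.integrable_mul (hB.memLp_two hr)
  have hYJ : Integrable (fun ω => Y ω * J ω) P := by
    have := (integrable_prod_mul_drift a b q hs hX.continuous_extend hX.measurable_extend hY
      (hX.memLp_two_prod_extend hB hs)).integral_prod_right
    simpa [hJ, integral_const_mul, intervalIntegral.integral_of_le hs] using this
  have hinc := hB.integral_mul_increment ht hts hYm hY0
  simp only [mul_sub] at hinc
  rw [integral_sub (hYB s hs) (hYB t ht), sub_eq_zero] at hinc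
  have hae : ∀ᵐ ω ∂P, Y ω * X (max s 0) ω = ψ 0 * Y ω + Y ω * J ω + σ * (Y ω * B s ω) := by
    filter_upwards [hX.ae_eq_extend] with ω hω
    rw [hω s hs]; ring
  have hsum : Integrable (fun ω => ψ 0 * Y ω + Y ω * J ω) P := (hYi.const_mul _).add hYJ
  rw [integral_congr_ae hae, integral_add hsum ((hYB s hs).const_mul σ),
    integral_add (hYi.const_mul _) hYJ, integral_const_mul, integral_const_mul, hY0, hinc]
  ring

end IsSolutionSFDE

theorem rcov_eq_integral_centered_mul {Ω : Type*} {mΩ : MeasurableSpace Ω} {P : Measure Ω}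
    [IsProbabilityMeasure P] {Y Z : Ω → ℝ} (hY : MemLp Y 2 P) (hZ : MemLp Z 2 P) :
    rcov P Y Z = ∫ ω, (Y ω - ∫ ω', Y ω' ∂P) * Z ω ∂P := by
  have hYZ : Integrable (fun ω => Y ω * Z ω) P := hY.integrable_mul hZ
  simp only [sub_mul]
  rw [integral_sub hYZ ((hZ.integrable one_le_two).const_mul _), integral_const_mul, rcov]

theorem sfde_autocovariance_poly_decay {Ω : Type*} {mΩ : MeasurableSpace Ω} (P : Measure Ω) [IsProbabilityMeasure P]
    (F : MeasureTheory.Filtration ℝ mΩ) (a b σ : ℝ) (ψ : ℝ → ℝ) (B X : ℝ → Ω → ℝ)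
    (hσ : 0 < σ) (hψ : ContinuousOn ψ (Set.Icc (-1 : ℝ) 0))
    (hB : IsStdBrownian P F B) (hX : IsSolutionSFDE P F a b σ ψ B X)
    (ha : a < 0) (hab : a + b ≤ 0) (t : ℝ) (ht : 0 ≤ t) :
    ∃ c : ℝ, Filter.Tendsto
      (fun Δ : ℝ => Δ ^ (1 + b / a) * rcov P (X t) (X (t + Δ)))
      Filter.atTop (nhds c) := by
  have hXt : MemLp (X t) 2 P := by simpa [ht] using hX.memLp_two_extend hB ht
  set Y : Ω → ℝ := fun ω => X t ω - ∫ ω', X t ω' ∂P with hYdef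
  have hYm : StronglyMeasurable[F t] Y := (hX.1 t ht).sub stronglyMeasurable_const
  have hY : MemLp Y 2 P := hXt.sub (memLp_const _)
  have hY0 : ∫ ω, Y ω ∂P = 0 := by
    rw [hYdef, integral_sub (hXt.integrable one_le_two) (integrable_const _)]
    simp
  set C : ℝ → ℝ := fun s => ∫ ω, Y ω * X (max s 0) ω ∂P with hC
  obtain ⟨L, hL⟩ := tendsto_rpow_mul_of_integral_equation (C := C) (b := b) ha ht
    (fun T hT => intervalIntegrable_integral_mul hT hY (hX.memLp_two_prod_extend hB hT))
    (fun s hs => hX.integral_mul_eq hB ht hs hYm hY hY0)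
  have hcov : ∀ Δ > 0, rcov P (X t) (X (t + Δ)) = C (t + Δ) := by
    intro Δ hΔ
    have h0 : 0 ≤ t + Δ := by linarith
    have hZ : MemLp (X (t + Δ)) 2 P := by simpa [h0] using hX.memLp_two_extend hB h0
    rw [rcov_eq_integral_centered_mul hXt hZ]
    simp only [hC, hYdef, max_eq_left h0]
  have hratio : Tendsto (fun Δ : ℝ => Δ / (1 + (t + Δ))) atTop (nhds 1) := by
    have htop : Tendsto (fun Δ : ℝ => 1 + (t + Δ)) atTop atTop :=
      tendsto_atTop_add_const_left _ _ (tendsto_atTop_add_const_left _ _ tendsto_id)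
    have h := (htop.const_div_atTop (1 + t)).const_sub 1
    rw [sub_zero] at h
    refine h.congr' ?_
    filter_upwards [eventually_gt_atTop 0] with Δ hΔ
    have : 1 + (t + Δ) ≠ 0 := by linarith
    field_simp
    ring
  refine ⟨1 ^ (1 + b / a) * L, ?_⟩
  have h := (hratio.rpow_const (p := 1 + b / a) (Or.inl one_ne_zero)).mul
    (hL.comp (tendsto_atTop_add_const_left _ t tendsto_id))
  refine h.congr' ?_
  filter_upwards [eventually_gt_atTop 0] with Δ hΔ
  have h1 : 0 < 1 + (t + Δ) := by linarith
  rw [hcov Δ hΔ, Real.div_rpow hΔ.le h1.le]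
  simp only [Function.comp_apply, id_eq]
  have h2 := (Real.rpow_pos_of_pos h1 (1 + b / a)).ne'
  field_simp
end
end
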